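/- Let G and H be finite metacyclic groups with ℚG and ℚH isomorphic as ℚ-algebras, and let p ∈ π_G with (k^G)_p = 1. Then (m^G)_p = (m^H)_p = m^{G_p} and (r^G)_p = (r^H)_p = r^{G_p}, where G_p denotes a Sylow p-subgroup of G. -/

import Mathlib

open scoped Classical

noncomputable section

namespace ArXiv230800432

/-- The `σ`-part of a natural number: product of `p ^ vₚ(n)` over primes `p ∈ σ` dividing `n`. -/
def natPart (n : ℕ) (σ : Set ℕ) : ℕ :=
  ∏ p ∈ n.primeFactors, if p ∈ σ then p ^ (n.factorization p) else 1

/-- A metacyclic factorization `G = A·B` with `A` cyclic normal and `B` cyclic. -/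
structure MetacyclicFact (G : Type*) [Group G] where
  A : Subgroup G
  B : Subgroup G
  normalA : A.Normal
  cyclicA : IsCyclic A
  cyclicB : IsCyclic B
  mul_cover : ∀ g : G, ∃ x ∈ A, ∃ y ∈ B, g = x * y

/-- A group is metacyclic if it admits a metacyclic factorization. -/
def IsMetacyclic (G : Type*) [Group G] : Prop :=
  Nonempty (MetacyclicFact G)

variable {G : Type*} [Group G]

/-- `π_G`: primes `p` dividing `|G|` such that `G` has a normal Hall `p'`-subgroup. -/
def piSet (G : Type*) [Group G] : Set ℕ :=
  {p | p.Prime ∧ p ∣ Nat.card G ∧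
    ∃ N : Subgroup G, N.Normal ∧ Nat.card N = ordCompl[p] (Nat.card G)}

/-- `π'_G = π(G) \ π_G`. -/
def piSet' (G : Type*) [Group G] : Set ℕ :=
  {p | p.Prime ∧ p ∣ Nat.card G} \ piSet G

/-- The image mod `d` of `T_G(A)`: classes `[t]_d` such that some `g ∈ G` acts on `A` by
conjugation as `x ↦ x ^ t`.  For `d = |A|` this is exactly `T_G(A)`. -/
def TGmod (A : Subgroup G) (d : ℕ) : Subgroup (ZMod d)ˣ :=
  Subgroup.closure
    {u : (ZMod d)ˣ | ∃ g : G, ∃ t : ℕ, ((t : ZMod d) = (u : ZMod d)) ∧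
      ∀ x ∈ A, g⁻¹ * x * g = x ^ t}

/-- `T_G(A)` as subgroup of `(ℤ/|A|ℤ)ˣ`. -/
def TG (A : Subgroup G) : Subgroup (ZMod (Nat.card A))ˣ :=
  TGmod A (Nat.card A)

/-- The image of `T` under `Res_q : (ℤ/dℤ)ˣ → (ℤ/qℤ)ˣ` is trivial. -/
def resTriv (d q : ℕ) (T : Subgroup (ZMod d)ˣ) : Prop :=
  ∀ u ∈ T, ∀ t : ℕ, ((t : ZMod d) = (u : ZMod d)) → (t : ZMod q) = 1

/-- The image of `T` under `Res_q` is contained in `⟨-1⟩`. -/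
def resInPMOne (d q : ℕ) (T : Subgroup (ZMod d)ˣ) : Prop :=
  ∀ u ∈ T, ∀ t : ℕ, ((t : ZMod d) = (u : ZMod d)) →
    ((t : ZMod q) = 1 ∨ (t : ZMod q) = -1)

/-- The image of `T` under `Res_q` as a set of units mod `q`. -/
def resSet (d q : ℕ) (T : Subgroup (ZMod d)ˣ) : Set (ZMod q)ˣ :=
  {v | ∃ u ∈ T, ∃ t : ℕ, ((t : ZMod d) = (u : ZMod d)) ∧ ((t : ZMod q) = (v : ZMod q))}

/-- The set of natural numbers representing elements of `T ≤ (ℤ/dℤ)ˣ`. -/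
def liftSet {d : ℕ} (T : Subgroup (ZMod d)ˣ) : Set ℕ :=
  {t | ∃ u ∈ T, (t : ZMod d) = (u : ZMod d)}

/-- `r^G(A)`: the greatest divisor `r` of `|A|` such that `Res_{r_{2'}}(T_G(A)) = 1` and
`Res_{r_2}(T_G(A)) ⊆ ⟨-1⟩`. -/
def rOfA (A : Subgroup G) : ℕ :=
  sSup {r : ℕ | r ∣ Nat.card A ∧ resTriv (Nat.card A) (ordCompl[2] r) (TG A) ∧
    resInPMOne (Nat.card A) (ordProj[2] r) (TG A)}

/-- `ε^G(A)`: `-1` if `Res_{r_2}(T_G(A)) ≠ 1`, and `1` otherwise. -/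
def epsOfA (A : Subgroup G) : ℤ :=
  if resTriv (Nat.card A) (ordProj[2] (rOfA A)) (TG A) then 1 else -1

/-- `k^G(A)`: order of the image of `T_G(A)` in `(ℤ/m_ν ℤ)ˣ`, `ν` the primes dividing `|A|`
but not `r^G(A)`. -/
def kOfA (A : Subgroup G) : ℕ :=
  (resSet (Nat.card A) (natPart (Nat.card A) {p | ¬ p ∣ rOfA A}) (TG A)).ncard

/-- The triple `(|A|, r^G(A), [G:B])` attached to a metacyclic factorization. -/
def factTriple (f : MetacyclicFact G) : ℕ × ℕ × ℕ :=
  (Nat.card f.A, rOfA f.A, f.B.index)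

/-- Lexicographic order on triples. -/
def lex3 (x y : ℕ × ℕ × ℕ) : Prop :=
  x.1 < y.1 ∨ (x.1 = y.1 ∧ (x.2.1 < y.2.1 ∨ (x.2.1 = y.2.1 ∧ x.2.2 ≤ y.2.2)))

/-- A metacyclic factorization is minimal when its triple is lexicographically minimal. -/
def IsMinimalFact (f : MetacyclicFact G) : Prop :=
  ∀ f' : MetacyclicFact G, lex3 (factTriple f) (factTriple f')

def mOf (f : MetacyclicFact G) : ℕ := Nat.card f.A
def nOf (f : MetacyclicFact G) : ℕ := f.A.index
def sOf (f : MetacyclicFact G) : ℕ := f.B.index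
def rOf (f : MetacyclicFact G) : ℕ := rOfA f.A
def epsOf (f : MetacyclicFact G) : ℤ := epsOfA f.A
def kOf (f : MetacyclicFact G) : ℕ := kOfA f.A

/-- The `σ`-part of an element of a finite group. -/
def elemPart (σ : Set ℕ) (g : G) : G :=
  g ^ ((orderOf g / natPart (orderOf g) σ) *
    (((orderOf g / natPart (orderOf g) σ : ℕ) : ZMod (natPart (orderOf g) σ))⁻¹.val))

/-- The (unique, for `N` cyclic) Hall `σ`-subgroup of a subgroup `N`. -/
def hallOf (N : Subgroup G) (σ : Set ℕ) : Subgroup G :=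
  Subgroup.closure {x : G | x ∈ N ∧ orderOf x ∣ natPart (Nat.card N) σ}

/-- `R^G = T_G(G'_{π'})`, realized as a subgroup of `(ℤ/dℤ)ˣ`. -/
def ROf (G : Type*) [Group G] (d : ℕ) : Subgroup (ZMod d)ˣ :=
  TGmod (hallOf (commutator G) (piSet' G)) d

/-- Conjugation by `g` acts on `A` as `x ↦ x ^ t`. -/
def ConjActsAsPow (A : Subgroup G) (g : G) (t : ℕ) : Prop :=
  ∀ x ∈ A, g⁻¹ * x * g = x ^ t

lemma exists_conjActsAsPow [Finite G] (A : Subgroup G) [A.Normal] [IsCyclic A] (g : G) :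
    ∃ t, ConjActsAsPow A g t := by
  obtain ⟨t, ht⟩ := MonoidHom.map_cyclic ((MulAut.conjNormal (H := A) g⁻¹).toMonoidHom)
  have hpos : (0 : ℤ) < Nat.card A := by exact_mod_cast Nat.card_pos
  refine ⟨(t % (Nat.card A : ℤ)).toNat, fun x hx => ?_⟩
  have h1 := congrArg Subtype.val (ht ⟨x, hx⟩)
  simp only [MulEquiv.toMonoidHom_eq_coe, MonoidHom.coe_coe, MulAut.conjNormal_apply, inv_inv,
    Subgroup.coe_zpow] at h1
  rw [h1, ← zpow_natCast, Int.toNat_of_nonneg (Int.emod_nonneg _ hpos.ne')]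
  have h2 : x ^ (Nat.card A : ℤ) = 1 := by
    rw [zpow_natCast]
    exact congrArg Subtype.val (pow_card_eq_one' (x := (⟨x, hx⟩ : A)))
  conv_lhs => rw [← Int.emod_add_mul_ediv t (Nat.card A), zpow_add, zpow_mul, h2, one_zpow, mul_one]

lemma exists_generator (A : Subgroup G) [IsCyclic A] :
    ∃ a ∈ A, Subgroup.zpowers a = A := by
  obtain ⟨a, ha⟩ := IsCyclic.exists_generator (α := A)
  refine ⟨a, a.2, le_antisymm (by simp) fun x hx => ?_⟩
  obtain ⟨k, hk⟩ := ha ⟨x, hx⟩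
  exact ⟨k, by simpa using congrArg Subtype.val hk⟩

lemma pow_eq_one_iff_natCast_eq [Finite G] {A : Subgroup G} {a : G}
    (ha : Subgroup.zpowers a = A) (s t : ℕ) :
    a ^ s = a ^ t ↔ (s : ZMod (Nat.card A)) = t := by
  rw [pow_eq_pow_iff_modEq, ← Nat.card_zpowers, ha, ZMod.natCast_eq_natCast_iff]

lemma ConjActsAsPow.mul {A : Subgroup G} [A.Normal] {g h : G} {s t : ℕ}
    (hg : ConjActsAsPow A g s) (hh : ConjActsAsPow A h t) : ConjActsAsPow A (g * h) (s * t) := by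
  intro x hx
  have : (g * h)⁻¹ * x * (g * h) = h⁻¹ * (g⁻¹ * x * g) * h := by group
  rw [this, hg x hx, hh _ (A.pow_mem hx _), pow_mul]

lemma ConjActsAsPow.pow {A : Subgroup G} [A.Normal] {g : G} {s : ℕ}
    (hg : ConjActsAsPow A g s) (k : ℕ) : ConjActsAsPow A (g ^ k) (s ^ k) := by
  induction k with
  | zero => intro x _; simp
  | succ k ih => rw [pow_succ, pow_succ]; exact ih.mul hg

lemma ConjActsAsPow.natCast_eq [Finite G] {A : Subgroup G} [IsCyclic A] {g : G} {s t : ℕ}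
    (hs : ConjActsAsPow A g s) (ht : ConjActsAsPow A g t) :
    (s : ZMod (Nat.card A)) = t := by
  obtain ⟨a, haA, ha⟩ := exists_generator A
  rw [← pow_eq_one_iff_natCast_eq ha, ← hs a haA, ht a haA]

lemma ConjActsAsPow.isUnit [Finite G] {A : Subgroup G} [A.Normal] [IsCyclic A] {g : G} {t : ℕ}
    (ht : ConjActsAsPow A g t) : IsUnit (t : ZMod (Nat.card A)) := by
  obtain ⟨s, hs⟩ := exists_conjActsAsPow A g⁻¹
  have h1 := ht.mul hs
  rw [mul_inv_cancel] at h1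
  have h2 : ConjActsAsPow A (1 : G) 1 := fun x _ => by simp
  refine IsUnit.of_mul_eq_one (s : ZMod (Nat.card A)) ?_
  have := h1.natCast_eq h2
  push_cast at this
  exact this

lemma natCast_eq_castHom {m d : ℕ} (h : d ∣ m) {t : ℕ} {u : ZMod m} (ht : (t : ZMod m) = u) :
    (t : ZMod d) = ZMod.castHom h (ZMod d) u := by
  rw [← ht, map_natCast]

lemma unitsMap_val {m d : ℕ} (h : d ∣ m) {t : ℕ} {u : (ZMod m)ˣ} (ht : (t : ZMod m) = u) :
    ((ZMod.unitsMap h u : (ZMod d)ˣ) : ZMod d) = t := by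
  rw [natCast_eq_castHom h ht]; rfl

lemma exists_natCast_eq {m : ℕ} [NeZero m] (u : ZMod m) : ∃ t : ℕ, (t : ZMod m) = u :=
  ⟨u.val, ZMod.natCast_zmod_val u⟩

lemma TG_le_iff [Finite G] (A : Subgroup G) [A.Normal] [IsCyclic A] {d : ℕ} (hd : d ∣ Nat.card A)
    (K : Subgroup (ZMod d)ˣ) :
    (∀ u ∈ TG A, ∀ t : ℕ, (t : ZMod (Nat.card A)) = u → ∃ v ∈ K, (t : ZMod d) = v) ↔
      ∀ g t, ConjActsAsPow A g t → ∃ v ∈ K, (t : ZMod d) = v := by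
  have : NeZero (Nat.card A) := ⟨Nat.card_pos.ne'⟩
  constructor
  · intro H g t hgt
    exact H hgt.isUnit.unit (Subgroup.subset_closure ⟨g, t, by simp, hgt⟩) t (by simp)
  · intro H u hu t ht
    have hle : TG A ≤ K.comap (ZMod.unitsMap hd) := by
      refine (Subgroup.closure_le _).2 ?_
      rintro u ⟨g, t, htu, hgt⟩
      obtain ⟨v, hv, htv⟩ := H g t hgt
      have : ZMod.unitsMap hd u = v := Units.ext (by rw [unitsMap_val hd htu, htv])
      simpa [this] using hv
    exact ⟨_, hle hu, (unitsMap_val hd ht).symm⟩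

lemma resTriv_iff [Finite G] (A : Subgroup G) [A.Normal] [IsCyclic A] {d : ℕ}
    (hd : d ∣ Nat.card A) :
    resTriv (Nat.card A) d (TG A) ↔ ∀ g t, ConjActsAsPow A g t → (t : ZMod d) = 1 := by
  simpa [resTriv] using TG_le_iff A hd ⊥

lemma resInPMOne_iff [Finite G] (A : Subgroup G) [A.Normal] [IsCyclic A] {d : ℕ}
    (hd : d ∣ Nat.card A) :
    resInPMOne (Nat.card A) d (TG A) ↔
      ∀ g t, ConjActsAsPow A g t → ((t : ZMod d) = 1 ∨ (t : ZMod d) = -1) := by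
  have key : ∀ t : ℕ, (∃ v ∈ Subgroup.zpowers (-1 : (ZMod d)ˣ), (t : ZMod d) = v) ↔
      ((t : ZMod d) = 1 ∨ (t : ZMod d) = -1) := by
    intro t
    constructor
    · rintro ⟨v, ⟨k, rfl⟩, h⟩
      rcases Int.even_or_odd k with hk | hk
      · left; simpa [hk.neg_one_zpow] using h
      · right; simpa [hk.neg_one_zpow] using h
    · rintro (h | h)
      · exact ⟨1, one_mem _, by simpa using h⟩
      · exact ⟨-1, Subgroup.mem_zpowers _, by simpa using h⟩
  have := TG_le_iff A hd (Subgroup.zpowers (-1))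
  simp only [key] at this
  exact this

/-- The local condition at the prime power `q ^ k` in the definition of `r^G(A)`. -/
def PMOneAt (A : Subgroup G) (q k : ℕ) : Prop :=
  q ^ k ∣ Nat.card A ∧ ∀ g t, ConjActsAsPow A g t →
    ((t : ZMod (q ^ k)) = 1 ∨ (q = 2 ∧ (t : ZMod (q ^ k)) = -1))

lemma natCast_eq_one_of_dvd {d e t : ℕ} (h : d ∣ e) (ht : (t : ZMod e) = 1) :
    (t : ZMod d) = 1 := by
  have := congrArg (ZMod.castHom h (ZMod d)) ht
  rwa [map_natCast, map_one] at this

lemma natCast_eq_neg_one_of_dvd {d e t : ℕ} (h : d ∣ e) (ht : (t : ZMod e) = -1) :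
    (t : ZMod d) = -1 := by
  have := congrArg (ZMod.castHom h (ZMod d)) ht
  rwa [map_natCast, map_neg, map_one] at this

lemma natCast_eq_one_iff_dvd {d t : ℕ} : (t : ZMod d) = 1 ↔ (d : ℤ) ∣ (t : ℤ) - 1 := by
  rw [← ZMod.intCast_zmod_eq_zero_iff_dvd]
  push_cast
  rw [sub_eq_zero]

/-- The set whose supremum is `r^G(A)`. -/
def rSet (A : Subgroup G) : Set ℕ :=
  {r : ℕ | r ∣ Nat.card A ∧ resTriv (Nat.card A) (ordCompl[2] r) (TG A) ∧
    resInPMOne (Nat.card A) (ordProj[2] r) (TG A)}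

lemma mem_rSet_iff [Finite G] (A : Subgroup G) [A.Normal] [IsCyclic A] {r : ℕ}
    (hr : r ∣ Nat.card A) :
    r ∈ rSet A ↔ ∀ q k, q.Prime → q ^ k ∣ r → PMOneAt A q k := by
  have hr0 : r ≠ 0 := ne_zero_of_dvd_ne_zero Nat.card_pos.ne' hr
  have h1 : ordCompl[2] r ∣ r := Nat.ordCompl_dvd r 2
  have h2 : ordProj[2] r ∣ r := Nat.ordProj_dvd r 2
  simp only [rSet, Set.mem_ofPred_eq, hr, true_and, resTriv_iff A (h1.trans hr),
    resInPMOne_iff A (h2.trans hr)]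
  constructor
  · rintro ⟨ha, hb⟩ q k hq hqk
    refine ⟨hqk.trans hr, fun g t hgt => ?_⟩
    by_cases h : q = 2
    · subst h
      have hd : 2 ^ k ∣ ordProj[2] r :=
        pow_dvd_pow 2 ((hq.pow_dvd_iff_le_factorization hr0).1 hqk)
      rcases hb g t hgt with h | h
      · exact Or.inl (natCast_eq_one_of_dvd hd h)
      · exact Or.inr ⟨rfl, natCast_eq_neg_one_of_dvd hd h⟩
    · left
      have hc : Nat.Coprime (q ^ k) (ordProj[2] r) :=
        Nat.Coprime.pow _ _ ((Nat.coprime_primes hq Nat.prime_two).2 h)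
      have hd : q ^ k ∣ ordCompl[2] r := by
        rw [← Nat.ordProj_mul_ordCompl_eq_self r 2] at hqk
        exact hc.dvd_of_dvd_mul_left hqk
      exact natCast_eq_one_of_dvd hd (ha g t hgt)
  · intro H
    refine ⟨fun g t hgt => ?_, fun g t hgt => ?_⟩
    · rw [natCast_eq_one_iff_dvd, Int.natCast_dvd, Nat.dvd_iff_prime_pow_dvd_dvd]
      intro q k hq hqk
      rcases Nat.eq_zero_or_pos k with rfl | hk
      · simp
      have hq2 : q ≠ 2 := by
        rintro rfl
        exact Nat.not_dvd_ordCompl Nat.prime_two hr0 ((dvd_pow_self 2 hk.ne').trans hqk)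
      rw [← Int.natCast_dvd, ← natCast_eq_one_iff_dvd]
      exact ((H q k hq (hqk.trans h1)).2 g t hgt).resolve_right fun h => hq2 h.1
    · rcases (H 2 _ Nat.prime_two h2).2 g t hgt with h | h
      · exact Or.inl h
      · exact Or.inr h.2

lemma PMOneAt.mono {A : Subgroup G} {q k l : ℕ} (h : PMOneAt A q k) (hl : l ≤ k) :
    PMOneAt A q l := by
  have hd : q ^ l ∣ q ^ k := pow_dvd_pow q hl
  refine ⟨hd.trans h.1, fun g t hgt => ?_⟩
  rcases h.2 g t hgt with h | h
  · exact Or.inl (natCast_eq_one_of_dvd hd h)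
  · exact Or.inr ⟨h.1, natCast_eq_neg_one_of_dvd hd h.2⟩

lemma rSet_finite [Finite G] (A : Subgroup G) : (rSet A).Finite :=
  (Set.finite_Iic (Nat.card A)).subset fun _ hr => Nat.le_of_dvd Nat.card_pos hr.1

lemma rOfA_mem [Finite G] (A : Subgroup G) [A.Normal] [IsCyclic A] : rOfA A ∈ rSet A := by
  refine Nat.sSup_mem ⟨1, ?_⟩ (rSet_finite A).bddAbove
  rw [mem_rSet_iff A (one_dvd _)]
  intro q k hq hqk
  have h1 : q ^ k = 1 := Nat.dvd_one.1 hqk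
  refine ⟨by rw [h1]; exact one_dvd _, fun g t _ => Or.inl ?_⟩
  rw [natCast_eq_one_iff_dvd, h1]
  simp

lemma rOfA_dvd_card [Finite G] (A : Subgroup G) [A.Normal] [IsCyclic A] :
    rOfA A ∣ Nat.card A := (rOfA_mem A).1

lemma rOfA_pos [Finite G] (A : Subgroup G) [A.Normal] [IsCyclic A] : 0 < rOfA A :=
  Nat.pos_of_dvd_of_pos (rOfA_dvd_card A) Nat.card_pos

lemma prime_pow_dvd_rOfA_iff [Finite G] (A : Subgroup G) [A.Normal] [IsCyclic A] {q k : ℕ}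
    (hq : q.Prime) : q ^ k ∣ rOfA A ↔ PMOneAt A q k := by
  constructor
  · exact (mem_rSet_iff A (rOfA_dvd_card A)).1 (rOfA_mem A) q k hq
  · intro h
    by_contra hcon
    have hr0 : rOfA A ≠ 0 := (rOfA_pos A).ne'
    have hlt : (rOfA A).factorization q < k := by
      rw [hq.pow_dvd_iff_le_factorization hr0] at hcon; omega
    set c := ordCompl[q] (rOfA A) with hc
    have hcop : Nat.Coprime (q ^ k) c := (Nat.coprime_ordCompl hq hr0).pow_left k
    have hcd : c ∣ rOfA A := Nat.ordCompl_dvd _ _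
    have hdvd : q ^ k * c ∣ Nat.card A :=
      hcop.mul_dvd_of_dvd_of_dvd h.1 (hcd.trans (rOfA_dvd_card A))
    have hmem : q ^ k * c ∈ rSet A := by
      rw [mem_rSet_iff A hdvd]
      intro l j hl hlj
      by_cases hlq : l = q
      · subst hlq
        have : l ^ j ∣ l ^ k := (Nat.Coprime.pow_left j
          (Nat.coprime_ordCompl hq hr0)).dvd_of_dvd_mul_right hlj
        exact h.mono ((Nat.pow_dvd_pow_iff_le_right hl.one_lt).1 this)
      · have : l ^ j ∣ c :=
          (Nat.Coprime.pow _ _ ((Nat.coprime_primes hl hq).2 hlq)).dvd_of_dvd_mul_left hlj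
        exact (mem_rSet_iff A (rOfA_dvd_card A)).1 (rOfA_mem A) l j hl (this.trans hcd)
    have hle : q ^ k * c ≤ rOfA A := le_csSup (rSet_finite A).bddAbove hmem
    have hlt' : rOfA A < q ^ k * c := by
      conv_lhs => rw [← Nat.ordProj_mul_ordCompl_eq_self (rOfA A) q]
      exact Nat.mul_lt_mul_of_pos_right (Nat.pow_lt_pow_right hq.one_lt hlt)
        (Nat.pos_of_dvd_of_pos hcd (rOfA_pos A))
    omega

lemma eq_of_prime_pow_dvd_iff {a b : ℕ}
    (h : ∀ q k, q.Prime → (q ^ k ∣ a ↔ q ^ k ∣ b)) : a = b :=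
  Nat.dvd_antisymm ((Nat.dvd_iff_prime_pow_dvd_dvd _ _).2 fun q k hq hd => (h q k hq).1 hd)
    ((Nat.dvd_iff_prime_pow_dvd_dvd _ _).2 fun q k hq hd => (h q k hq).2 hd)

lemma exists_isMinimalFact (f₀ : MetacyclicFact G) : ∃ f : MetacyclicFact G, IsMinimalFact f := by
  let μ : MetacyclicFact G → ℕ ×ₗ (ℕ ×ₗ ℕ) := fun f =>
    toLex (Nat.card f.A, toLex (rOfA f.A, f.B.index))
  obtain ⟨f, -, hf⟩ := WellFounded.has_min (InvImage.wf μ wellFounded_lt) Set.univ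
    ⟨f₀, Set.mem_univ _⟩
  refine ⟨f, fun f' => ?_⟩
  have h := hf f' (Set.mem_univ _)
  simp only [InvImage, μ, Prod.Lex.toLex_lt_toLex, factTriple, lex3] at h ⊢
  omega

/-- The image of a metacyclic factorization under a surjective homomorphism. -/
def MetacyclicFact.map {G' : Type*} [Group G'] (f : MetacyclicFact G) (φ : G →* G')
    (hφ : Function.Surjective φ) : MetacyclicFact G' where
  A := f.A.map φ
  B := f.B.map φ
  normalA := f.normalA.map φ hφ
  cyclicA := by
    have := f.cyclicA
    exact isCyclic_of_surjective (φ.subgroupMap f.A) (φ.subgroupMap_surjective f.A)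
  cyclicB := by
    have := f.cyclicB
    exact isCyclic_of_surjective (φ.subgroupMap f.B) (φ.subgroupMap_surjective f.B)
  mul_cover := by
    intro g'
    obtain ⟨g, rfl⟩ := hφ g'
    obtain ⟨x, hx, y, hy, rfl⟩ := f.mul_cover g
    exact ⟨φ x, Subgroup.mem_map_of_mem _ hx, φ y, Subgroup.mem_map_of_mem _ hy, map_mul _ _ _⟩

lemma conjActsAsPow_map_iff {G' : Type*} [Group G'] (e : G ≃* G') (A : Subgroup G) (g : G)
    (t : ℕ) : ConjActsAsPow (A.map e.toMonoidHom) (e g) t ↔ ConjActsAsPow A g t := by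
  constructor
  · intro h x hx
    apply e.injective
    simpa using h (e x) (Subgroup.mem_map_of_mem e.toMonoidHom hx)
  · rintro h _ ⟨x, hx, rfl⟩
    simpa using congrArg e (h x hx)

lemma card_map_equiv {G' : Type*} [Group G'] (e : G ≃* G') (A : Subgroup G) :
    Nat.card (A.map e.toMonoidHom) = Nat.card A :=
  (Nat.card_congr (e.subgroupMap A).toEquiv).symm

lemma rOfA_map_equiv {G' : Type*} [Group G'] [Finite G] (e : G ≃* G') (A : Subgroup G)
    [hA : A.Normal] [IsCyclic A] : rOfA (A.map e.toMonoidHom) = rOfA A := by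
  have : Finite G' := Finite.of_equiv G e.toEquiv
  have h1 : (A.map e.toMonoidHom).Normal := hA.map _ e.surjective
  have h2 : IsCyclic (A.map e.toMonoidHom) :=
    isCyclic_of_surjective (e.subgroupMap A) (e.subgroupMap A).surjective
  refine eq_of_prime_pow_dvd_iff fun q k hq => ?_
  rw [prime_pow_dvd_rOfA_iff _ hq, prime_pow_dvd_rOfA_iff _ hq, PMOneAt, PMOneAt,
    card_map_equiv]
  refine and_congr_right fun _ => ⟨fun h g t hgt => ?_, fun h g' t hgt => ?_⟩
  · exact h (e g) t ((conjActsAsPow_map_iff e A g t).2 hgt)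
  · obtain ⟨g, rfl⟩ := e.surjective g'
    exact h g t ((conjActsAsPow_map_iff e A g t).1 hgt)

lemma factTriple_map_equiv {G' : Type*} [Group G'] [Finite G] (e : G ≃* G')
    (f : MetacyclicFact G) :
    factTriple (f.map e.toMonoidHom e.surjective) = factTriple f := by
  have := f.normalA
  have := f.cyclicA
  simp only [factTriple, MetacyclicFact.map]
  have hB : (f.B.map e.toMonoidHom).index = f.B.index := Subgroup.index_map_equiv f.B e
  rw [card_map_equiv, rOfA_map_equiv, hB]

lemma IsMinimalFact.map_equiv {G' : Type*} [Group G'] [Finite G] (e : G ≃* G')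
    {f : MetacyclicFact G} (hf : IsMinimalFact f) :
    IsMinimalFact (f.map e.toMonoidHom e.surjective) := by
  intro f'
  have : Finite G' := Finite.of_equiv G e.toEquiv
  rw [factTriple_map_equiv, ← factTriple_map_equiv e.symm f']
  exact hf _

section Prod

variable {P N : Type*} [Group P] [Group N]

lemma isCyclic_subgroup_prod [Finite P] [Finite N] (hc : (Nat.card P).Coprime (Nat.card N))
    {A₁ : Subgroup P} {A₂ : Subgroup N} (h₁ : IsCyclic A₁) (h₂ : IsCyclic A₂) :
    IsCyclic (A₁.prod A₂) := by
  have : IsCyclic (A₁ × A₂) := Group.isCyclic_prod_iff.2 ⟨h₁, h₂,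
    Nat.Coprime.coprime_dvd_left A₁.card_subgroup_dvd_card
      (Nat.Coprime.coprime_dvd_right A₂.card_subgroup_dvd_card hc)⟩
  exact (Subgroup.prodEquiv A₁ A₂).symm.isCyclic.1 this

/-- The product of two metacyclic factorizations of groups of coprime orders. -/
def MetacyclicFact.prod [Finite P] [Finite N] (hc : (Nat.card P).Coprime (Nat.card N))
    (f₁ : MetacyclicFact P) (f₂ : MetacyclicFact N) : MetacyclicFact (P × N) where
  A := f₁.A.prod f₂.A
  B := f₁.B.prod f₂.B
  normalA := by
    have := f₁.normalA
    have := f₂.normalA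
    infer_instance
  cyclicA := isCyclic_subgroup_prod hc f₁.cyclicA f₂.cyclicA
  cyclicB := isCyclic_subgroup_prod hc f₁.cyclicB f₂.cyclicB
  mul_cover := by
    rintro ⟨g, h⟩
    obtain ⟨x, hx, y, hy, rfl⟩ := f₁.mul_cover g
    obtain ⟨x', hx', y', hy', rfl⟩ := f₂.mul_cover h
    exact ⟨(x, x'), ⟨hx, hx'⟩, (y, y'), ⟨hy, hy'⟩, rfl⟩

lemma card_subgroup_prod (A₁ : Subgroup P) (A₂ : Subgroup N) :
    Nat.card (A₁.prod A₂) = Nat.card A₁ * Nat.card A₂ := by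
  rw [Nat.card_congr (Subgroup.prodEquiv A₁ A₂).toEquiv, Nat.card_prod]

lemma eq_prod_map_of_isCyclic [Finite P] [Finite N] (hc : (Nat.card P).Coprime (Nat.card N))
    (A : Subgroup (P × N)) :
    A = (A.map (MonoidHom.fst P N)).prod (A.map (MonoidHom.snd P N)) := by
  have hle : A ≤ (A.map (MonoidHom.fst P N)).prod (A.map (MonoidHom.snd P N)) :=
    fun x hx => ⟨Subgroup.mem_map_of_mem _ hx, Subgroup.mem_map_of_mem _ hx⟩
  refine Subgroup.eq_of_le_of_card_ge hle ?_
  rw [card_subgroup_prod]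
  refine Nat.le_of_dvd Nat.card_pos (Nat.Coprime.mul_dvd_of_dvd_of_dvd ?_
    (Subgroup.card_map_dvd A (MonoidHom.fst P N)) (Subgroup.card_map_dvd A (MonoidHom.snd P N)))
  exact Nat.Coprime.coprime_dvd_left (Subgroup.card_subgroup_dvd_card _)
    (Nat.Coprime.coprime_dvd_right (Subgroup.card_subgroup_dvd_card _) hc)

lemma ConjActsAsPow.fst {A₁ : Subgroup P} {A₂ : Subgroup N} {g : P × N} {t : ℕ}
    (h : ConjActsAsPow (A₁.prod A₂) g t) : ConjActsAsPow A₁ g.1 t := fun x hx => by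
  simpa using congrArg Prod.fst (h (x, 1) ⟨hx, A₂.one_mem⟩)

lemma ConjActsAsPow.snd {A₁ : Subgroup P} {A₂ : Subgroup N} {g : P × N} {t : ℕ}
    (h : ConjActsAsPow (A₁.prod A₂) g t) : ConjActsAsPow A₂ g.2 t := fun x hx => by
  simpa using congrArg Prod.snd (h (1, x) ⟨A₁.one_mem, hx⟩)

lemma pmOneAt_prod_iff_left [Finite P] [Finite N] (hc : (Nat.card P).Coprime (Nat.card N))
    (A₁ : Subgroup P) (A₂ : Subgroup N) [A₁.Normal] [A₂.Normal] [IsCyclic A₁] [IsCyclic A₂]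
    {q k : ℕ} (hqk : q ^ k ∣ Nat.card A₁) :
    PMOneAt (A₁.prod A₂) q k ↔ PMOneAt A₁ q k := by
  constructor
  · refine fun h => ⟨hqk, fun g t hgt => ?_⟩
    have := isCyclic_subgroup_prod hc (A₁ := A₁) (A₂ := A₂) inferInstance inferInstance
    obtain ⟨t', ht'⟩ := exists_conjActsAsPow (A₁.prod A₂) (g, (1 : N))
    have h1 : (t : ZMod (q ^ k)) = t' := by
      have := (ZMod.natCast_eq_natCast_iff _ _ _).1 (hgt.natCast_eq ht'.fst)
      exact (ZMod.natCast_eq_natCast_iff _ _ _).2 (this.of_dvd hqk)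
    rw [h1]
    exact h.2 _ t' ht'
  · refine fun h => ⟨hqk.trans ?_, fun g t hgt => h.2 _ t hgt.fst⟩
    rw [card_subgroup_prod]
    exact dvd_mul_right _ _

lemma pmOneAt_prod_iff_right [Finite P] [Finite N] (hc : (Nat.card P).Coprime (Nat.card N))
    (A₁ : Subgroup P) (A₂ : Subgroup N) [A₁.Normal] [A₂.Normal] [IsCyclic A₁] [IsCyclic A₂]
    {q k : ℕ} (hqk : q ^ k ∣ Nat.card A₂) :
    PMOneAt (A₁.prod A₂) q k ↔ PMOneAt A₂ q k := by
  constructor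
  · refine fun h => ⟨hqk, fun g t hgt => ?_⟩
    have := isCyclic_subgroup_prod hc (A₁ := A₁) (A₂ := A₂) inferInstance inferInstance
    obtain ⟨t', ht'⟩ := exists_conjActsAsPow (A₁.prod A₂) ((1 : P), g)
    have h1 : (t : ZMod (q ^ k)) = t' := by
      have := (ZMod.natCast_eq_natCast_iff _ _ _).1 (hgt.natCast_eq ht'.snd)
      exact (ZMod.natCast_eq_natCast_iff _ _ _).2 (this.of_dvd hqk)
    rw [h1]
    exact h.2 _ t' ht'
  · refine fun h => ⟨hqk.trans ?_, fun g t hgt => h.2 _ t hgt.snd⟩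
    rw [card_subgroup_prod]
    exact dvd_mul_left _ _

lemma prime_pow_dvd_mul_iff_of_coprime {a b q k : ℕ} (hq : q.Prime) (hab : a.Coprime b) :
    q ^ k ∣ a * b ↔ q ^ k ∣ a ∨ q ^ k ∣ b := by
  refine ⟨fun h => ?_, fun h => h.elim (·.mul_right _) (·.mul_left _)⟩
  by_cases hqa : q ∣ a
  · have : (q ^ k).Coprime b :=
      Nat.Coprime.pow_left _ (Nat.Coprime.coprime_dvd_left hqa hab)
    exact Or.inl (this.dvd_of_dvd_mul_right h)
  · have : (q ^ k).Coprime a := Nat.Coprime.pow_left _ ((Nat.Prime.coprime_iff_not_dvd hq).2 hqa)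
    exact Or.inr (this.dvd_of_dvd_mul_left h)

lemma rOfA_prod [Finite P] [Finite N] (hc : (Nat.card P).Coprime (Nat.card N))
    (A₁ : Subgroup P) (A₂ : Subgroup N) [A₁.Normal] [A₂.Normal] [IsCyclic A₁] [IsCyclic A₂] :
    rOfA (A₁.prod A₂) = rOfA A₁ * rOfA A₂ := by
  have := isCyclic_subgroup_prod hc (A₁ := A₁) (A₂ := A₂) inferInstance inferInstance
  have hc' : (Nat.card A₁).Coprime (Nat.card A₂) :=
    Nat.Coprime.coprime_dvd_left A₁.card_subgroup_dvd_card
      (Nat.Coprime.coprime_dvd_right A₂.card_subgroup_dvd_card hc)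
  have hcr : (rOfA A₁).Coprime (rOfA A₂) :=
    Nat.Coprime.coprime_dvd_left (rOfA_dvd_card A₁)
      (Nat.Coprime.coprime_dvd_right (rOfA_dvd_card A₂) hc')
  refine eq_of_prime_pow_dvd_iff fun q k hq => ?_
  rw [prime_pow_dvd_mul_iff_of_coprime hq hcr, prime_pow_dvd_rOfA_iff _ hq,
    prime_pow_dvd_rOfA_iff _ hq, prime_pow_dvd_rOfA_iff _ hq]
  constructor
  · intro h
    have h1 := h.1
    rw [card_subgroup_prod, prime_pow_dvd_mul_iff_of_coprime hq hc'] at h1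
    rcases h1 with h1 | h1
    · exact Or.inl ((pmOneAt_prod_iff_left hc A₁ A₂ h1).1 h)
    · exact Or.inr ((pmOneAt_prod_iff_right hc A₁ A₂ h1).1 h)
  · rintro (h | h)
    · exact (pmOneAt_prod_iff_left hc A₁ A₂ h.1).2 h
    · exact (pmOneAt_prod_iff_right hc A₁ A₂ h.1).2 h

/-- In a direct product of groups of coprime orders, the first factor of a minimal factorization
has the same invariants as any minimal factorization of the first factor. -/
lemma IsMinimalFact.of_prod [Finite P] [Finite N] (hc : (Nat.card P).Coprime (Nat.card N))
    {f : MetacyclicFact (P × N)} (hf : IsMinimalFact f) {f₁ : MetacyclicFact P}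
    (hf₁ : IsMinimalFact f₁) :
    ∃ a b, mOf f = mOf f₁ * a ∧ a ∣ Nat.card N ∧ rOf f = rOf f₁ * b ∧ b ∣ Nat.card N := by
  set f₁' := f.map (MonoidHom.fst P N) Prod.fst_surjective with hf₁'
  set f₂ := f.map (MonoidHom.snd P N) Prod.snd_surjective with hf₂
  have i1 := f₁.normalA
  have i2 := f₁.cyclicA
  have i3 := f₂.normalA
  have i4 := f₂.cyclicA
  have i5 := f₁'.normalA
  have i6 := f₁'.cyclicA
  have hA : f.A = f₁'.A.prod f₂.A := eq_prod_map_of_isCyclic hc f.A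
  have h1 := hf (f₁.prod hc f₂)
  have h2 := hf₁ f₁'
  have e1 : (f₁.prod hc f₂).A = f₁.A.prod f₂.A := rfl
  simp only [lex3, factTriple, e1] at h1 h2
  rw [hA, card_subgroup_prod, card_subgroup_prod, rOfA_prod hc, rOfA_prod hc] at h1
  have p2 : 0 < Nat.card f₂.A := Nat.card_pos
  have p4 : 0 < rOfA f₂.A := rOfA_pos _
  rw [Nat.mul_lt_mul_right p2, Nat.mul_lt_mul_right p4, Nat.mul_left_inj p2.ne',
    Nat.mul_left_inj p4.ne'] at h1
  have hm : Nat.card f₁'.A = Nat.card f₁.A := by omega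
  have hr : rOfA f₁'.A = rOfA f₁.A := by omega
  refine ⟨Nat.card f₂.A, rOfA f₂.A, ?_, f₂.A.card_subgroup_dvd_card, ?_,
    (rOfA_dvd_card _).trans f₂.A.card_subgroup_dvd_card⟩
  · rw [mOf, hA, card_subgroup_prod, hm, mOf]
  · rw [rOf, hA, rOfA_prod hc, hr, rOf]

end Prod

section GroupAlgebra

/-- The coefficient at `1` of an element of the rational group algebra. -/
def tau (G : Type*) [Group G] : MonoidAlgebra ℚ G →ₗ[ℚ] ℚ where
  toFun x := x.coeff 1
  map_add' _ _ := rfl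
  map_smul' _ _ := rfl

lemma tau_apply (x : MonoidAlgebra ℚ G) : tau G x = x.coeff 1 := rfl

/-- The averaging map `x ↦ ∑ g⁻¹ x g`. -/
def conjSum (G : Type*) [Group G] [Finite G] : MonoidAlgebra ℚ G →ₗ[ℚ] MonoidAlgebra ℚ G :=
  letI := Fintype.ofFinite G
  ∑ g : G, LinearMap.mulLeft ℚ (MonoidAlgebra.single g⁻¹ 1) ∘ₗ
    LinearMap.mulRight ℚ (MonoidAlgebra.single g 1)

lemma tau_mul_single (x : MonoidAlgebra ℚ G) (g : G) :
    tau G (x * MonoidAlgebra.single g⁻¹ 1) = x.coeff g := by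
  simp [tau_apply, MonoidAlgebra.coeff_mul_single_apply]

lemma tau_mul_comm (x y : MonoidAlgebra ℚ G) : tau G (x * y) = tau G (y * x) := by
  induction x using MonoidAlgebra.induction_linear with
  | zero => simp
  | add f g hf hg => simp [add_mul, mul_add, hf, hg]
  | single g a =>
    simp [tau_apply, MonoidAlgebra.coeff_mul_single_apply, MonoidAlgebra.coeff_single_mul_apply,
      mul_comm]

lemma eq_of_tau_mul_eq {x y : MonoidAlgebra ℚ G} (h : ∀ z, tau G (x * z) = tau G (y * z)) :
    x = y := by
  ext g
  rw [← tau_mul_single, ← tau_mul_single, h]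

lemma trace_eq_sum {X : Type*} [Fintype X] (f : MonoidAlgebra ℚ X →ₗ[ℚ] MonoidAlgebra ℚ X) :
    LinearMap.trace ℚ _ f = ∑ g : X, (f (MonoidAlgebra.single g 1)).coeff g := by
  rw [LinearMap.trace_eq_matrix_trace ℚ (MonoidAlgebra.basis X ℚ), Matrix.trace]
  refine Finset.sum_congr rfl fun g _ => ?_
  simp [LinearMap.toMatrix_apply, MonoidAlgebra.basis]

lemma trace_mulLeft [Finite G] (x : MonoidAlgebra ℚ G) :
    LinearMap.trace ℚ _ (LinearMap.mulLeft ℚ x) = Nat.card G * tau G x := by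
  have := Fintype.ofFinite G
  rw [trace_eq_sum]
  simp [MonoidAlgebra.coeff_mul_single_apply, tau_apply]

lemma trace_mulLeft_mulRight [Finite G] (a b : MonoidAlgebra ℚ G) :
    LinearMap.trace ℚ _ (LinearMap.mulLeft ℚ a ∘ₗ LinearMap.mulRight ℚ b) =
      tau G (conjSum G a * b) := by
  let := Fintype.ofFinite G
  rw [trace_eq_sum, conjSum, LinearMap.sum_apply, Finset.sum_mul, map_sum]
  refine Finset.sum_congr rfl fun g _ => ?_
  rw [← tau_mul_single, tau_mul_comm]
  simp [mul_assoc]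

/-- The Casimir-type element `∑ [g, h]` of the group algebra. -/
def commSum (G : Type*) [Group G] [Finite G] : MonoidAlgebra ℚ G :=
  letI := Fintype.ofFinite G
  ∑ g : G, conjSum G (MonoidAlgebra.single g 1) * MonoidAlgebra.single g⁻¹ 1

lemma trace_mulLeft_conjSum [Finite G] (b : MonoidAlgebra ℚ G) :
    LinearMap.trace ℚ _ (LinearMap.mulLeft ℚ b ∘ₗ conjSum G) = tau G (commSum G * b) := by
  let := Fintype.ofFinite G
  rw [trace_eq_sum, tau_mul_comm, commSum, Finset.mul_sum, map_sum]
  refine Finset.sum_congr rfl fun g _ => ?_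
  rw [← mul_assoc, tau_mul_single]
  simp

variable {H : Type*} [Group H]

lemma card_eq_of_algEquiv (φ : MonoidAlgebra ℚ G ≃ₐ[ℚ] MonoidAlgebra ℚ H) :
    Nat.card G = Nat.card H := by
  have h := φ.toLinearEquiv.finrank_eq
  rwa [Module.finrank_eq_nat_card_basis (MonoidAlgebra.basis G ℚ),
    Module.finrank_eq_nat_card_basis (MonoidAlgebra.basis H ℚ)] at h

lemma trace_conj_algEquiv (φ : MonoidAlgebra ℚ G ≃ₐ[ℚ] MonoidAlgebra ℚ H)
    {f : MonoidAlgebra ℚ G →ₗ[ℚ] MonoidAlgebra ℚ G}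
    {f' : MonoidAlgebra ℚ H →ₗ[ℚ] MonoidAlgebra ℚ H} (h : ∀ x, f' (φ x) = φ (f x)) :
    LinearMap.trace ℚ _ f' = LinearMap.trace ℚ _ f := by
  rw [← LinearMap.trace_conj' f φ.toLinearEquiv]
  congr 1
  refine LinearMap.ext fun x => ?_
  obtain ⟨y, rfl⟩ := φ.surjective x
  simp [LinearEquiv.conj_apply, h]

lemma tau_algEquiv [Finite G] [Finite H] (φ : MonoidAlgebra ℚ G ≃ₐ[ℚ] MonoidAlgebra ℚ H) (x : MonoidAlgebra ℚ G) :
    tau H (φ x) = tau G x := by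
  have h : LinearMap.trace ℚ _ (LinearMap.mulLeft ℚ (φ x)) =
      LinearMap.trace ℚ _ (LinearMap.mulLeft ℚ x) := trace_conj_algEquiv φ (by simp)
  rw [trace_mulLeft, trace_mulLeft, card_eq_of_algEquiv φ] at h
  exact mul_left_cancel₀ (Nat.cast_ne_zero.2 Nat.card_pos.ne') h

lemma conjSum_algEquiv [Finite G] [Finite H] (φ : MonoidAlgebra ℚ G ≃ₐ[ℚ] MonoidAlgebra ℚ H) (x : MonoidAlgebra ℚ G) :
    conjSum H (φ x) = φ (conjSum G x) := by
  refine eq_of_tau_mul_eq fun z => ?_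
  obtain ⟨y, rfl⟩ := φ.surjective z
  rw [← trace_mulLeft_mulRight, ← map_mul, tau_algEquiv, ← trace_mulLeft_mulRight]
  exact trace_conj_algEquiv φ (by simp)

lemma commSum_algEquiv [Finite G] [Finite H] (φ : MonoidAlgebra ℚ G ≃ₐ[ℚ] MonoidAlgebra ℚ H) :
    φ (commSum G) = commSum H := by
  refine eq_of_tau_mul_eq fun z => ?_
  obtain ⟨y, rfl⟩ := φ.surjective z
  rw [← trace_mulLeft_conjSum, ← map_mul, tau_algEquiv, ← trace_mulLeft_conjSum]
  exact (trace_conj_algEquiv φ (by simp [conjSum_algEquiv])).symm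

lemma tau_commSum_pow_algEquiv [Finite G] [Finite H] (φ : MonoidAlgebra ℚ G ≃ₐ[ℚ] MonoidAlgebra ℚ H) (k : ℕ) :
    tau H (commSum H ^ k) = tau G (commSum G ^ k) := by
  rw [← commSum_algEquiv φ, ← map_pow, tau_algEquiv]

lemma commSum_eq_sum [Fintype G] :
    commSum G = ∑ g : G, ∑ h : G, MonoidAlgebra.single (h⁻¹ * g * h * g⁻¹) (1 : ℚ) := by
  rw [commSum]
  convert Finset.sum_congr rfl fun g _ => ?_
  rw [conjSum, LinearMap.sum_apply, Finset.sum_mul]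
  convert Finset.sum_congr rfl fun h _ => ?_
  simp [mul_assoc]

end GroupAlgebra

section Casimir

lemma exists_pairing (A : Type*) [Group A] [Fintype A] [IsCyclic A] :
    ∃ β : A → A →* ℂ, (∀ x x' y, β (x * x') y = β x y * β x' y) ∧
      (∀ y, ∑ x, β x y = if y = 1 then (Nat.card A : ℂ) else 0) ∧
      ∀ x, (∀ y, β x y = 1) → x = 1 := by
  have : NeZero (Nat.card A) := ⟨Nat.card_pos.ne'⟩
  let e : A ≃* Multiplicative (ZMod (Nat.card A)) := (zmodCyclicMulEquiv inferInstance).symm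
  have hadd : ∀ x y : A, (e (x * y)).toAdd = (e x).toAdd + (e y).toAdd := by simp
  have key : ∀ y : A, ∑ x : A, (ZMod.stdAddChar ((e x).toAdd * (e y).toAdd) : ℂ) =
      if y = 1 then (Nat.card A : ℂ) else 0 := by
    intro y
    have h := Equiv.sum_comp (e.toEquiv.trans Multiplicative.toAdd)
      (fun i => (ZMod.stdAddChar (i * (e y).toAdd) : ℂ))
    rw [AddChar.sum_mulShift _ (ZMod.isPrimitive_stdAddChar _)] at h
    refine h.trans ?_
    simp
  refine ⟨fun x => ⟨⟨fun y => ZMod.stdAddChar ((e x).toAdd * (e y).toAdd), by simp⟩, fun y y' => ?_⟩,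
    fun x x' y => ?_, key, fun x hx => ?_⟩
  · simp only [hadd, mul_add, AddChar.map_add_eq_mul]
  · simp only [MonoidHom.coe_mk, OneHom.coe_mk, hadd, add_mul, AddChar.map_add_eq_mul]
  · by_contra hne
    have h := key x
    rw [if_neg hne] at h
    simp only [MonoidHom.coe_mk, OneHom.coe_mk] at hx
    simp only [mul_comm _ (e x).toAdd, hx] at h
    simp at h

lemma mul_comm_of_mem_of_isCyclic (A : Subgroup G) [IsCyclic A] {x y : G} (hx : x ∈ A)
    (hy : y ∈ A) : x * y = y * x := by
  obtain ⟨a, -, rfl⟩ := exists_generator A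
  obtain ⟨i, rfl⟩ := hx
  obtain ⟨j, rfl⟩ := hy
  simp only [← zpow_add, add_comm]

lemma MetacyclicFact.commutator_mem (f : MetacyclicFact G) (g h : G) :
    h⁻¹ * g * h * g⁻¹ ∈ f.A := by
  have := f.normalA
  obtain ⟨x, hx, u, hu, rfl⟩ := f.mul_cover g
  obtain ⟨y, hy, v, hv, rfl⟩ := f.mul_cover h
  have hc : v * u = u * v := by
    have := f.cyclicB
    exact mul_comm_of_mem_of_isCyclic f.B hv hu
  rw [← QuotientGroup.eq_one_iff]
  have hx' : (x : G ⧸ f.A) = 1 := (QuotientGroup.eq_one_iff x).2 hx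
  have hy' : (y : G ⧸ f.A) = 1 := (QuotientGroup.eq_one_iff y).2 hy
  have hc' : (v : G ⧸ f.A) * u = u * v := by rw [← QuotientGroup.mk_mul, hc]; rfl
  simp only [QuotientGroup.mk_mul, QuotientGroup.mk_inv, hx', hy']
  simp [mul_assoc, ← hc']

lemma sum_commutator_eq [Fintype G] (f : MetacyclicFact G) (C : Subgroup G) (hAC : f.A ≤ C)
    (χ : G → ℂ) (hmul : ∀ y ∈ f.A, ∀ z ∈ f.A, χ (y * z) = χ y * χ z) (hone : χ 1 = 1)
    (hC : ∀ c ∈ C, ∀ y ∈ f.A, χ (c⁻¹ * y * c) = χ y)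
    (hnC : ∀ c ∉ C, ∃ y ∈ f.A, χ (c⁻¹ * y * c) ≠ χ y) :
    ∑ g : G, ∑ h : G, χ (h⁻¹ * g * h * g⁻¹) = (Nat.card C : ℂ) ^ 2 := by
  have i1 := f.normalA
  have i2 := f.cyclicA
  have hinv : ∀ y ∈ f.A, χ y⁻¹ * χ y = 1 := fun y hy => by
    rw [← hmul _ (inv_mem hy) _ hy, inv_mul_cancel, hone]
  have hne : ∀ y ∈ f.A, χ y ≠ 0 := fun y hy => right_ne_zero_of_mul_eq_one (hinv y hy)
  have hconj : ∀ c, ∀ y ∈ f.A, c⁻¹ * y * c ∈ f.A := fun c y hy => by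
    simpa using i1.conj_mem y hy c⁻¹
  have step1 : ∀ g ∉ C, ∑ h : G, χ (h⁻¹ * g * h * g⁻¹) = 0 := by
    intro g hg
    obtain ⟨y, hy, hy'⟩ := hnC g⁻¹ (by simpa using hg)
    rw [inv_inv] at hy'
    have e : ∑ h : G, χ (h⁻¹ * g * h * g⁻¹) =
        (χ y⁻¹ * χ (g * y * g⁻¹)) * ∑ h : G, χ (h⁻¹ * g * h * g⁻¹) := by
      rw [Finset.mul_sum]
      conv_lhs => rw [← Equiv.sum_comp (Equiv.mulRight y)]
      refine Finset.sum_congr rfl fun h _ => ?_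
      have : (h * y)⁻¹ * g * (h * y) * g⁻¹ = y⁻¹ * (h⁻¹ * g * h * g⁻¹) * (g * y * g⁻¹) := by group
      rw [Equiv.coe_mulRight, this,
        hmul _ (mul_mem (inv_mem hy) (f.commutator_mem g h)) _ (i1.conj_mem y hy g),
        hmul _ (inv_mem hy) _ (f.commutator_mem g h)]
      ring
    by_contra h0
    refine hy' ?_
    have e' := mul_right_cancel₀ h0 ((one_mul _).trans e)
    rw [← hinv y hy] at e'
    exact (mul_left_cancel₀ (left_ne_zero_of_mul_eq_one (hinv y hy)) e').symm
  have step2 : ∀ h ∉ C, ∑ g : G, (if g ∈ C then χ (h⁻¹ * g * h * g⁻¹) else 0) = 0 := by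
    intro h hh
    obtain ⟨y, hy, hy'⟩ := hnC h hh
    have e : ∑ g : G, (if g ∈ C then χ (h⁻¹ * g * h * g⁻¹) else 0) =
        (χ (h⁻¹ * y * h) * χ y⁻¹) * ∑ g : G, (if g ∈ C then χ (h⁻¹ * g * h * g⁻¹) else 0) := by
      rw [Finset.mul_sum]
      conv_lhs => rw [← Equiv.sum_comp (Equiv.mulLeft y)]
      refine Finset.sum_congr rfl fun g _ => ?_
      have : h⁻¹ * (y * g) * h * (y * g)⁻¹ = (h⁻¹ * y * h) * (h⁻¹ * g * h * g⁻¹) * y⁻¹ := by group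
      rw [Equiv.coe_mulLeft, this, hmul _ (mul_mem (hconj h y hy) (f.commutator_mem g h)) _
        (inv_mem hy), hmul _ (hconj h y hy) _ (f.commutator_mem g h),
        Subgroup.mul_mem_cancel_left _ (hAC hy)]
      split_ifs <;> ring
    by_contra h0
    refine hy' ?_
    have e' := mul_right_cancel₀ h0 ((one_mul _).trans e)
    rw [← hinv y hy, mul_comm] at e'
    exact (mul_right_cancel₀ (left_ne_zero_of_mul_eq_one (hinv y hy)) e').symm
  have step3 : ∀ g ∈ C, ∀ h ∈ C, χ (h⁻¹ * g * h * g⁻¹) = 1 := by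
    intro g hg h hh
    obtain ⟨x, hx, u, hu, rfl⟩ := f.mul_cover g
    obtain ⟨y, hy, v, hv, rfl⟩ := f.mul_cover h
    have i3 := f.cyclicB
    have huC : u ∈ C := (Subgroup.mul_mem_cancel_left _ (hAC hx)).1 hg
    have hvC : v ∈ C := (Subgroup.mul_mem_cancel_left _ (hAC hy)).1 hh
    have hc : v * u = u * v := mul_comm_of_mem_of_isCyclic f.B hv hu
    have hc' : v * u⁻¹ = u⁻¹ * v := by
      rw [eq_inv_mul_iff_mul_eq, ← mul_assoc, ← hc, mul_inv_cancel_right]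
    have : (y * v)⁻¹ * (x * u) * (y * v) * (x * u)⁻¹ =
        (v⁻¹ * y⁻¹ * v) * (v⁻¹ * x * v) * ((u⁻¹ * v)⁻¹ * y * (u⁻¹ * v)) * x⁻¹ := by
      have h1 : (u⁻¹ * v)⁻¹ * y * (u⁻¹ * v) = v⁻¹ * u * y * (v * u⁻¹) := by rw [hc']; group
      rw [h1]; group
    have q1 := hconj v _ (inv_mem hy)
    have q2 := hconj v _ hx
    have q3 := hconj (u⁻¹ * v) _ hy
    rw [this, hmul _ (mul_mem (mul_mem q1 q2) q3) _ (inv_mem hx), hmul _ (mul_mem q1 q2) _ q3,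
      hmul _ q1 _ q2, hC v hvC _ (inv_mem hy), hC v hvC _ hx,
      hC _ (mul_mem (inv_mem huC) hvC) _ hy]
    have e1 := hinv x hx
    have e2 := hinv y hy
    linear_combination (χ y⁻¹ * χ y) * e1 + e2
  have card : ∑ g : G, (if g ∈ C then (1 : ℂ) else 0) = Nat.card C := by
    rw [Finset.sum_boole, Nat.card_eq_fintype_card, Fintype.card_subtype]
  calc ∑ g : G, ∑ h : G, χ (h⁻¹ * g * h * g⁻¹)
      = ∑ g : G, ∑ h : G, (if g ∈ C then χ (h⁻¹ * g * h * g⁻¹) else 0) := by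
        refine Finset.sum_congr rfl fun g _ => ?_
        by_cases hg : g ∈ C
        · simp only [hg, if_true]
        · simp only [hg, if_false, step1 g hg, Finset.sum_const_zero]
    _ = ∑ h : G, ∑ g : G, (if g ∈ C then χ (h⁻¹ * g * h * g⁻¹) else 0) := Finset.sum_comm
    _ = ∑ h : G, ∑ g : G, (if h ∈ C then 1 else 0) * (if g ∈ C then (1 : ℂ) else 0) := by
        refine Finset.sum_congr rfl fun h _ => ?_
        by_cases hh : h ∈ C
        · refine Finset.sum_congr rfl fun g _ => ?_
          by_cases hg : g ∈ C
          · simp only [hg, hh, if_true, step3 g hg h hh, mul_one]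
          · simp only [hg, if_false, mul_zero]
        · simp only [hh, if_false, step2 h hh, zero_mul, Finset.sum_const_zero]
    _ = (Nat.card C : ℂ) ^ 2 := by
        rw [← Finset.sum_mul_sum, card, sq]

lemma MetacyclicFact.card_mul_tau [Finite G] (f : MetacyclicFact G) [Fintype f.A] (k : ℕ) :
    (Nat.card f.A : ℚ) * tau G (commSum G ^ k) =
      ∑ x : f.A, ((Nat.card (Subgroup.centralizer {(x : G)}) : ℚ) ^ 2) ^ k := by
  let := Fintype.ofFinite G
  have i1 := f.normalA
  have i2 := f.cyclicA
  obtain ⟨β, hβ, hsum, hinj⟩ := exists_pairing f.A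
  let c : MonoidAlgebra ℚ f.A :=
    ∑ g : G, ∑ h : G, MonoidAlgebra.single ⟨h⁻¹ * g * h * g⁻¹, f.commutator_mem g h⟩ (1 : ℚ)
  let ι : MonoidAlgebra ℚ f.A →ₐ[ℚ] MonoidAlgebra ℚ G :=
    MonoidAlgebra.lift ℚ _ _ ((MonoidAlgebra.of ℚ G).comp f.A.subtype)
  have hι : ι c = commSum G := by
    rw [commSum_eq_sum]
    simp [c, ι, map_sum]
  have hτ : ∀ z, tau G (ι z) = tau f.A z := by
    intro z
    induction z using MonoidAlgebra.induction_linear with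
    | zero => simp
    | add f g hf hg => simp [hf, hg]
    | single g a => simp [ι, tau_apply, Finsupp.single_apply]
  let ev : f.A → MonoidAlgebra ℚ f.A →ₐ[ℚ] ℂ := fun x => MonoidAlgebra.lift ℚ _ _ (β x)
  have hev : ∀ z, (Nat.card f.A : ℂ) * (tau f.A z : ℚ) = ∑ x, ev x z := by
    intro z
    induction z using MonoidAlgebra.induction_linear with
    | zero => simp
    | add f g hf hg =>
      simp only [map_add, Rat.cast_add, mul_add, hf, hg, Finset.sum_add_distrib]
    | single g a =>
      simp only [ev, MonoidAlgebra.lift_single, ← Finset.smul_sum, hsum, tau_apply,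
        MonoidAlgebra.coeff_single, Finsupp.single_apply]
      split_ifs <;> simp [Algebra.smul_def, mul_comm]
  have hpow : ∀ x : f.A, ∀ t : ℕ, ∀ y, β (x ^ t) y = β x y ^ t := by
    intro x t y
    have h1 : β 1 y = 1 := by
      have h := hβ 1 1 y
      rw [mul_one] at h
      have hy : β 1 y ≠ 0 := ((Group.isUnit y).map (β 1)).ne_zero
      exact mul_left_cancel₀ hy (by rw [← h, mul_one])
    induction t with
    | zero => simpa using h1
    | succ t ih => rw [pow_succ, hβ, ih, pow_succ]
  have hc : ∀ x, ev x c = (Nat.card (Subgroup.centralizer {(x : G)}) : ℂ) ^ 2 := by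
    intro x
    let χ : G → ℂ := fun z => if hz : z ∈ f.A then β x ⟨z, hz⟩ else 0
    have hχ : ∀ z (hz : z ∈ f.A), χ z = β x ⟨z, hz⟩ := fun z hz => dif_pos hz
    have hconj : ∀ c : G, ∀ y ∈ f.A, c⁻¹ * y * c ∈ f.A := fun c y hy => by
      simpa using i1.conj_mem y hy c⁻¹
    have hact : ∀ c : G, ∃ t : ℕ, c⁻¹ * x * c = (x : G) ^ t ∧ ∀ y (hy : y ∈ f.A),
        χ (c⁻¹ * y * c) = β (x ^ t) ⟨y, hy⟩ := by
      intro c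
      obtain ⟨t, ht⟩ := exists_conjActsAsPow f.A c
      refine ⟨t, ht _ x.2, fun y hy => ?_⟩
      rw [ht y hy, hχ _ (pow_mem hy t), hpow, ← map_pow]
      rfl
    have hmem : ∀ c : G, c ∈ Subgroup.centralizer {(x : G)} ↔ c⁻¹ * x * c = x := by
      intro c
      rw [Subgroup.mem_centralizer_singleton_iff, mul_assoc, inv_mul_eq_iff_eq_mul]
      exact eq_comm
    rw [← sum_commutator_eq f (Subgroup.centralizer {(x : G)}) ?_ χ ?_ ?_ ?_ ?_]
    · simp only [c, ev, map_sum, MonoidAlgebra.lift_single, one_smul]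
      refine Finset.sum_congr rfl fun g _ => Finset.sum_congr rfl fun h _ => ?_
      rw [hχ _ (f.commutator_mem g h)]
    · intro y hy
      rw [Subgroup.mem_centralizer_singleton_iff]
      exact mul_comm_of_mem_of_isCyclic f.A hy x.2
    · intro y hy z hz
      rw [hχ _ hy, hχ _ hz, hχ _ (mul_mem hy hz), ← map_mul]
      rfl
    · rw [hχ _ (one_mem _)]
      exact map_one _
    · intro c hc y hy
      obtain ⟨t, ht, ht'⟩ := hact c
      have : x ^ t = x := Subtype.ext (by rw [Subgroup.coe_pow, ← ht, (hmem c).1 hc])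
      rw [ht' y hy, this, hχ _ hy]
    · intro c hc
      by_contra! hall
      obtain ⟨t, ht, ht'⟩ := hact c
      refine hc ((hmem c).2 ?_)
      have : x⁻¹ * x ^ t = 1 := by
        refine hinj _ fun y => ?_
        have hy : β x y ≠ 0 := ((Group.isUnit y).map (β x)).ne_zero
        refine mul_left_cancel₀ hy ?_
        rw [← hβ, mul_inv_cancel_left, mul_one, ← ht' y y.2, hall y y.2, hχ _ y.2]
      rw [inv_mul_eq_one] at this
      rw [ht, ← Subgroup.coe_pow, ← this]
  have key : ((Nat.card f.A : ℚ) * tau G (commSum G ^ k) : ℂ) =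
      ∑ x : f.A, ((Nat.card (Subgroup.centralizer {(x : G)}) : ℂ) ^ 2) ^ k := by
    rw [← hι, ← map_pow, hτ]
    push_cast
    rw [hev]
    exact Finset.sum_congr rfl fun x _ => by rw [map_pow, hc]
  exact_mod_cast key

end Casimir

section Transfer

lemma sum_apply_eq_of_sum_pow_eq {X Y : Type*} [Fintype X] [Fintype Y] (a : X → ℚ) (b : Y → ℚ)
    (M N : ℚ) (h : ∀ k : ℕ, M * ∑ x, a x ^ k = N * ∑ y, b y ^ k) (F : ℚ → ℚ) :
    M * ∑ x, F (a x) = N * ∑ y, F (b y) := by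
  let S : Finset ℚ := Finset.univ.image a ∪ Finset.univ.image b
  let q := Lagrange.interpolate S id F
  have hq : ∀ s ∈ S, q.eval s = F s := fun s hs =>
    Lagrange.eval_interpolate_at_node F (v := id) (Set.injOn_id _) hs
  have ha : ∀ x, F (a x) = ∑ i ∈ Finset.range (q.natDegree + 1), q.coeff i * a x ^ i := fun x => by
    rw [← Polynomial.eval_eq_sum_range, hq _ (by simp [S])]
  have hb : ∀ y, F (b y) = ∑ i ∈ Finset.range (q.natDegree + 1), q.coeff i * b y ^ i := fun y => by
    rw [← Polynomial.eval_eq_sum_range, hq _ (by simp [S])]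
  simp only [ha, hb]
  rw [Finset.sum_comm, Finset.sum_comm (s := (Finset.univ : Finset Y)), Finset.mul_sum,
    Finset.mul_sum]
  refine Finset.sum_congr rfl fun i _ => ?_
  rw [← Finset.mul_sum, ← Finset.mul_sum, mul_left_comm, h, mul_left_comm]

lemma sum_card_centralizer_eq {H : Type*} [Group H] [Finite G] [Finite H]
    (φ : MonoidAlgebra ℚ G ≃ₐ[ℚ] MonoidAlgebra ℚ H) (f : MetacyclicFact G) (f' : MetacyclicFact H)
    [Fintype f.A] [Fintype f'.A] (F : ℕ → ℚ) :
    (Nat.card f'.A : ℚ) * ∑ x : f.A, F (Nat.card (Subgroup.centralizer {(x : G)})) =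
      (Nat.card f.A : ℚ) * ∑ x : f'.A, F (Nat.card (Subgroup.centralizer {(x : H)})) := by
  have h := sum_apply_eq_of_sum_pow_eq
    (fun x : f.A => (Nat.card (Subgroup.centralizer {(x : G)}) : ℚ) ^ 2)
    (fun x : f'.A => (Nat.card (Subgroup.centralizer {(x : H)}) : ℚ) ^ 2)
    (Nat.card f'.A) (Nat.card f.A) (fun k => by
      rw [← f.card_mul_tau, ← f'.card_mul_tau, tau_commSum_pow_algEquiv φ, mul_left_comm])
    (fun y => F (Nat.sqrt ⌊y⌋₊))
  have e : ∀ n : ℕ, Nat.sqrt ⌊(n : ℚ) ^ 2⌋₊ = n := fun n => by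
    rw [← Nat.cast_pow, Nat.floor_natCast, Nat.sqrt_eq']
  simpa only [e] using h

lemma mem_of_coprime_index [Finite G] (K : Subgroup G) [K.Normal] {g : G}
    (h : (orderOf g).Coprime K.index) : g ∈ K := by
  rw [← QuotientGroup.eq_one_iff, ← orderOf_eq_one_iff]
  refine Nat.eq_one_of_dvd_coprimes h (orderOf_map_dvd (QuotientGroup.mk' K) g) ?_
  rw [Subgroup.index]
  exact orderOf_dvd_natCard _

/-- All prime divisors of `n` lie in `σ`. -/
def IsSigma (σ : Set ℕ) (n : ℕ) : Prop :=
  ∀ q, q.Prime → q ∣ n → q ∈ σ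

lemma isSigma_compl_index [Finite G] (K : Subgroup G) {σ : Set ℕ}
    (h : ∀ g, IsSigma σ (orderOf g) → g ∈ K) : IsSigma σᶜ K.index := by
  intro q hq hdvd hσ
  have : Fact q.Prime := ⟨hq⟩
  obtain ⟨Q⟩ := (inferInstance : Nonempty (Sylow q G))
  refine Q.not_dvd_index (hdvd.trans (Subgroup.index_dvd_of_le fun g hg => h g ?_))
  intro l hl hld
  obtain ⟨k, hk⟩ := (IsPGroup.iff_orderOf.1 Q.isPGroup') ⟨g, hg⟩
  rw [Subgroup.orderOf_mk] at hk
  rw [hk] at hld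
  rwa [(Nat.prime_dvd_prime_iff_eq hl hq).1 (hl.dvd_of_dvd_pow hld)]

lemma IsSigma.coprime {σ : Set ℕ} {a b : ℕ} (ha : IsSigma σ a) (hb : IsSigma σᶜ b) :
    a.Coprime b :=
  Nat.coprime_of_dvd fun q hq h1 h2 => hb q hq h2 (ha q hq h1)

lemma MetacyclicFact.normal_of_le (f : MetacyclicFact G) {C : Subgroup G} (h : f.A ≤ C) :
    C.Normal where
  conj_mem n hn g := by
    have := mul_mem (h (f.commutator_mem n g⁻¹)) hn
    simpa using this

lemma MetacyclicFact.le_centralizer (f : MetacyclicFact G) {x : G} (hx : x ∈ f.A) :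
    f.A ≤ Subgroup.centralizer {x} := by
  have := f.cyclicA
  intro y hy
  rw [Subgroup.mem_centralizer_singleton_iff]
  exact mul_comm_of_mem_of_isCyclic f.A hy hx

/-- The elements of `A` centralized by all `σ`-elements. -/
def MetacyclicFact.fixSub (f : MetacyclicFact G) (σ : Set ℕ) : Subgroup f.A :=
  (Subgroup.centralizer {g : G | IsSigma σ (orderOf g)}).subgroupOf f.A

lemma MetacyclicFact.mem_fixSub_iff [Finite G] (f : MetacyclicFact G) (σ : Set ℕ) (x : f.A) :
    x ∈ f.fixSub σ ↔ IsSigma σᶜ (Nat.card G / Nat.card (Subgroup.centralizer {(x : G)})) := by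
  have hidx : Nat.card G / Nat.card (Subgroup.centralizer {(x : G)}) =
      (Subgroup.centralizer {(x : G)}).index := by
    rw [← Subgroup.card_mul_index (Subgroup.centralizer {(x : G)}),
      Nat.mul_div_cancel_left _ Nat.card_pos]
  rw [hidx, MetacyclicFact.fixSub, Subgroup.mem_subgroupOf, Subgroup.mem_centralizer_iff]
  constructor
  · intro h
    refine isSigma_compl_index _ fun g hg => ?_
    rw [Subgroup.mem_centralizer_singleton_iff]
    exact h g hg
  · intro h g hg
    have := f.normal_of_le (f.le_centralizer x.2)
    rw [← Subgroup.mem_centralizer_singleton_iff]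
    exact mem_of_coprime_index _ (IsSigma.coprime hg h)

lemma index_fixSub_eq {H : Type*} [Group H] [Finite G] [Finite H]
    (φ : MonoidAlgebra ℚ G ≃ₐ[ℚ] MonoidAlgebra ℚ H) (f : MetacyclicFact G) (f' : MetacyclicFact H)
    (σ : Set ℕ) : (f.fixSub σ).index = (f'.fixSub σ).index := by
  have := Fintype.ofFinite f.A
  have := Fintype.ofFinite f'.A
  have h := sum_card_centralizer_eq φ f f' (fun n => if IsSigma σᶜ (Nat.card G / n) then 1 else 0)
  have e1 : (Nat.card (f.fixSub σ) : ℚ) = ∑ x : f.A,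
      (if IsSigma σᶜ (Nat.card G / Nat.card (Subgroup.centralizer {(x : G)})) then 1 else 0) := by
    simp only [← f.mem_fixSub_iff]
    rw [Finset.sum_boole, Nat.card_eq_fintype_card, Fintype.card_subtype]
  have e2 : (Nat.card (f'.fixSub σ) : ℚ) = ∑ x : f'.A,
      (if IsSigma σᶜ (Nat.card G / Nat.card (Subgroup.centralizer {(x : H)})) then 1 else 0) := by
    simp only [card_eq_of_algEquiv φ, ← f'.mem_fixSub_iff]
    rw [Finset.sum_boole, Nat.card_eq_fintype_card, Fintype.card_subtype]
  rw [← e1, ← e2] at h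
  have h' : Nat.card f'.A * Nat.card (f.fixSub σ) = Nat.card f.A * Nat.card (f'.fixSub σ) := by
    exact_mod_cast h
  rw [← (f.fixSub σ).card_mul_index, ← (f'.fixSub σ).card_mul_index] at h'
  have p1 : 0 < Nat.card (f.fixSub σ) := Nat.card_pos
  have p2 : 0 < Nat.card (f'.fixSub σ) := Nat.card_pos
  refine (Nat.eq_of_mul_eq_mul_left (Nat.mul_pos p1 p2) ?_).symm
  linarith

/-- The `σ`-elements of `G` centralize the `σ'`-elements of `A`. -/
def MetacyclicFact.Splits (f : MetacyclicFact G) (σ : Set ℕ) : Prop :=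
  ∀ g, IsSigma σ (orderOf g) → ∀ x ∈ f.A, IsSigma σᶜ (orderOf x) → g * x = x * g

lemma MetacyclicFact.splits_iff [Finite G] (f : MetacyclicFact G) (σ : Set ℕ) :
    f.Splits σ ↔ IsSigma σ (f.fixSub σ).index := by
  have := f.cyclicA
  have hn : (f.fixSub σ).Normal := ⟨fun n hn g => by
    have : g * n = n * g := Subtype.ext (mul_comm_of_mem_of_isCyclic f.A g.2 n.2)
    rwa [this, mul_inv_cancel_right]⟩
  constructor
  · intro h
    have := isSigma_compl_index (f.fixSub σ) (σ := σᶜ) fun x hx => by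
      rw [MetacyclicFact.fixSub, Subgroup.mem_subgroupOf, Subgroup.mem_centralizer_iff]
      exact fun g hg => h g hg x x.2 (by rwa [Subgroup.orderOf_coe])
    rwa [compl_compl] at this
  · intro h g hg x hx hxo
    have hm : (⟨x, hx⟩ : f.A) ∈ f.fixSub σ := by
      refine mem_of_coprime_index _ (Nat.Coprime.symm (IsSigma.coprime h ?_))
      rwa [Subgroup.orderOf_mk]
    exact Subgroup.mem_centralizer_iff.1 (Subgroup.mem_subgroupOf.1 hm) g hg

lemma MetacyclicFact.Splits.transfer {H : Type*} [Group H] [Finite G] [Finite H]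
    (φ : MonoidAlgebra ℚ G ≃ₐ[ℚ] MonoidAlgebra ℚ H) (f : MetacyclicFact G) (f' : MetacyclicFact H)
    {σ : Set ℕ} (h : f.Splits σ) : f'.Splits σ := by
  rw [MetacyclicFact.splits_iff] at h ⊢
  rwa [← index_fixSub_eq φ f f']

end Transfer

section Hypotheses

lemma IsSigma.exists_eq_pow {p n : ℕ} (h : IsSigma {p} n) (hn : n ≠ 0) : ∃ k, n = p ^ k :=
  ⟨_, Nat.eq_prime_pow_of_unique_prime_dvd hn fun hq hd => h _ hq hd⟩

lemma isSigma_singleton_pow {p : ℕ} (hp : p.Prime) (k : ℕ) : IsSigma {p} (p ^ k) :=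
  fun _ hq hd => (Nat.prime_dvd_prime_iff_eq hq hp).1 (hq.dvd_of_dvd_pow hd)

lemma isSigma_compl_singleton_iff {p n : ℕ} (hp : p.Prime) : IsSigma {p}ᶜ n ↔ ¬ p ∣ n :=
  ⟨fun h hd => h p hp hd rfl, fun h q _ hd hqp => h (by rwa [Set.mem_singleton_iff.1 hqp] at hd)⟩

lemma MetacyclicFact.splits_compl [Finite G] (f : MetacyclicFact G) {p : ℕ}
    (hp : p ∈ piSet G) : f.Splits {p}ᶜ := by
  obtain ⟨hp, -, N, hN, hcard⟩ := hp
  have i1 := f.normalA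
  have i2 := f.cyclicA
  intro g hg x hx hxo
  rw [compl_compl] at hxo
  have hG : Nat.card G ≠ 0 := Nat.card_pos.ne'
  have hcop : ¬ p ∣ Nat.card N := by
    rw [hcard]; exact Nat.not_dvd_ordCompl hp hG
  have hidx : N.index = ordProj[p] (Nat.card G) := by
    have h1 := N.card_mul_index
    rw [hcard] at h1
    refine Nat.eq_of_mul_eq_mul_left (Nat.ordCompl_pos p hG) ?_
    rw [h1, mul_comm, Nat.ordProj_mul_ordCompl_eq_self]
  have hgN : g ∈ N := by
    refine mem_of_coprime_index N ?_
    rw [hidx]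
    exact (IsSigma.coprime (isSigma_singleton_pow hp _) hg).symm
  obtain ⟨t, ht⟩ := exists_conjActsAsPow f.A g⁻¹
  have h1 : g * x * g⁻¹ = x ^ t := by simpa using ht x hx
  have h2 : x ^ t * x⁻¹ ∈ N := by
    rw [← h1, mul_assoc, mul_assoc]
    refine mul_mem hgN ?_
    have := hN.conj_mem _ (inv_mem hgN) x
    simpa [mul_assoc] using this
  have h3 : x ^ t * x⁻¹ ∈ Subgroup.zpowers x :=
    mul_mem (pow_mem (Subgroup.mem_zpowers x) t) (inv_mem (Subgroup.mem_zpowers x))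
  have h4 : orderOf (x ^ t * x⁻¹) ∣ Nat.card N := Subgroup.orderOf_dvd_natCard _ h2
  have h5 : orderOf (x ^ t * x⁻¹) ∣ orderOf x := by
    rw [← Nat.card_zpowers x]; exact Subgroup.orderOf_dvd_natCard _ h3
  have h6 : x ^ t * x⁻¹ = 1 := by
    rw [← orderOf_eq_one_iff]
    exact Nat.eq_one_of_dvd_coprimes
      (IsSigma.coprime hxo ((isSigma_compl_singleton_iff hp).2 hcop)) h5 h4
  rw [mul_inv_eq_one] at h6
  rw [h6] at h1
  exact mul_inv_eq_iff_eq_mul.1 h1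

lemma pow_dvd_natPart {n q j : ℕ} {σ : Set ℕ} (hn : n ≠ 0) (hq : q.Prime) (hσ : q ∈ σ)
    (h : q ^ j ∣ n) : q ^ j ∣ natPart n σ := by
  rcases Nat.eq_zero_or_pos j with rfl | hj
  · simp
  have hmem : q ∈ n.primeFactors :=
    Nat.mem_primeFactors.2 ⟨hq, (dvd_pow_self q hj.ne').trans h, hn⟩
  refine Dvd.dvd.trans ?_ (Finset.dvd_prod_of_mem _ hmem)
  rw [if_pos hσ]
  exact pow_dvd_pow q ((hq.pow_dvd_iff_le_factorization hn).1 h)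

lemma natPart_dvd {n : ℕ} (σ : Set ℕ) (hn : n ≠ 0) : natPart n σ ∣ n := by
  conv_rhs => rw [← Nat.prod_factorization_pow_eq_self hn]
  rw [natPart, Finsupp.prod, Nat.support_factorization]
  refine Finset.prod_dvd_prod_of_dvd _ _ fun q _ => ?_
  split_ifs
  · exact dvd_rfl
  · exact one_dvd _

lemma MetacyclicFact.splits_singleton [Finite G] (f : MetacyclicFact G) {p : ℕ} (hp : p.Prime)
    (hk : ordProj[p] (kOf f) = 1) : f.Splits {p} := by
  have i1 := f.normalA
  have i2 := f.cyclicA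
  intro g hg x hx hxo
  have hm0 : Nat.card f.A ≠ 0 := Nat.card_pos.ne'
  obtain ⟨e, he⟩ := hg.exists_eq_pow (orderOf_pos g).ne'
  obtain ⟨t, ht⟩ := exists_conjActsAsPow f.A g
  have ht1 : ((t ^ p ^ e : ℕ) : ZMod (Nat.card f.A)) = 1 := by
    have h1 := ht.pow (p ^ e)
    rw [← he, pow_orderOf_eq_one] at h1
    have h2 : ConjActsAsPow f.A (1 : G) 1 := fun x _ => by simp
    rw [← he]
    simpa using h1.natCast_eq h2
  have hdx : orderOf x ∣ Nat.card f.A := Subgroup.orderOf_dvd_natCard _ hx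
  have key : ∀ q j : ℕ, q.Prime → q ≠ p → q ^ j ∣ Nat.card f.A → (t : ZMod (q ^ j)) = 1 := by
    intro q j hq hqp hdvd
    have hpe : (t : ZMod (q ^ j)) ^ p ^ e = 1 := by
      have := natCast_eq_one_of_dvd hdvd ht1
      exact_mod_cast this
    rcases Nat.eq_zero_or_pos j with rfl | hj
    · exact Subsingleton.elim (α := ZMod 1) _ _
    by_cases hqr : q ∣ rOfA f.A
    · have h1 := (prime_pow_dvd_rOfA_iff f.A (k := 1) hq).1 (by simpa using hqr)
      have h2 : (t : ZMod q) = 1 := by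
        have h3 := h1.2 g t ht
        rw [pow_one] at h3
        rcases h3 with h3 | ⟨rfl, h3⟩
        · exact h3
        · rw [h3]; rfl
      have h3 : ((t ^ q ^ j : ℕ) : ZMod (q ^ j)) = 1 := by
        rw [natCast_eq_one_iff_dvd] at h2 ⊢
        have h4 := dvd_sub_pow_of_dvd_sub h2 j
        rw [one_pow] at h4
        push_cast
        exact (pow_dvd_pow _ (Nat.le_succ j)).trans h4
      have h4 : (t : ZMod (q ^ j)) ^ q ^ j = 1 := by exact_mod_cast h3
      have h5 : orderOf (t : ZMod (q ^ j)) = 1 :=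
        Nat.eq_one_of_dvd_coprimes (((Nat.coprime_primes hp hq).2 hqp.symm).pow e j)
          (orderOf_dvd_of_pow_eq_one hpe) (orderOf_dvd_of_pow_eq_one h4)
      exact orderOf_eq_one_iff.1 h5
    · set d := natPart (Nat.card f.A) {p | ¬ p ∣ rOfA f.A} with hd
      have hdm : d ∣ Nat.card f.A := natPart_dvd _ hm0
      have hqd : q ^ j ∣ d := pow_dvd_natPart hm0 hq hqr hdvd
      refine natCast_eq_one_of_dvd hqd ?_
      have hset : resSet (Nat.card f.A) d (TG f.A) =
          ((TG f.A).map (ZMod.unitsMap hdm) : Set (ZMod d)ˣ) := by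
        have : NeZero (Nat.card f.A) := ⟨hm0⟩
        ext v
        constructor
        · rintro ⟨u, hu, s, hs, hsv⟩
          exact ⟨u, hu, Units.ext (by rw [unitsMap_val hdm hs, hsv])⟩
        · rintro ⟨u, hu, rfl⟩
          obtain ⟨s, hs⟩ := exists_natCast_eq (u : ZMod (Nat.card f.A))
          exact ⟨u, hu, s, hs, (unitsMap_val hdm hs).symm⟩
      have hkc : kOf f = Nat.card ((TG f.A).map (ZMod.unitsMap hdm)) := by
        rw [kOf, kOfA, ← hd, hset]; rfl
      have hd0 : NeZero d := ⟨fun h => hm0 (by rw [h, zero_dvd_iff] at hdm; exact hdm)⟩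
      have hpk : ¬ p ∣ kOf f := by
        intro hdvd
        have hk0 : kOf f ≠ 0 := by rw [hkc]; exact Nat.card_pos.ne'
        have := hp.factorization_pos_of_dvd hk0 hdvd
        rw [Nat.pow_eq_one] at hk
        rcases hk with hk | hk
        · exact hp.one_lt.ne' hk
        · omega
      set u : (ZMod (Nat.card f.A))ˣ := ht.isUnit.unit with hu
      have hut : (t : ZMod (Nat.card f.A)) = u := by simp [hu]
      have huT : u ∈ TG f.A := Subgroup.subset_closure ⟨g, t, hut, ht⟩
      have hv : orderOf (ZMod.unitsMap hdm u) ∣ kOf f := by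
        rw [hkc]
        exact Subgroup.orderOf_dvd_natCard _ (Subgroup.mem_map_of_mem _ huT)
      have hv' : orderOf (ZMod.unitsMap hdm u) ∣ p ^ e := by
        refine orderOf_dvd_of_pow_eq_one (Units.ext ?_)
        rw [Units.val_pow_eq_pow_val, unitsMap_val hdm hut, Units.val_one]
        have := natCast_eq_one_of_dvd hdm ht1
        exact_mod_cast this
      have h1 : orderOf (ZMod.unitsMap hdm u) = 1 :=
        Nat.eq_one_of_dvd_coprimes ((hp.coprime_iff_not_dvd.2 hpk).pow_left e) hv' hv
      rw [← unitsMap_val hdm hut, orderOf_eq_one_iff.1 h1, Units.val_one]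
  have hfin : (t : ZMod (orderOf x)) = 1 := by
    rw [natCast_eq_one_iff_dvd, Int.natCast_dvd, Nat.dvd_iff_prime_pow_dvd_dvd]
    intro q j hq hd
    rw [← Int.natCast_dvd, ← natCast_eq_one_iff_dvd]
    rcases Nat.eq_zero_or_pos j with rfl | hj
    · exact Subsingleton.elim (α := ZMod 1) _ _
    refine key q j hq ?_ (hd.trans hdx)
    rintro rfl
    exact hxo q hq ((dvd_pow_self q hj.ne').trans hd) rfl
  have hxt : x ^ t = x := by
    have : ((t : ℕ) : ZMod (orderOf x)) = ((1 : ℕ) : ZMod (orderOf x)) := by simpa using hfin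
    rw [ZMod.natCast_eq_natCast_iff, ← pow_eq_pow_iff_modEq, pow_one] at this
    exact this
  have h1 := ht x hx
  rw [hxt, mul_assoc, inv_mul_eq_iff_eq_mul] at h1
  exact h1.symm

end Hypotheses

section Splitting

lemma IsSigma.of_dvd {σ : Set ℕ} {a b : ℕ} (hb : IsSigma σ b) (h : a ∣ b) : IsSigma σ a :=
  fun q hq hd => hb q hq (hd.trans h)

lemma IsSigma.mul {σ : Set ℕ} {a b : ℕ} (ha : IsSigma σ a) (hb : IsSigma σ b) :
    IsSigma σ (a * b) :=
  fun q hq hd => (hq.dvd_mul.1 hd).elim (ha q hq) (hb q hq)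

/-- The subgroup of `σ`-elements of a cyclic subgroup. -/
def sigmaPart (C : Subgroup G) [IsCyclic C] (σ : Set ℕ) : Subgroup G where
  carrier := {x | x ∈ C ∧ IsSigma σ (orderOf x)}
  one_mem' := ⟨one_mem _, fun q hq hd => by
    rw [orderOf_one] at hd
    exact absurd (Nat.dvd_one.1 hd) hq.one_lt.ne'⟩
  mul_mem' := fun {x y} hx hy => ⟨mul_mem hx.1 hy.1, (hx.2.mul hy.2).of_dvd
    (Commute.orderOf_mul_dvd_mul_orderOf (mul_comm_of_mem_of_isCyclic C hx.1 hy.1))⟩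
  inv_mem' := fun {x} hx => ⟨inv_mem hx.1, by rw [orderOf_inv]; exact hx.2⟩

lemma isSigma_card_of_forall [Finite G] {K : Subgroup G} {σ : Set ℕ}
    (h : ∀ x ∈ K, IsSigma σ (orderOf x)) : IsSigma σ (Nat.card K) := by
  intro q hq hd
  have : Fact q.Prime := ⟨hq⟩
  obtain ⟨x, hx⟩ := exists_prime_orderOf_dvd_card' q hd
  have := h x x.2 q hq
  rw [Subgroup.orderOf_coe, hx] at this
  exact this dvd_rfl

lemma sigmaPart_normal (C : Subgroup G) [IsCyclic C] [hC : C.Normal] (σ : Set ℕ) :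
    (sigmaPart C σ).Normal where
  conj_mem n hn g := ⟨hC.conj_mem n hn.1 g, by
    have : SemiconjBy g n (g * n * g⁻¹) := by simp [SemiconjBy]
    rw [← this.orderOf_eq]; exact hn.2⟩

lemma isSigma_card_sup [Finite G] {A B : Subgroup G} [A.Normal] {σ : Set ℕ}
    (hA : IsSigma σ (Nat.card A)) (hB : IsSigma σ (Nat.card B)) :
    IsSigma σ (Nat.card (A ⊔ B : Subgroup G)) := by
  rw [← Subgroup.relIndex_bot_left, ← Subgroup.relIndex_mul_relIndex ⊥ A (A ⊔ B) bot_le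
    le_sup_left, Subgroup.relIndex_sup_left, Subgroup.relIndex_bot_left]
  exact hA.mul (hB.of_dvd (Subgroup.relIndex_dvd_card A B))

lemma exists_mul_eq_of_isSigma [Finite G] {p : ℕ} (hp : p.Prime) (y : G) :
    ∃ z w, y = z * w ∧ z ∈ Subgroup.zpowers y ∧ w ∈ Subgroup.zpowers y ∧
      IsSigma {p} (orderOf z) ∧ IsSigma {p}ᶜ (orderOf w) := by
  set N := orderOf y with hN
  have hN0 : N ≠ 0 := (orderOf_pos y).ne'
  set u := ordProj[p] N
  set v := ordCompl[p] N
  have huv : u * v = N := Nat.ordProj_mul_ordCompl_eq_self N p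
  have hcop : IsCoprime (u : ℤ) (v : ℤ) :=
    Nat.isCoprime_iff_coprime.2 ((Nat.coprime_ordCompl hp hN0).pow_left _)
  obtain ⟨α, β, hαβ⟩ := hcop
  have hy : y ^ (N : ℤ) = 1 := by rw [zpow_natCast]; exact pow_orderOf_eq_one y
  refine ⟨y ^ (β * v), y ^ (α * u), ?_, ⟨_, rfl⟩, ⟨_, rfl⟩, ?_, ?_⟩
  · rw [← zpow_add, add_comm, hαβ, zpow_one]
  · refine (isSigma_singleton_pow hp (N.factorization p)).of_dvd (orderOf_dvd_of_pow_eq_one ?_)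
    have : (β * v) * (u : ℤ) = N * β := by rw [← huv]; push_cast; ring
    change (y ^ (β * v)) ^ u = 1
    rw [← zpow_natCast, ← zpow_mul, this, zpow_mul, hy, one_zpow]
  · refine ((isSigma_compl_singleton_iff hp).2 (Nat.not_dvd_ordCompl hp hN0)).of_dvd
      (orderOf_dvd_of_pow_eq_one ?_)
    have : (α * u) * (v : ℤ) = N * α := by rw [← huv]; push_cast; ring
    change (y ^ (α * u)) ^ v = 1
    rw [← zpow_natCast, ← zpow_mul, this, zpow_mul, hy, one_zpow]

lemma MetacyclicFact.exists_prod_equiv [Finite G] (f : MetacyclicFact G) {p : ℕ} (hp : p.Prime)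
    (h1 : f.Splits {p}) (h2 : f.Splits {p}ᶜ) :
    ∃ K L : Subgroup G, IsSigma {p} (Nat.card K) ∧ ¬ p ∣ Nat.card L ∧ Nonempty (K × L ≃* G) := by
  have i1 := f.normalA
  have i2 := f.cyclicA
  have i3 := f.cyclicB
  have n1 := sigmaPart_normal f.A {p}
  have n2 := sigmaPart_normal f.A {p}ᶜ
  set K := sigmaPart f.A {p} ⊔ sigmaPart f.B {p} with hK
  set L := sigmaPart f.A {p}ᶜ ⊔ sigmaPart f.B {p}ᶜ with hL
  have cK : IsSigma {p} (Nat.card K) :=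
    isSigma_card_sup (isSigma_card_of_forall fun x hx => hx.2)
      (isSigma_card_of_forall fun x hx => hx.2)
  have cL : IsSigma {p}ᶜ (Nat.card L) :=
    isSigma_card_sup (isSigma_card_of_forall fun x hx => hx.2)
      (isSigma_card_of_forall fun x hx => hx.2)
  have hcomm : K ≤ Subgroup.centralizer (L : Set G) := by
    refine sup_le (Subgroup.le_centralizer_iff.1 (sup_le ?_ ?_))
      (Subgroup.le_centralizer_iff.1 (sup_le ?_ ?_)) <;>
      intro x hx <;> rw [Subgroup.mem_centralizer_iff] <;> intro y hy
    · exact mul_comm_of_mem_of_isCyclic f.A hy.1 hx.1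
    · exact (h2 x hx.2 y hy.1 (by rw [compl_compl]; exact hy.2)).symm
    · exact h1 y hy.2 x hx.1 hx.2
    · exact mul_comm_of_mem_of_isCyclic f.B hy.1 hx.1
  refine ⟨K, L, cK, (isSigma_compl_singleton_iff hp).1 cL, ⟨?_⟩⟩
  let F : K × L →* G := K.subtype.noncommCoprod L.subtype fun m n =>
    (Subgroup.mem_centralizer_iff.1 (hcomm m.2) n n.2).symm
  refine MulEquiv.ofBijective F ⟨?_, ?_⟩
  · rw [injective_iff_map_eq_one]
    rintro ⟨x, y⟩ hxy
    have hxy' : (x : G) * y = 1 := hxy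
    have ex : (x : G) = (y : G)⁻¹ := eq_inv_of_mul_eq_one_left hxy'
    have d1 : orderOf (x : G) ∣ Nat.card K := Subgroup.orderOf_dvd_natCard _ x.2
    have d2 : orderOf (x : G) ∣ Nat.card L := by
      rw [ex, orderOf_inv]; exact Subgroup.orderOf_dvd_natCard _ y.2
    have hx1 : (x : G) = 1 := orderOf_eq_one_iff.1 (Nat.eq_one_of_dvd_coprimes (cK.coprime cL) d1 d2)
    have hy1 : (y : G) = 1 := by simpa [hx1] using hxy'
    exact Prod.ext (Subtype.ext hx1) (Subtype.ext hy1)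
  · intro g
    obtain ⟨x, hx, y, hy, rfl⟩ := f.mul_cover g
    obtain ⟨x₁, x₂, ex, hx₁, hx₂, ox₁, ox₂⟩ := exists_mul_eq_of_isSigma hp x
    obtain ⟨y₁, y₂, ey, hy₁, hy₂, oy₁, oy₂⟩ := exists_mul_eq_of_isSigma hp y
    have zx : Subgroup.zpowers x ≤ f.A := by simpa using hx
    have zy : Subgroup.zpowers y ≤ f.B := by simpa using hy
    have kx : x₁ ∈ K := (le_sup_left : _ ≤ K) ⟨zx hx₁, ox₁⟩
    have ky : y₁ ∈ K := (le_sup_right : _ ≤ K) ⟨zy hy₁, oy₁⟩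
    have lx : x₂ ∈ L := (le_sup_left : _ ≤ L) ⟨zx hx₂, ox₂⟩
    have ly : y₂ ∈ L := (le_sup_right : _ ≤ L) ⟨zy hy₂, oy₂⟩
    refine ⟨(⟨x₁ * y₁, mul_mem kx ky⟩, ⟨x₂ * y₂, mul_mem lx ly⟩), ?_⟩
    change (x₁ * y₁) * (x₂ * y₂) = x * y
    have hc : x₂ * y₁ = y₁ * x₂ := Subgroup.mem_centralizer_iff.1 (hcomm ky) x₂ lx
    rw [ex, ey, mul_assoc, ← mul_assoc y₁, ← hc]
    group

lemma ordProj_mul_of_isSigma {p : ℕ} (hp : p.Prime) {n c l : ℕ} (hn : n ≠ 0)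
    (hs : IsSigma {p} n) (hc : c ∣ l) (hl : ¬ p ∣ l) : ordProj[p] (n * c) = n := by
  obtain ⟨k, rfl⟩ := hs.exists_eq_pow hn
  have hpc : ¬ p ∣ c := fun h => hl (h.trans hc)
  have hc0 : c ≠ 0 := fun h => hpc (h ▸ dvd_zero p)
  rw [Nat.factorization_mul hn hc0]
  simp [Nat.factorization_eq_zero_of_not_dvd hpc, hp.factorization_self]

lemma IsMinimalFact.p_parts_eq [Finite G] {p : ℕ} (hp : p.Prime) {K L : Type*} [Group K] [Group L]
    [Finite K] [Finite L] (cK : IsSigma {p} (Nat.card K)) (cL : ¬ p ∣ Nat.card L) (e : K × L ≃* G)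
    {f : MetacyclicFact G} (hf : IsMinimalFact f) {f₁ : MetacyclicFact K}
    (hf₁ : IsMinimalFact f₁) :
    ordProj[p] (mOf f) = mOf f₁ ∧ ordProj[p] (rOf f) = rOf f₁ := by
  have i1 := f.normalA
  have i2 := f.cyclicA
  have i3 := f₁.normalA
  have i4 := f₁.cyclicA
  have hf' := hf.map_equiv e.symm
  have hc : (Nat.card K).Coprime (Nat.card L) :=
    cK.coprime ((isSigma_compl_singleton_iff hp).2 cL)
  obtain ⟨a, b, hm, ha, hr, hb⟩ := hf'.of_prod hc hf₁
  have em : mOf (f.map e.symm.toMonoidHom e.symm.surjective) = mOf f := card_map_equiv e.symm f.A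
  have er : rOf (f.map e.symm.toMonoidHom e.symm.surjective) = rOf f := rOfA_map_equiv e.symm f.A
  rw [em] at hm
  rw [er] at hr
  have sm : IsSigma {p} (mOf f₁) := cK.of_dvd f₁.A.card_subgroup_dvd_card
  have sr : IsSigma {p} (rOf f₁) := sm.of_dvd (rOfA_dvd_card _)
  exact ⟨by rw [hm]; exact ordProj_mul_of_isSigma hp Nat.card_pos.ne' sm ha cL,
    by rw [hr]; exact ordProj_mul_of_isSigma hp (rOfA_pos _).ne' sr hb cL⟩

end Splitting

section Abelianization

lemma dvd_of_isPrimitiveRoot_mem_adjoin {N d : ℕ} (hN : N ≠ 0) (hd : d ≠ 0) (h2 : Even N) {ζ x : ℂ}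
    (hζ : IsPrimitiveRoot ζ N) (hx : IsPrimitiveRoot x d) (hmem : x ∈ Algebra.adjoin ℚ {ζ}) :
    d ∣ N := by
  have : NeZero N := ⟨hN⟩
  have i1 : IsCyclotomicExtension {N} ℚ (Algebra.adjoin ℚ {ζ}) :=
    hζ.adjoin_isCyclotomicExtension ℚ
  have i2 := IsCyclotomicExtension.finiteDimensional {N} ℚ (Algebra.adjoin ℚ {ζ})
  have hζ' : IsPrimitiveRoot (⟨ζ, Algebra.self_mem_adjoin_singleton ℚ ζ⟩ : Algebra.adjoin ℚ {ζ}) N :=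
    IsPrimitiveRoot.of_map_of_injective (f := (Algebra.adjoin ℚ {ζ}).val) hζ Subtype.val_injective
  have hx' : IsPrimitiveRoot (⟨x, hmem⟩ : Algebra.adjoin ℚ {ζ}) d :=
    IsPrimitiveRoot.of_map_of_injective (f := (Algebra.adjoin ℚ {ζ}).val) hx Subtype.val_injective
  have key := hx'.lcm_totient_le_finrank hζ' (Polynomial.cyclotomic.irreducible_rat
    (Nat.lcm_pos (Nat.pos_of_ne_zero hd) (Nat.pos_of_ne_zero hN)))
  rw [IsCyclotomicExtension.finrank _ (Polynomial.cyclotomic.irreducible_rat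
    (Nat.pos_of_ne_zero hN))] at key
  have hdvd : N ∣ d.lcm N := Nat.dvd_lcm_right d N
  have hle := Nat.le_of_dvd (Nat.totient_pos.2 (Nat.lcm_pos (Nat.pos_of_ne_zero hd)
    (Nat.pos_of_ne_zero hN))) (Nat.totient_dvd_of_dvd hdvd)
  rw [h2.eq_of_totient_eq_totient hdvd (le_antisymm hle key)]
  exact Nat.dvd_lcm_left d N

variable {H : Type*} [Group H]

/-- The exponent of the abelianization. -/
def expAb (G : Type*) [Group G] : ℕ := Monoid.exponent (Abelianization G)

lemma expAb_dvd_iff {n : ℕ} : expAb G ∣ n ↔ ∀ g : G, g ^ n ∈ commutator G := by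
  rw [expAb, Monoid.exponent_dvd]
  constructor
  · intro h g
    have := orderOf_dvd_iff_pow_eq_one.1 (h (Abelianization.of g))
    rwa [← map_pow, ← MonoidHom.mem_ker, Abelianization.ker_of] at this
  · intro h x
    obtain ⟨g, rfl⟩ := QuotientGroup.mk_surjective x
    refine orderOf_dvd_of_pow_eq_one ?_
    change Abelianization.of g ^ n = 1
    rw [← map_pow, ← MonoidHom.mem_ker, Abelianization.ker_of]
    exact h g

lemma expAb_ne_zero [Finite G] : expAb G ≠ 0 := by
  have : Finite (Abelianization G) := Finite.of_surjective _ (QuotientGroup.mk_surjective)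
  exact Monoid.exponent_ne_zero_of_finite

lemma hom_pow_expAb (χ : G →* ℂˣ) (g : G) : χ g ^ expAb G = 1 := by
  have h : g ^ expAb G ∈ commutator G := expAb_dvd_iff.1 dvd_rfl g
  rw [← map_pow]
  exact Abelianization.commutator_subset_ker χ h

lemma pow_mem_commutator_of_hom [Finite G] {n : ℕ} {g : G} (h : ∀ χ : G →* ℂˣ, χ g ^ n = 1) :
    g ^ n ∈ commutator G := by
  have : Finite (Abelianization G) := Finite.of_surjective _ (QuotientGroup.mk_surjective)
  by_contra hc
  have hne : Abelianization.of (g ^ n) ≠ 1 := by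
    rwa [Ne, ← MonoidHom.mem_ker, Abelianization.ker_of]
  have : NeZero (Monoid.exponent (Abelianization G)) := ⟨Monoid.exponent_ne_zero_of_finite⟩
  obtain ⟨χ, hχ⟩ := CommGroup.exists_apply_ne_one_of_hasEnoughRootsOfUnity (Abelianization G) ℂ hne
  apply hχ
  have := h (χ.comp Abelianization.of)
  rwa [← map_pow] at this

/-- A linear character of `G` transported along an isomorphism of group algebras. -/
def transportHom (φ : MonoidAlgebra ℚ G ≃ₐ[ℚ] MonoidAlgebra ℚ H) (χ : H →* ℂˣ) : G →* ℂˣ :=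
  MonoidHom.toHomUnits
    ((((MonoidAlgebra.lift ℚ ℂ H ((Units.coeHom ℂ).comp χ)).comp φ.toAlgHom :
      MonoidAlgebra ℚ G →ₐ[ℚ] ℂ) : MonoidAlgebra ℚ G →* ℂ).comp (MonoidAlgebra.of ℚ G))

lemma lift_transportHom (φ : MonoidAlgebra ℚ G ≃ₐ[ℚ] MonoidAlgebra ℚ H) (χ : H →* ℂˣ) :
    MonoidAlgebra.lift ℚ ℂ G ((Units.coeHom ℂ).comp (transportHom φ χ)) =
      (MonoidAlgebra.lift ℚ ℂ H ((Units.coeHom ℂ).comp χ)).comp φ.toAlgHom := by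
  ext g
  simp [transportHom]

lemma expAb_dvd_of_algEquiv [Finite G] [Finite H]
    (φ : MonoidAlgebra ℚ G ≃ₐ[ℚ] MonoidAlgebra ℚ H) :
    expAb H ∣ Nat.lcm 2 (expAb G) := by
  set N := Nat.lcm 2 (expAb G) with hN
  have hN0 : N ≠ 0 := Nat.lcm_ne_zero two_ne_zero expAb_ne_zero
  have h2 : Even N := even_iff_two_dvd.2 (Nat.dvd_lcm_left 2 _)
  obtain ⟨ζ, hζ⟩ : ∃ ζ : ℂ, IsPrimitiveRoot ζ N := ⟨_, Complex.isPrimitiveRoot_exp N hN0⟩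
  have : NeZero N := ⟨hN0⟩
  refine expAb_dvd_iff.2 fun h => pow_mem_commutator_of_hom fun χ => ?_
  set ψ := transportHom φ χ
  have hrange : ∀ z, MonoidAlgebra.lift ℚ ℂ G ((Units.coeHom ℂ).comp ψ) z ∈
      Algebra.adjoin ℚ {ζ} := by
    intro z
    induction z using MonoidAlgebra.induction_linear with
    | zero => rw [map_zero]; exact zero_mem _
    | add x y hx hy => rw [map_add]; exact add_mem hx hy
    | single g c =>
      rw [MonoidAlgebra.lift_single]
      refine Subalgebra.smul_mem _ ?_ c
      have hp : ((ψ g : ℂˣ) : ℂ) ^ N = 1 := by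
        obtain ⟨e, he⟩ : expAb G ∣ N := Nat.dvd_lcm_right 2 _
        rw [he, pow_mul]
        have := congrArg Units.val (hom_pow_expAb ψ g)
        rw [Units.val_pow_eq_pow_val, Units.val_one] at this
        rw [this, one_pow]
      obtain ⟨i, -, hi⟩ := hζ.eq_pow_of_pow_eq_one hp
      change ((ψ g : ℂˣ) : ℂ) ∈ _
      rw [← hi]
      exact pow_mem (Algebra.self_mem_adjoin_singleton ℚ ζ) i
  have hmem : ((χ h : ℂˣ) : ℂ) ∈ Algebra.adjoin ℚ {ζ} := by
    have := hrange (φ.symm (MonoidAlgebra.single h 1))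
    rw [lift_transportHom] at this
    simpa using this
  have hfin : IsOfFinOrder ((χ h : ℂˣ) : ℂ) :=
    MonoidHom.isOfFinOrder ((Units.coeHom ℂ).comp χ) (isOfFinOrder_of_finite h)
  have hd := dvd_of_isPrimitiveRoot_mem_adjoin hN0 hfin.orderOf_pos.ne' h2 hζ
    (IsPrimitiveRoot.orderOf _) hmem
  refine Units.ext ?_
  rw [Units.val_pow_eq_pow_val, Units.val_one]
  exact orderOf_dvd_iff_pow_eq_one.1 hd

lemma card_abelianization_eq_card_algHom [Finite G] :
    Nat.card (Abelianization G) = Nat.card (MonoidAlgebra ℚ G →ₐ[ℚ] ℂ) := by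
  have : Finite (Abelianization G) := Finite.of_surjective _ (QuotientGroup.mk_surjective)
  have : NeZero (Monoid.exponent (Abelianization G)) := ⟨Monoid.exponent_ne_zero_of_finite⟩
  rw [← CommGroup.card_monoidHom_of_hasEnoughRootsOfUnity (Abelianization G) ℂ]
  refine Nat.card_congr ((Abelianization.lift (G := G) (A := ℂˣ)).symm.trans
    (Equiv.trans ?_ (MonoidAlgebra.lift ℚ ℂ G)))
  exact ⟨fun χ => (Units.coeHom ℂ).comp χ, MonoidHom.toHomUnits,
    fun χ => by ext; rfl, fun χ => by ext; rfl⟩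

lemma card_commutator_eq_of_algEquiv [Finite G] [Finite H]
    (φ : MonoidAlgebra ℚ G ≃ₐ[ℚ] MonoidAlgebra ℚ H) :
    Nat.card (commutator G) = Nat.card (commutator H) := by
  have h1 : Nat.card (Abelianization G) = Nat.card (Abelianization H) := by
    rw [card_abelianization_eq_card_algHom, card_abelianization_eq_card_algHom]
    exact Nat.card_congr ⟨fun f => f.comp φ.symm.toAlgHom, fun f => f.comp φ.toAlgHom,
      fun f => by ext; simp, fun f => by ext; simp⟩
  have h2 := (commutator G).card_eq_card_quotient_mul_card_subgroup
  have h3 := (commutator H).card_eq_card_quotient_mul_card_subgroup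
  rw [card_eq_of_algEquiv φ, h3] at h2
  change Nat.card (Abelianization H) * _ = Nat.card (Abelianization G) * _ at h2
  rw [h1] at h2
  have : Finite (Abelianization H) := Finite.of_surjective _ (QuotientGroup.mk_surjective)
  exact (Nat.eq_of_mul_eq_mul_left Nat.card_pos h2).symm

lemma map_mem_commutator {A B : Type*} [Group A] [Group B] (f : A →* B) {x : A}
    (hx : x ∈ commutator A) : f x ∈ commutator B := by
  have h : (commutator A).map f ≤ commutator B := by
    rw [commutator_def, Subgroup.map_commutator]
    exact Subgroup.commutator_mono le_top le_top
  exact h ⟨x, hx, rfl⟩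

lemma expAb_prod {p : ℕ} (hp : p.Prime) {K L : Type*} [Group K] [Group L]
    [Finite K] (cK : IsSigma {p} (Nat.card K)) (cL : ¬ p ∣ Nat.card L) (e : K × L ≃* G) :
    ordProj[p] (expAb G) = expAb K := by
  have d1 : expAb K ∣ expAb G := expAb_dvd_iff.2 fun k => by
    have h := map_mem_commutator ((MonoidHom.fst K L).comp e.symm.toMonoidHom)
      (expAb_dvd_iff.1 dvd_rfl (e (k, 1)))
    simpa using h
  have d2 : expAb G ∣ expAb K * Nat.card L := expAb_dvd_iff.2 fun g => by
    obtain ⟨⟨k, l⟩, rfl⟩ := e.surjective g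
    have h := map_mem_commutator (e.toMonoidHom.comp (MonoidHom.inl K L))
      (pow_mem (expAb_dvd_iff.1 dvd_rfl k) (Nat.card L))
    have hl : (k, l) ^ (expAb K * Nat.card L) = ((k ^ expAb K) ^ Nat.card L, 1) := by
      rw [Prod.pow_mk, pow_mul, mul_comm, pow_mul l, pow_card_eq_one', one_pow]
    rw [← map_pow, hl]
    exact h
  have d3 : expAb K ∣ Nat.card K := expAb_dvd_iff.2 fun k => by
    rw [pow_card_eq_one']; exact one_mem _
  obtain ⟨c, hc⟩ := d1
  rw [hc] at d2 ⊢
  exact ordProj_mul_of_isSigma hp expAb_ne_zero (cK.of_dvd d3)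
    (Nat.dvd_of_mul_dvd_mul_left (Nat.pos_of_ne_zero expAb_ne_zero) d2) cL

lemma card_commutator_prod {p : ℕ} (hp : p.Prime) {K L : Type*} [Group K] [Group L]
    [Finite K] (cK : IsSigma {p} (Nat.card K)) (cL : ¬ p ∣ Nat.card L) (e : K × L ≃* G) :
    ordProj[p] (Nat.card (commutator G)) = Nat.card (commutator K) := by
  have h1 : (commutator (K × L)).map e.toMonoidHom = commutator G := by
    rw [commutator_def, Subgroup.map_commutator, Subgroup.map_top_of_surjective _ e.surjective]
    rfl
  have h2 : commutator (K × L) = (commutator K).prod (commutator L) := by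
    rw [commutator_def, ← Subgroup.top_prod_top, Subgroup.commutator_prod_prod]
    rfl
  rw [← h1, Subgroup.card_map_of_injective e.injective, h2,
    Nat.card_congr ((commutator K).prodEquiv (commutator L)).toEquiv, Nat.card_prod]
  exact ordProj_mul_of_isSigma hp Nat.card_pos.ne' (cK.of_dvd (commutator K).card_subgroup_dvd_card)
    (commutator L).card_subgroup_dvd_card cL

end Abelianization

section Generators

lemma geom_sum_range_mul {R : Type*} [CommRing R] (v : R) (a b : ℕ) :
    ∑ i ∈ Finset.range (a * b), v ^ i =
      (∑ i ∈ Finset.range a, v ^ i) * ∑ i ∈ Finset.range b, (v ^ a) ^ i := by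
  induction b with
  | zero => simp
  | succ b ih =>
    rw [mul_add_one, Finset.sum_range_add, ih, Finset.sum_range_succ, mul_add, add_right_inj,
      ← pow_mul, Finset.sum_mul]
    exact Finset.sum_congr rfl fun i _ => by rw [pow_add, mul_comm]

lemma exists_geom_sum_prime_eq {p : ℕ} (hp : p.Prime) {v : ℤ} (h1 : (p : ℤ) ∣ v - 1)
    (h2 : p = 2 → 4 ∣ v - 1) :
    ∃ w : ℤ, ∑ i ∈ Finset.range p, v ^ i = p * w ∧ ¬ (p : ℤ) ∣ w := by
  have hp0 : (p : ℤ) ≠ 0 := by exact_mod_cast hp.ne_zero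
  have hp1 : ¬ (p : ℤ) ∣ 1 := by
    intro h
    exact hp.one_lt.ne' (Nat.dvd_one.1 (by exact_mod_cast h))
  rcases hp.eq_two_or_odd' with rfl | hodd
  · obtain ⟨c, hc⟩ := h2 rfl
    refine ⟨1 + 2 * c, ?_, ?_⟩
    · rw [Finset.sum_range_succ, Finset.sum_range_one]
      push_cast
      linarith
    · push_cast
      omega
  · obtain ⟨c, hc⟩ := h1
    have hv : v = 1 + p * c := by linarith
    obtain ⟨d, hd⟩ := odd_sq_dvd_geom_sum₂_sub (R := ℤ) (1 : ℤ) c hodd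
    refine ⟨1 + p * d, ?_, fun h => hp1 ?_⟩
    · rw [hv]
      simp only [one_pow, mul_one] at hd
      linarith
    · simpa using (dvd_add_left (dvd_mul_right (p : ℤ) d)).1 h

lemma exists_geom_sum_eq {p : ℕ} (hp : p.Prime) {v : ℤ} (h1 : (p : ℤ) ∣ v - 1)
    (h2 : p = 2 → 4 ∣ v - 1) (k : ℕ) :
    ∃ w : ℤ, ∑ i ∈ Finset.range (p ^ k), v ^ i = (p : ℤ) ^ k * w ∧ ¬ (p : ℤ) ∣ w := by
  induction k with
  | zero =>
    refine ⟨1, by simp, fun h => hp.one_lt.ne' (Nat.dvd_one.1 (by exact_mod_cast h))⟩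
  | succ k ih =>
    obtain ⟨w, hw, hpw⟩ := ih
    have hd : v - 1 ∣ v ^ p ^ k - 1 := by simpa using sub_dvd_pow_sub_pow v 1 (p ^ k)
    obtain ⟨w', hw', hpw'⟩ := exists_geom_sum_prime_eq hp (h1.trans hd) fun h => (h2 h).trans hd
    refine ⟨w * w', ?_, fun h => ?_⟩
    · rw [pow_succ, geom_sum_range_mul, hw, hw']
      ring
    · exact ((Nat.prime_iff_prime_int.1 hp).dvd_or_dvd h).elim hpw hpw'

lemma mul_zpow_pow {h a : G} {v : ℤ} (hv : a * h = h * a ^ v) (x : ℤ) (k : ℕ) :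
    (h * a ^ x) ^ k = h ^ k * a ^ (x * ∑ i ∈ Finset.range k, v ^ i) := by
  have hz : ∀ y : ℤ, a ^ y * h = h * a ^ (v * y) := by
    intro y
    have h1 : SemiconjBy h (a ^ v) a := hv.symm
    have h2 : h * (a ^ v) ^ y = a ^ y * h := h1.zpow_right y
    rw [zpow_mul, h2]
  induction k with
  | zero => simp
  | succ k ih =>
    rw [pow_succ, ih, mul_assoc, ← mul_assoc _ h, hz, pow_succ, mul_assoc, mul_assoc, ← zpow_add,
      geom_sum_succ]
    congr 3
    ring

lemma zpow_mul_pow_eq {a b : G} {u : ℤ} (hab : a * b = b * a ^ u) (x : ℤ) (k : ℕ) :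
    a ^ x * b ^ k = b ^ k * a ^ (x * u ^ k) := by
  induction k generalizing x with
  | zero => simp
  | succ k ih =>
    have h1 : SemiconjBy b (a ^ u) a := hab.symm
    have h2 : b * (a ^ u) ^ x = a ^ x * b := h1.zpow_right x
    rw [pow_succ', ← mul_assoc, ← h2, ← zpow_mul, mul_assoc, ih, ← mul_assoc]
    congr 2
    ring

/-- Twisting a generator: if `h` acts on `⟨a⟩` by a power `v` close to `1` and `h ^ p ^ k = a ^ σ`,
then some `h * a ^ x` has `p ^ k`-th power equal to `a ^ r`. -/
lemma exists_twist {p : ℕ} (hp : p.Prime) {μ k : ℕ} {h a : G} (ha : a ^ p ^ μ = 1) {v σ r : ℤ}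
    (hv : a * h = h * a ^ v) (h1 : (p : ℤ) ∣ v - 1) (h2 : p = 2 → 4 ∣ v - 1)
    (hh : h ^ p ^ k = a ^ σ) {c : ℤ} (hc : r - σ = (p : ℤ) ^ k * c) :
    ∃ x : ℤ, (h * a ^ x) ^ p ^ k = a ^ r ∧ ((p : ℤ) ∣ x → (p : ℤ) ∣ c) := by
  obtain ⟨w, hw, hpw⟩ := exists_geom_sum_eq hp h1 h2 k
  have hcop : IsCoprime w ((p : ℤ) ^ (μ + 1)) :=
    (((Nat.prime_iff_prime_int.1 hp).coprime_iff_not_dvd).2 hpw).symm.pow_right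
  obtain ⟨α, β, hαβ⟩ := hcop
  have hx : α * c * w - c = (p : ℤ) ^ (μ + 1) * (- (β * c)) := by linear_combination c * hαβ
  refine ⟨α * c, ?_, fun hd => ?_⟩
  · rw [mul_zpow_pow hv, hh, hw, ← zpow_add]
    have : σ + α * c * ((p : ℤ) ^ k * w) = r + (p ^ μ : ℕ) * ((p : ℤ) ^ k * p * (- (β * c))) := by
      push_cast
      linear_combination (p : ℤ) ^ k * hx - hc
    rw [this, zpow_add, zpow_mul, zpow_natCast, ha, one_zpow, mul_one]
  · have h3 : (p : ℤ) ∣ α * c * w - c := by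
      rw [hx, pow_succ]
      exact Dvd.intro_left ((p : ℤ) ^ μ * -(β * c)) (by ring)
    exact (dvd_sub_right (hd.mul_right w)).1 h3

/-- Adapted generators of a metacyclic factorization. -/
structure MetacyclicFact.Gens (f : MetacyclicFact G) where
  a : G
  b : G
  u : ℤ
  zpowers_a : Subgroup.zpowers a = f.A
  zpowers_b : Subgroup.zpowers b = f.B
  mul_eq : a * b = b * a ^ u

lemma MetacyclicFact.exists_gens [Finite G] (f : MetacyclicFact G) : Nonempty f.Gens := by
  have := f.normalA
  have := f.cyclicA
  have := f.cyclicB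
  obtain ⟨a, ha, hA⟩ := exists_generator f.A
  obtain ⟨b, hb, hB⟩ := exists_generator f.B
  obtain ⟨t, ht⟩ := exists_conjActsAsPow f.A b
  refine ⟨⟨a, b, t, hA, hB, ?_⟩⟩
  have := ht a ha
  rw [zpow_natCast, ← this]
  group

end Generators

section GeneratorLemmas

open scoped commutatorElement

lemma commutator_le_of_commute {N : Subgroup G} [N.Normal] {a b : G}
    (hgen : ∀ g : G, ∃ i j : ℤ, g = a ^ i * b ^ j)
    (hab : Commute (a : G ⧸ N) (b : G ⧸ N)) : commutator G ≤ N := by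
  rw [commutator_def, Subgroup.commutator_le]
  intro g _ h _
  obtain ⟨i, j, rfl⟩ := hgen g
  obtain ⟨k, l, rfl⟩ := hgen h
  rw [← QuotientGroup.eq_one_iff]
  have hc : Commute ((a : G ⧸ N) ^ i * (b : G ⧸ N) ^ j) ((a : G ⧸ N) ^ k * (b : G ⧸ N) ^ l) :=
    Commute.mul_left
      (Commute.mul_right (Commute.zpow_zpow_self _ _ _) (hab.zpow_zpow _ _))
      (Commute.mul_right (hab.symm.zpow_zpow _ _) (Commute.zpow_zpow_self _ _ _))
  have := commutatorElement_eq_one_iff_commute.2 hc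
  simpa [commutatorElement_def] using this

/-- A metacyclic factorization from two generators, one of which generates a subgroup containing
the commutator subgroup. -/
lemma exists_fact_of_generators {c d : G} (hc : commutator G ≤ Subgroup.zpowers c)
    (hcd : Subgroup.closure {c, d} = ⊤) : ∃ f : MetacyclicFact G, f.A = Subgroup.zpowers c := by
  have hn : (Subgroup.zpowers c).Normal :=
    ⟨fun n hn g => by
      have h1 : ⁅g, n⁆ ∈ commutator G := Subgroup.commutator_mem_commutator
        (Subgroup.mem_top _) (Subgroup.mem_top _)
      have := mul_mem (hc h1) hn
      simpa [commutatorElement_def] using this⟩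
  refine ⟨⟨Subgroup.zpowers c, Subgroup.zpowers d, hn, inferInstance, inferInstance, fun g => ?_⟩,
    rfl⟩
  have hg : g ∈ Subgroup.zpowers c ⊔ Subgroup.zpowers d := by
    rw [Subgroup.zpowers_eq_closure, Subgroup.zpowers_eq_closure, ← Subgroup.closure_union,
      Set.singleton_union, hcd]
    exact Subgroup.mem_top g
  obtain ⟨x, hx, y, hy, h⟩ := Subgroup.mem_sup_of_normal_left.1 hg
  exact ⟨x, hx, y, hy, h.symm⟩

lemma normal_of_le_of_isCyclic [Finite G] {A C : Subgroup G} [A.Normal] [IsCyclic A] (h : C ≤ A) :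
    C.Normal where
  conj_mem n hn g := by
    obtain ⟨t, ht⟩ := exists_conjActsAsPow A g⁻¹
    have := ht n (h hn)
    rw [inv_inv] at this
    rw [this]
    exact pow_mem hn t

variable {f : MetacyclicFact G}

lemma MetacyclicFact.Gens.exists_eq (s : f.Gens) (g : G) : ∃ i j : ℤ, g = s.a ^ i * s.b ^ j := by
  obtain ⟨x, hx, y, hy, rfl⟩ := f.mul_cover g
  rw [← s.zpowers_a] at hx
  rw [← s.zpowers_b] at hy
  obtain ⟨i, rfl⟩ := hx
  obtain ⟨j, rfl⟩ := hy
  exact ⟨i, j, rfl⟩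

lemma MetacyclicFact.Gens.orderOf_a (s : f.Gens) : orderOf s.a = Nat.card f.A := by
  rw [← s.zpowers_a, Nat.card_zpowers]

lemma MetacyclicFact.Gens.zpow_eq_one_iff (s : f.Gens) (x : ℤ) :
    s.a ^ x = 1 ↔ (Nat.card f.A : ℤ) ∣ x := by
  rw [← s.orderOf_a, orderOf_dvd_iff_zpow_eq_one]

lemma MetacyclicFact.Gens.zpow_eq_iff (s : f.Gens) (x y : ℤ) :
    s.a ^ x = s.a ^ y ↔ (Nat.card f.A : ℤ) ∣ x - y := by
  rw [← s.zpow_eq_one_iff, zpow_sub, mul_inv_eq_one]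

lemma MetacyclicFact.Gens.commutator_eq [Finite G] (s : f.Gens) :
    commutator G = Subgroup.zpowers (s.a ^ (s.u - 1)) := by
  have hb : s.b⁻¹ * s.a * s.b = s.a ^ s.u := by rw [mul_assoc, s.mul_eq]; group
  apply le_antisymm
  · have hn : (Subgroup.zpowers (s.a ^ (s.u - 1))).Normal := by
      have := f.normalA
      have := f.cyclicA
      refine normal_of_le_of_isCyclic (A := f.A) ?_
      rw [← s.zpowers_a, Subgroup.zpowers_le]
      exact ⟨_, rfl⟩
    refine commutator_le_of_commute s.exists_eq ?_
    have h1 : ((s.a ^ (s.u - 1) : G) : G ⧸ Subgroup.zpowers (s.a ^ (s.u - 1))) = 1 :=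
      (QuotientGroup.eq_one_iff _).2 (Subgroup.mem_zpowers _)
    change (s.a : G ⧸ Subgroup.zpowers (s.a ^ (s.u - 1))) * s.b = s.b * s.a
    rw [← QuotientGroup.mk_mul, s.mul_eq, ← QuotientGroup.mk_mul]
    rw [show s.b * s.a ^ s.u = s.b * s.a * s.a ^ (s.u - 1) by rw [mul_assoc, ← zpow_one_add]; simp,
      QuotientGroup.mk_mul, h1, mul_one]
  · rw [Subgroup.zpowers_le]
    have h1 : ⁅s.a⁻¹, s.b⁻¹⁆ ∈ commutator G := Subgroup.commutator_mem_commutator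
        (Subgroup.mem_top _) (Subgroup.mem_top _)
    rw [commutatorElement_def, inv_inv, inv_inv, mul_assoc s.a⁻¹, mul_assoc s.a⁻¹, hb] at h1
    rwa [zpow_sub_one, (Commute.refl s.a).zpow_left s.u |>.inv_right.eq]

/-- The greatest common divisor of `u - 1` and `|A|`. -/
def MetacyclicFact.Gens.r (s : f.Gens) : ℕ := Int.gcd (s.u - 1) (Nat.card f.A)

lemma MetacyclicFact.Gens.r_dvd (s : f.Gens) : s.r ∣ Nat.card f.A := by
  exact_mod_cast Int.gcd_dvd_right (s.u - 1) (Nat.card f.A)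

lemma MetacyclicFact.Gens.zpow_mem_commutator_iff [Finite G] (s : f.Gens) (x : ℤ) :
    s.a ^ x ∈ commutator G ↔ (s.r : ℤ) ∣ x := by
  rw [s.commutator_eq]
  have hr1 : (s.r : ℤ) ∣ s.u - 1 := Int.gcd_dvd_left _ _
  have hr2 : (s.r : ℤ) ∣ Nat.card f.A := Int.gcd_dvd_right _ _
  constructor
  · rintro ⟨k, hk⟩
    replace hk : (s.a ^ (s.u - 1)) ^ k = s.a ^ x := hk
    rw [← zpow_mul, s.zpow_eq_iff] at hk
    exact (dvd_sub_right (hr1.mul_right k)).1 (hr2.trans hk)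
  · rintro ⟨c, rfl⟩
    have hb := Int.gcd_eq_gcd_ab (s.u - 1) (Nat.card f.A)
    refine ⟨Int.gcdA (s.u - 1) (Nat.card f.A) * c, ?_⟩
    change (s.a ^ (s.u - 1)) ^ _ = _
    rw [← zpow_mul, s.zpow_eq_iff]
    refine ⟨- Int.gcdB (s.u - 1) (Nat.card f.A) * c, ?_⟩
    have : (s.r : ℤ) = _ := hb
    rw [this]
    ring

lemma MetacyclicFact.Gens.commutator_eq_zpowers_r [Finite G] (s : f.Gens) :
    commutator G = Subgroup.zpowers (s.a ^ s.r) := by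
  apply le_antisymm
  · rw [s.commutator_eq, Subgroup.zpowers_le]
    obtain ⟨c, hc⟩ : (s.r : ℤ) ∣ s.u - 1 := Int.gcd_dvd_left _ _
    exact ⟨c, by rw [hc, zpow_mul, zpow_natCast]⟩
  · rw [Subgroup.zpowers_le, ← zpow_natCast]
    exact (s.zpow_mem_commutator_iff _).2 dvd_rfl

lemma MetacyclicFact.Gens.card_commutator [Finite G] (s : f.Gens) :
    s.r * Nat.card (commutator G) = Nat.card f.A := by
  have h0 : s.r ≠ 0 := fun h => Nat.card_pos.ne' (Nat.eq_zero_of_zero_dvd (h ▸ s.r_dvd))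
  rw [s.commutator_eq_zpowers_r, Nat.card_zpowers,
    orderOf_pow_of_dvd h0 (s.orderOf_a ▸ s.r_dvd), s.orderOf_a, Nat.mul_div_cancel' s.r_dvd]

lemma MetacyclicFact.Gens.expAb_dvd [Finite G] (s : f.Gens) {E : ℕ} (h1 : s.r ∣ E)
    (h2 : s.b ^ E ∈ commutator G) : expAb G ∣ E := by
  refine expAb_dvd_iff.2 fun g => ?_
  obtain ⟨i, j, rfl⟩ := s.exists_eq g
  have ha : s.a ^ E ∈ commutator G := by
    rw [← zpow_natCast, s.zpow_mem_commutator_iff]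
    exact_mod_cast h1
  have h : Abelianization.of ((s.a ^ i * s.b ^ j) ^ E) =
      Abelianization.of ((s.a ^ E) ^ i * (s.b ^ E) ^ j) := by
    simp only [map_pow, map_mul, map_zpow, mul_pow]
    simp only [← zpow_natCast, ← zpow_mul, mul_comm]
  have hm : (s.a ^ E) ^ i * (s.b ^ E) ^ j ∈ commutator G := mul_mem (zpow_mem ha i) (zpow_mem h2 j)
  rw [← Abelianization.ker_of, MonoidHom.mem_ker] at hm ⊢
  rw [h, hm]

lemma MetacyclicFact.Gens.exists_pow_index [Finite G] (s : f.Gens) :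
    ∃ σ : ℤ, s.b ^ f.A.index = s.a ^ σ ∧ (Nat.card f.A : ℤ) ∣ σ * (s.u - 1) := by
  have := f.normalA
  have h : s.b ^ f.A.index ∈ Subgroup.zpowers s.a := s.zpowers_a ▸ Subgroup.pow_index_mem f.A s.b
  obtain ⟨σ, hσ⟩ := h
  refine ⟨σ, hσ.symm, ?_⟩
  have h1 := zpow_mul_pow_eq s.mul_eq σ 1
  rw [pow_one, pow_one, show s.a ^ σ = s.b ^ f.A.index from hσ, ← pow_succ, pow_succ',
    mul_right_inj, ← show s.a ^ σ = s.b ^ f.A.index from hσ, eq_comm, s.zpow_eq_iff] at h1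
  convert h1 using 1
  ring

lemma MetacyclicFact.index_dvd_expAb [Finite G] (f : MetacyclicFact G) : f.A.index ∣ expAb G := by
  have := f.normalA
  obtain ⟨s⟩ := f.exists_gens
  have hgen : ∀ x : G ⧸ f.A, x ∈ Subgroup.zpowers (s.b : G ⧸ f.A) := by
    intro x
    obtain ⟨g, rfl⟩ := QuotientGroup.mk_surjective x
    obtain ⟨i, j, rfl⟩ := s.exists_eq g
    refine ⟨j, ?_⟩
    have h : ((s.a ^ i : G) : G ⧸ f.A) = 1 :=
      (QuotientGroup.eq_one_iff _).2 (s.zpowers_a ▸ ⟨i, rfl⟩)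
    change (s.b : G ⧸ f.A) ^ j = _
    rw [QuotientGroup.mk_mul, h, one_mul, QuotientGroup.mk_zpow]
  have hle : commutator G ≤ f.A := by
    rw [s.commutator_eq, ← s.zpowers_a, Subgroup.zpowers_le]
    exact ⟨_, rfl⟩
  rw [Subgroup.index, ← orderOf_eq_card_of_forall_mem_zpowers hgen]
  refine orderOf_dvd_of_pow_eq_one ?_
  rw [← QuotientGroup.mk_pow, QuotientGroup.eq_one_iff]
  exact hle (expAb_dvd_iff.1 dvd_rfl s.b)

end GeneratorLemmas

section MinimalOrder

variable {f : MetacyclicFact G}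

lemma MetacyclicFact.Gens.eq_top (s : f.Gens) {C : Subgroup G} (ha : s.a ∈ C) (hb : s.b ∈ C) :
    C = ⊤ := by
  refine top_le_iff.1 fun g _ => ?_
  obtain ⟨i, j, rfl⟩ := s.exists_eq g
  exact mul_mem (zpow_mem ha i) (zpow_mem hb j)

/-- The acting exponent is `1` modulo `p`, and modulo `4` when `p = 2`. -/
def MetacyclicFact.Gens.Regular (s : f.Gens) (p : ℕ) : Prop :=
  (p : ℤ) ∣ s.u - 1 ∧ (p = 2 → 4 ∣ s.u - 1)

lemma MetacyclicFact.Gens.prime_dvd_sub_one [Finite G] (s : f.Gens) {p : ℕ} (hp : p.Prime)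
    (hG : IsSigma {p} (Nat.card G)) (hm : p ∣ Nat.card f.A) : (p : ℤ) ∣ s.u - 1 := by
  have : Fact p.Prime := ⟨hp⟩
  obtain ⟨N, hN⟩ := hG.exists_eq_pow Nat.card_pos.ne'
  have h := zpow_mul_pow_eq s.mul_eq 1 (Nat.card G)
  rw [pow_card_eq_one', mul_one, one_mul, one_mul, s.zpow_eq_iff, hN] at h
  have h1 : (p : ℤ) ∣ 1 - s.u ^ p ^ N := (Int.natCast_dvd_natCast.2 hm).trans h
  rw [← ZMod.intCast_zmod_eq_zero_iff_dvd] at h1 ⊢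
  push_cast at h1 ⊢
  rw [ZMod.pow_card_pow] at h1
  linear_combination -h1

lemma MetacyclicFact.exists_gens_regular_or [Finite G] (f : MetacyclicFact G) {p : ℕ}
    (hp : p.Prime) (hG : IsSigma {p} (Nat.card G)) :
    ∃ s : f.Gens, s.Regular p ∨ (p = 2 ∧ 4 ∣ Nat.card f.A ∧ (4 : ℤ) ∣ s.u + 1) := by
  obtain ⟨s⟩ := f.exists_gens
  by_cases hd : (Nat.card f.A : ℤ) ∣ 1 - s.u
  · refine ⟨⟨s.a, s.b, 1, s.zpowers_a, s.zpowers_b, ?_⟩, Or.inl ⟨by simp, by simp⟩⟩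
    rw [s.mul_eq, (s.zpow_eq_iff 1 s.u).2 hd]
  · refine ⟨s, ?_⟩
    obtain ⟨μ, hμ⟩ := (hG.of_dvd f.A.card_subgroup_dvd_card).exists_eq_pow Nat.card_pos.ne'
    have hμ0 : μ ≠ 0 := by
      rintro rfl
      rw [hμ] at hd
      simp at hd
    have h1 := s.prime_dvd_sub_one hp hG (hμ ▸ dvd_pow_self p hμ0)
    by_cases h2 : p = 2
    · subst h2
      have hμ1 : μ ≠ 1 := by
        rintro rfl
        rw [hμ] at hd
        omega
      have h4 : 4 ∣ Nat.card f.A := by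
        rw [hμ]
        exact pow_dvd_pow 2 (show 2 ≤ μ by omega)
      by_cases h5 : (4 : ℤ) ∣ s.u - 1
      · exact Or.inl ⟨h1, fun _ => h5⟩
      · exact Or.inr ⟨rfl, h4, by omega⟩
    · exact Or.inl ⟨h1, fun h => absurd h h2⟩

lemma MetacyclicFact.Gens.exists_fact_of_twist [Finite G] (s : f.Gens) {c d : G} {q E : ℕ}
    (hq : 0 < q) (hc : c ^ q = s.a ^ (s.r : ℤ))
    (hcd : Subgroup.closure {c, d} = ⊤) (hE : expAb G ∣ E) (hE0 : 0 < E)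
    (hqE : q * E = f.A.index * s.r) :
    ∃ f' : MetacyclicFact G, Nat.card f'.A * expAb G ≤ Nat.card G := by
  obtain ⟨f', hf'⟩ := exists_fact_of_generators (c := c) (d := d) (by
    rw [s.commutator_eq_zpowers_r, Subgroup.zpowers_le, ← zpow_natCast, ← hc]
    exact ⟨q, zpow_natCast _ _⟩) hcd
  refine ⟨f', ?_⟩
  have h1 : Nat.card f'.A ∣ q * Nat.card (commutator G) := by
    rw [hf', Nat.card_zpowers]
    refine orderOf_dvd_of_pow_eq_one ?_
    rw [pow_mul, hc, zpow_natCast, ← pow_mul, s.card_commutator, ← s.orderOf_a, pow_orderOf_eq_one]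
  calc Nat.card f'.A * expAb G ≤ (q * Nat.card (commutator G)) * E :=
        Nat.mul_le_mul (Nat.le_of_dvd (Nat.mul_pos hq Nat.card_pos) h1) (Nat.le_of_dvd hE0 hE)
    _ = (q * E) * Nat.card (commutator G) := by ring
    _ = f.A.index * (s.r * Nat.card (commutator G)) := by rw [hqE]; ring
    _ = Nat.card G := by rw [s.card_commutator, mul_comm, Subgroup.card_mul_index]

lemma MetacyclicFact.Gens.exists_card_mul_expAb_le [Finite G] (s : f.Gens) {p : ℕ} (hp : p.Prime)
    (hG : IsSigma {p} (Nat.card G)) (hs : s.Regular p) :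
    ∃ f' : MetacyclicFact G, Nat.card f'.A * expAb G ≤ Nat.card G := by
  obtain ⟨h1, h2⟩ := hs
  obtain ⟨σ, hσ, -⟩ := s.exists_pow_index
  have cm := hG.of_dvd f.A.card_subgroup_dvd_card
  obtain ⟨μ, hμ⟩ := cm.exists_eq_pow Nat.card_pos.ne'
  have hn0 : f.A.index ≠ 0 := Subgroup.index_ne_zero_of_finite
  obtain ⟨ν, hν⟩ := (hG.of_dvd f.A.index_dvd_card).exists_eq_pow hn0
  have hr0 : s.r ≠ 0 := fun h => Nat.card_pos.ne' (Nat.eq_zero_of_zero_dvd (h ▸ s.r_dvd))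
  have hg0 : Int.gcd s.r σ ≠ 0 := by
    rw [Ne, Int.gcd_eq_zero_iff]
    exact fun h => hr0 (by exact_mod_cast h.1)
  have hgr : Int.gcd s.r σ ∣ s.r := by exact_mod_cast Int.gcd_dvd_left (s.r : ℤ) σ
  obtain ⟨j, hj⟩ := (cm.of_dvd (hgr.trans s.r_dvd)).exists_eq_pow hg0
  rw [hj] at hgr
  obtain ⟨r', hr'⟩ := hgr
  have hσd : (p : ℤ) ^ j ∣ σ := by
    have := Int.gcd_dvd_right (s.r : ℤ) σ
    rw [hj] at this
    exact_mod_cast this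
  obtain ⟨σ', hσ'⟩ := hσd
  have ham : s.a ^ p ^ μ = 1 := by rw [← hμ, ← s.orderOf_a, pow_orderOf_eq_one]
  have hrZ : (s.r : ℤ) = (p : ℤ) ^ j * r' := by rw [hr']; push_cast; rfl
  have hpj : 0 < p ^ j := Nat.pow_pos hp.pos
  by_cases hjν : j ≤ ν
  · obtain ⟨n', hn'⟩ : p ^ j ∣ f.A.index := hν ▸ pow_dvd_pow p hjν
    have hn'0 : 0 < n' := Nat.pos_of_ne_zero fun h => hn0 (by rw [hn', h, mul_zero])
    by_cases hjr : r' = 1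
    · refine ⟨f, ?_⟩
      have hE : expAb G ∣ f.A.index := by
        refine s.expAb_dvd (by rw [hr', hjr, mul_one, hn']; exact dvd_mul_right _ _) ?_
        rw [hσ, s.zpow_mem_commutator_iff, hrZ, hjr, hσ']
        simp
      calc _ ≤ Nat.card f.A * f.A.index :=
            Nat.mul_le_mul_left _ (Nat.le_of_dvd (Nat.pos_of_ne_zero hn0) hE)
        _ = _ := f.A.card_mul_index
    · have hpr' : p ∣ r' := by
        have := cm.of_dvd ((Dvd.intro_left (p ^ j) hr'.symm : r' ∣ s.r).trans s.r_dvd)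
        obtain ⟨q, hq, hqd⟩ := Nat.exists_prime_and_dvd hjr
        exact this q hq hqd ▸ hqd
      have hpσ' : ¬ (p : ℤ) ∣ σ' := by
        intro h
        have h3 : ((p ^ (j + 1) : ℕ) : ℤ) ∣ Int.gcd s.r σ := by
          refine Int.dvd_coe_gcd ?_ ?_
          · rw [hrZ, pow_succ]
            push_cast
            exact mul_dvd_mul_left _ (by exact_mod_cast hpr')
          · rw [hσ', pow_succ]
            push_cast
            exact mul_dvd_mul_left _ h
        rw [hj, Int.natCast_dvd_natCast, Nat.pow_dvd_pow_iff_le_right hp.one_lt] at h3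
        omega
      have hv := zpow_mul_pow_eq s.mul_eq 1 n'
      rw [zpow_one, one_mul] at hv
      have hd : s.u - 1 ∣ s.u ^ n' - 1 := by simpa using sub_dvd_pow_sub_pow s.u 1 n'
      obtain ⟨x, hx, hpx⟩ := exists_twist hp (k := j) (r := s.r) (c := r' - σ') ham hv (h1.trans hd)
        (fun h => (h2 h).trans hd) (by rw [← pow_mul, mul_comm, ← hn', hσ])
        (by rw [hrZ, hσ']; ring)
      have hpx' : ¬ (p : ℤ) ∣ x := fun h => hpσ' (by
        have h5 : (p : ℤ) ∣ r' := by exact_mod_cast hpr'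
        exact (dvd_sub_right h5).1 (hpx h))
      refine s.exists_fact_of_twist (c := s.b ^ n' * s.a ^ x) (d := s.b) hpj hx ?_
        (E := n' * s.r) (s.expAb_dvd (dvd_mul_left _ _) ?_)
        (Nat.mul_pos hn'0 (Nat.pos_of_ne_zero hr0)) (by rw [hn']; ring)
      · have hb : s.b ∈ Subgroup.closure {s.b ^ n' * s.a ^ x, s.b} :=
          Subgroup.subset_closure (by simp)
        have hc : s.b ^ n' * s.a ^ x ∈ Subgroup.closure {s.b ^ n' * s.a ^ x, s.b} :=
          Subgroup.subset_closure (by simp)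
        refine s.eq_top ?_ hb
        have hax := (Subgroup.mul_mem_cancel_left _ (pow_mem hb n')).1 hc
        have hcop : IsCoprime x ((p : ℤ) ^ μ) :=
          (((Nat.prime_iff_prime_int.1 hp).coprime_iff_not_dvd).2 hpx').symm.pow_right
        obtain ⟨α, β, hαβ⟩ := hcop
        have h6 : (s.a ^ x) ^ α = s.a ^ (1 : ℤ) := by
          rw [← zpow_mul, s.zpow_eq_iff, hμ]
          refine ⟨-β, ?_⟩
          push_cast
          linear_combination hαβ
        have h7 := zpow_mem hax α
        rwa [h6, zpow_one] at h7
      · rw [hr', show n' * (p ^ j * r') = (p ^ j * n') * r' by ring, ← hn', pow_mul, hσ,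
          ← zpow_natCast, ← zpow_mul, s.zpow_mem_commutator_iff, hrZ, hσ']
        exact ⟨σ', by ring⟩
  · have hνj : ν ≤ j := by omega
    obtain ⟨e, rfl⟩ := Nat.exists_eq_add_of_le hνj
    obtain ⟨x, hx, -⟩ := exists_twist hp (k := ν) (r := s.r) (c := (p : ℤ) ^ e * (r' - σ')) ham
      s.mul_eq h1 h2 (by rw [← hν, hσ]) (by rw [hrZ, hσ']; ring)
    refine s.exists_fact_of_twist (c := s.b * s.a ^ x) (d := s.a) (Nat.pow_pos hp.pos) hx ?_
        (E := s.r) (s.expAb_dvd dvd_rfl ?_) (Nat.pos_of_ne_zero hr0) (by rw [hν])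
    · have ha : s.a ∈ Subgroup.closure {s.b * s.a ^ x, s.a} :=
        Subgroup.subset_closure (by simp)
      have hc : s.b * s.a ^ x ∈ Subgroup.closure {s.b * s.a ^ x, s.a} :=
        Subgroup.subset_closure (by simp)
      exact s.eq_top ha ((Subgroup.mul_mem_cancel_right _ (zpow_mem ha x)).1 hc)
    · rw [hr', show p ^ (ν + e) * r' = f.A.index * (p ^ e * r') by rw [hν]; ring, pow_mul, hσ,
        ← zpow_natCast, ← zpow_mul, s.zpow_mem_commutator_iff, hrZ, hσ']
      exact ⟨p ^ e * σ', by push_cast; ring⟩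

lemma MetacyclicFact.Gens.two_dvd_index [Finite G] (s : f.Gens) (hG : IsSigma {2} (Nat.card G))
    (h4 : 4 ∣ Nat.card f.A) (hu : (4 : ℤ) ∣ s.u + 1) : 2 ∣ f.A.index := by
  obtain ⟨ν, hν⟩ := (hG.of_dvd f.A.index_dvd_card).exists_eq_pow Subgroup.index_ne_zero_of_finite
  rw [hν]
  refine dvd_pow_self 2 ?_
  rintro rfl
  obtain ⟨σ, hσ, -⟩ := s.exists_pow_index
  rw [hν, pow_zero, pow_one] at hσ
  have h := s.mul_eq
  rw [hσ, ← zpow_add, ← zpow_one_add, s.zpow_eq_iff] at h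
  have h5 : (4 : ℤ) ∣ 1 + σ - (σ + s.u) := (by exact_mod_cast h4 : (4 : ℤ) ∣ _).trans h
  omega

lemma MetacyclicFact.Gens.r_dvd_two [Finite G] (s : f.Gens) (hG : IsSigma {2} (Nat.card G))
    (hu : (4 : ℤ) ∣ s.u + 1) : s.r ∣ 2 := by
  have hr0 : s.r ≠ 0 := fun h => Nat.card_pos.ne' (Nat.eq_zero_of_zero_dvd (h ▸ s.r_dvd))
  obtain ⟨ρ, hρ⟩ := (hG.of_dvd (s.r_dvd.trans f.A.card_subgroup_dvd_card)).exists_eq_pow hr0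
  have hru : (s.r : ℤ) ∣ s.u - 1 := Int.gcd_dvd_left _ _
  rw [hρ]
  refine pow_dvd_pow (n := 1) 2 ?_
  by_contra hlt
  have h4 : (4 : ℤ) ∣ s.r := by
    rw [hρ]
    exact_mod_cast pow_dvd_pow 2 (show 2 ≤ ρ by omega)
  have := h4.trans hru
  omega

lemma MetacyclicFact.Gens.expAb_dvd_index [Finite G] (s : f.Gens) (hG : IsSigma {2} (Nat.card G))
    (h4 : 4 ∣ Nat.card f.A) (hu : (4 : ℤ) ∣ s.u + 1) : expAb G ∣ f.A.index := by
  obtain ⟨σ, hσ, hσ'⟩ := s.exists_pow_index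
  have hr2 := s.r_dvd_two hG hu
  refine s.expAb_dvd (hr2.trans (s.two_dvd_index hG h4 hu)) ?_
  rw [hσ, s.zpow_mem_commutator_iff]
  refine (by exact_mod_cast hr2 : (s.r : ℤ) ∣ 2).trans ?_
  obtain ⟨c, hc⟩ : (4 : ℤ) ∣ σ * (s.u - 1) := (by exact_mod_cast h4 : (4 : ℤ) ∣ _).trans hσ'
  obtain ⟨d, hd⟩ := hu
  have : s.u - 1 = 2 * (2 * d - 1) := by linarith
  rw [this] at hc
  exact ⟨σ * d - c, by linarith⟩

lemma IsMinimalFact.card_mul_expAb [Finite G] {p : ℕ} (hp : p.Prime)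
    (hG : IsSigma {p} (Nat.card G)) (hf : IsMinimalFact f) :
    Nat.card f.A * expAb G = Nat.card G := by
  apply le_antisymm
  · obtain ⟨s, hs | ⟨rfl, h4, hu⟩⟩ := f.exists_gens_regular_or hp hG
    · obtain ⟨f', hf'⟩ := s.exists_card_mul_expAb_le hp hG hs
      refine le_trans (Nat.mul_le_mul_right _ ?_) hf'
      rcases hf f' with h | h
      · exact h.le
      · exact h.1.le
    · rw [← f.A.card_mul_index]
      exact Nat.mul_le_mul_left _ (Nat.le_of_dvd
        (Nat.pos_of_ne_zero Subgroup.index_ne_zero_of_finite) (s.expAb_dvd_index hG h4 hu))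
  · rw [← f.A.card_mul_index]
    exact Nat.mul_le_mul_left _ (Nat.le_of_dvd (Nat.pos_of_ne_zero expAb_ne_zero)
      f.index_dvd_expAb)

end MinimalOrder

section ROfA

variable {f : MetacyclicFact G}

lemma MetacyclicFact.Gens.exists_eq_pow [Finite G] (s : f.Gens) (g : G) :
    ∃ (i : ℤ) (j : ℕ), g = s.a ^ i * s.b ^ j := by
  obtain ⟨i, j, rfl⟩ := s.exists_eq g
  obtain ⟨k, hk⟩ : s.b ^ j ∈ Submonoid.powers s.b :=
    mem_powers_iff_mem_zpowers.2 ⟨j, rfl⟩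
  exact ⟨i, k, by rw [← hk]⟩

lemma natCast_eq_neg_one_iff_dvd {d t : ℕ} : (t : ZMod d) = -1 ↔ (d : ℤ) ∣ (t : ℤ) + 1 := by
  rw [← ZMod.intCast_zmod_eq_zero_iff_dvd]
  push_cast
  rw [eq_neg_iff_add_eq_zero]

lemma MetacyclicFact.Gens.pmOneAt_iff [Finite G] (s : f.Gens) {q k : ℕ} :
    PMOneAt f.A q k ↔ q ^ k ∣ Nat.card f.A ∧
      (((q ^ k : ℕ) : ℤ) ∣ s.u - 1 ∨ (q = 2 ∧ ((q ^ k : ℕ) : ℤ) ∣ s.u + 1)) := by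
  have := f.normalA
  have := f.cyclicA
  have ha : s.a ∈ f.A := s.zpowers_a ▸ Subgroup.mem_zpowers _
  refine and_congr_right fun hd => ?_
  have hd' : ((q ^ k : ℕ) : ℤ) ∣ Nat.card f.A := Int.natCast_dvd_natCast.2 hd
  simp only [natCast_eq_one_iff_dvd, natCast_eq_neg_one_iff_dvd]
  have key : ∀ (i : ℤ) (j t : ℕ), ConjActsAsPow f.A (s.a ^ i * s.b ^ j) t →
      ((q ^ k : ℕ) : ℤ) ∣ s.u ^ j - t := by
    intro i j t ht
    refine hd'.trans ((s.zpow_eq_iff _ _).1 ?_)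
    have h1 := zpow_mul_pow_eq s.mul_eq 1 j
    rw [zpow_one, one_mul] at h1
    rw [zpow_natCast, ← ht s.a ha, eq_comm]
    calc _ = (s.b ^ j)⁻¹ * (s.a * s.b ^ j) := by group
      _ = _ := by rw [h1]; group
  constructor
  · intro h
    obtain ⟨t, ht⟩ := exists_conjActsAsPow f.A s.b
    have h1 := key 0 1 t (by simpa using ht)
    rw [pow_one] at h1
    rcases h s.b t ht with h2 | ⟨h2, h3⟩
    · left
      simpa using dvd_add h1 h2
    · right
      refine ⟨h2, ?_⟩
      have := dvd_add h1 h3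
      rwa [show s.u - t + (t + 1) = s.u + 1 by ring] at this
  · intro h g t ht
    obtain ⟨i, j, rfl⟩ := s.exists_eq_pow g
    have h1 := key i j t ht
    rcases h with h | ⟨rfl, h⟩
    · left
      have h2 : s.u - 1 ∣ s.u ^ j - 1 := by simpa using sub_dvd_pow_sub_pow s.u 1 j
      have := dvd_sub (h.trans h2) h1
      rwa [show s.u ^ j - 1 - (s.u ^ j - t) = (t : ℤ) - 1 by ring] at this
    · have h2 : s.u + 1 ∣ s.u ^ j - (-1) ^ j := by
        simpa using sub_dvd_pow_sub_pow s.u (-1) j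
      have := dvd_sub (h.trans h2) h1
      rw [show s.u ^ j - (-1) ^ j - (s.u ^ j - t) = (t : ℤ) - (-1) ^ j by ring] at this
      rcases Nat.even_or_odd j with hj | hj
      · left
        rwa [hj.neg_one_pow] at this
      · right
        rw [hj.neg_one_pow, sub_neg_eq_add] at this
        exact ⟨rfl, this⟩

lemma MetacyclicFact.Gens.rOfA_eq_of_regular [Finite G] (s : f.Gens) {p : ℕ}
    (hG : IsSigma {p} (Nat.card G)) (hs : s.Regular p) : rOfA f.A = s.r := by
  have := f.normalA
  have := f.cyclicA
  refine eq_of_prime_pow_dvd_iff fun q k hq => ?_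
  rw [prime_pow_dvd_rOfA_iff f.A hq, s.pmOneAt_iff]
  have h0 : q ^ k ∣ s.r ↔ q ^ k ∣ Nat.card f.A ∧ ((q ^ k : ℕ) : ℤ) ∣ s.u - 1 := by
    rw [← Int.natCast_dvd_natCast, MetacyclicFact.Gens.r, Int.dvd_coe_gcd_iff,
      Int.natCast_dvd_natCast, and_comm]
  rw [h0]
  refine and_congr_right fun hd => ⟨?_, Or.inl⟩
  rintro (h | ⟨rfl, h⟩)
  · exact h
  · rcases Nat.eq_zero_or_pos k with rfl | hk
    · simp
    · have hp2 : 2 = p := hG 2 hq ((dvd_pow_self 2 hk.ne').trans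
        (hd.trans f.A.card_subgroup_dvd_card))
      have h4 := hs.2 hp2.symm
      have hk1 : k = 1 := by
        by_contra hne
        have : ((4 : ℕ) : ℤ) ∣ ((2 ^ k : ℕ) : ℤ) :=
          Int.natCast_dvd_natCast.2 (pow_dvd_pow 2 (show 2 ≤ k by omega))
        have := this.trans h
        push_cast at this
        omega
      subst hk1
      push_cast
      omega

/-- The analogue of `Gens.r` for the exponent `-u`. -/
def MetacyclicFact.Gens.rNeg (s : f.Gens) : ℕ := Int.gcd (s.u + 1) (Nat.card f.A)

lemma MetacyclicFact.Gens.rOfA_eq_of_four_dvd [Finite G] (s : f.Gens)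
    (hG : IsSigma {2} (Nat.card G)) (hu : (4 : ℤ) ∣ s.u + 1) : rOfA f.A = s.rNeg := by
  have := f.normalA
  have := f.cyclicA
  refine eq_of_prime_pow_dvd_iff fun q k hq => ?_
  rw [prime_pow_dvd_rOfA_iff f.A hq, s.pmOneAt_iff]
  have h0 : q ^ k ∣ s.rNeg ↔ q ^ k ∣ Nat.card f.A ∧ ((q ^ k : ℕ) : ℤ) ∣ s.u + 1 := by
    rw [← Int.natCast_dvd_natCast, MetacyclicFact.Gens.rNeg, Int.dvd_coe_gcd_iff,
      Int.natCast_dvd_natCast, and_comm]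
  rw [h0]
  refine and_congr_right fun hd => ?_
  rcases Nat.eq_zero_or_pos k with rfl | hk
  · simp
  have hp2 : q = 2 := hG q hq ((dvd_pow_self q hk.ne').trans
    (hd.trans f.A.card_subgroup_dvd_card))
  subst hp2
  refine ⟨?_, fun h => Or.inr ⟨rfl, h⟩⟩
  rintro (h | ⟨-, h⟩)
  · have hk1 : k = 1 := by
      by_contra hne
      have : ((4 : ℕ) : ℤ) ∣ ((2 ^ k : ℕ) : ℤ) :=
        Int.natCast_dvd_natCast.2 (pow_dvd_pow 2 (show 2 ≤ k by omega))
      have := this.trans h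
      push_cast at this
      omega
    subst hk1
    push_cast
    omega
  · exact h

lemma MetacyclicFact.Gens.r_eq_two [Finite G] (s : f.Gens) (hG : IsSigma {2} (Nat.card G))
    (h4 : 4 ∣ Nat.card f.A) (hu : (4 : ℤ) ∣ s.u + 1) : s.r = 2 := by
  refine Nat.dvd_antisymm (s.r_dvd_two hG hu) ?_
  rw [← Int.natCast_dvd_natCast, MetacyclicFact.Gens.r, Int.dvd_coe_gcd_iff]
  exact ⟨by push_cast; omega, by push_cast; omega⟩

end ROfA

section LinearCount

lemma natCast_dvd_intCast_zmod {m g : ℕ} (hgm : g ∣ m) (x : ℤ) :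
    (g : ZMod m) ∣ (x : ZMod m) ↔ (g : ℤ) ∣ x := by
  constructor
  · rintro ⟨c, hc⟩
    obtain ⟨c, rfl⟩ := ZMod.intCast_surjective c
    have h : ((x - g * c : ℤ) : ZMod m) = 0 := by
      push_cast
      rw [hc, sub_self]
    rw [ZMod.intCast_zmod_eq_zero_iff_dvd] at h
    exact (dvd_sub_left (dvd_mul_right _ _)).1 ((Int.natCast_dvd_natCast.2 hgm).trans h)
  · rintro ⟨c, rfl⟩
    exact ⟨c, by push_cast; rfl⟩

lemma card_linear_eq {m : ℕ} [NeZero m] {g : ℕ} (hgm : g ∣ m) {α γ x y : ZMod m}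
    (τ : ZMod m) (hα : (g : ZMod m) ∣ α) (hγ : (g : ZMod m) ∣ γ)
    (hb : (g : ZMod m) = α * x + γ * y) :
    Nat.card {p : ZMod m × ZMod m // τ + p.1 * α + p.2 * γ = 0} =
      if (g : ZMod m) ∣ τ then m * g else 0 := by
  split_ifs with h
  · obtain ⟨t, rfl⟩ := h
    let φ : ZMod m × ZMod m →+ ZMod m :=
      { toFun := fun p => p.1 * α + p.2 * γ
        map_zero' := by simp
        map_add' := fun p q => by simp only [Prod.fst_add, Prod.snd_add]; ring }
    have hφ : ∀ p, φ p = p.1 * α + p.2 * γ := fun _ => rfl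
    have e1 : {p : ZMod m × ZMod m // (g : ZMod m) * t + p.1 * α + p.2 * γ = 0} ≃ φ.ker := by
      refine Equiv.trans (Equiv.subtypeEquivRight fun p => ?_)
        (AddMonoidHom.fiberEquivKer φ (-(t * x), -(t * y)))
      rw [Set.mem_preimage, Set.mem_singleton_iff, hφ, hφ, hb]
      constructor
      · intro h
        linear_combination h
      · intro h
        linear_combination h
    have hr : φ.range = AddSubgroup.zmultiples (g : ZMod m) := by
      ext z
      rw [AddMonoidHom.mem_range, AddSubgroup.mem_zmultiples_iff]
      constructor
      · rintro ⟨p, rfl⟩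
        obtain ⟨c, rfl⟩ := hα
        obtain ⟨d, rfl⟩ := hγ
        obtain ⟨k, hk⟩ := ZMod.intCast_surjective (p.1 * c + p.2 * d)
        refine ⟨k, ?_⟩
        rw [hφ, zsmul_eq_mul, hk]
        ring
      · rintro ⟨k, rfl⟩
        refine ⟨(k * x, k * y), ?_⟩
        rw [hφ, zsmul_eq_mul, hb]
        ring
    have h1 := φ.ker.card_mul_index
    rw [AddSubgroup.index_ker, hr, Nat.card_zmultiples, ZMod.addOrderOf_coe g (NeZero.ne m),
      Nat.gcd_eq_right hgm, Nat.card_prod, Nat.card_zmod] at h1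
    rw [Nat.card_congr e1]
    have hpos : 0 < m / g := Nat.div_pos (Nat.le_of_dvd (NeZero.pos m) hgm)
      (Nat.pos_of_dvd_of_pos hgm (NeZero.pos m))
    refine Nat.eq_of_mul_eq_mul_right hpos ?_
    rw [h1, mul_assoc, Nat.mul_div_cancel' hgm]
  · rw [Nat.card_eq_zero]
    left
    refine ⟨fun ⟨p, hp⟩ => h ?_⟩
    have : τ = -(p.1 * α + p.2 * γ) := by linear_combination hp
    rw [this, dvd_neg]
    exact dvd_add (hα.mul_left _) (hγ.mul_left _)

lemma card_linear_eq_left {m : ℕ} [NeZero m] {α γ : ℤ} (τ : ℤ) {g : ℕ}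
    (hg : Int.gcd α m = g) (hγ : (g : ℤ) ∣ γ) :
    Nat.card {p : ZMod m × ZMod m // (τ : ZMod m) + p.1 * α + p.2 * γ = 0} =
      if (g : ℤ) ∣ τ then m * g else 0 := by
  have hgm : g ∣ m := by
    rw [← Int.natCast_dvd_natCast, ← hg]
    exact Int.gcd_dvd_right _ _
  rw [card_linear_eq hgm (x := (Int.gcdA α m : ℤ)) (y := 0) _ ?_ ?_ ?_]
  · simp only [natCast_dvd_intCast_zmod hgm]
  · rw [natCast_dvd_intCast_zmod hgm, ← hg]
    exact Int.gcd_dvd_left _ _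
  · rwa [natCast_dvd_intCast_zmod hgm]
  · have := congrArg (Int.cast : ℤ → ZMod m) (Int.gcd_eq_gcd_ab α m)
    rw [hg] at this
    push_cast at this
    rw [this]
    simp

lemma card_linear_eq_right {m : ℕ} [NeZero m] {α γ : ℤ} (τ : ℤ) {g : ℕ}
    (hg : Int.gcd γ m = g) (hα : (g : ℤ) ∣ α) :
    Nat.card {p : ZMod m × ZMod m // (τ : ZMod m) + p.1 * α + p.2 * γ = 0} =
      if (g : ℤ) ∣ τ then m * g else 0 := by
  rw [← card_linear_eq_left τ hg hα]
  refine Nat.card_congr ((Equiv.prodComm _ _).subtypeEquiv fun p => ?_)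
  rw [Equiv.prodComm_apply, Prod.fst_swap, Prod.snd_swap, add_right_comm]

end LinearCount

section RealCount

/-- The number of pairs `(z, w)` with `w⁻¹ * z * w = z⁻¹`. -/
def realCount (G : Type*) [Group G] : ℕ :=
  Nat.card {q : G × G // q.1 * q.2 * q.1 = q.2}

variable {f : MetacyclicFact G}

lemma MetacyclicFact.Gens.pow_mem_iff [Finite G] (s : f.Gens) (k : ℕ) :
    s.b ^ k ∈ f.A ↔ f.A.index ∣ k := by
  have := f.normalA
  have hgen : ∀ x : G ⧸ f.A, x ∈ Subgroup.zpowers (s.b : G ⧸ f.A) := by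
    intro x
    obtain ⟨g, rfl⟩ := QuotientGroup.mk_surjective x
    obtain ⟨i, j, rfl⟩ := s.exists_eq g
    refine ⟨j, ?_⟩
    have h : ((s.a ^ i : G) : G ⧸ f.A) = 1 :=
      (QuotientGroup.eq_one_iff _).2 (s.zpowers_a ▸ ⟨i, rfl⟩)
    change (s.b : G ⧸ f.A) ^ j = _
    rw [QuotientGroup.mk_mul, h, one_mul, QuotientGroup.mk_zpow]
  rw [Subgroup.index, ← orderOf_eq_card_of_forall_mem_zpowers hgen, orderOf_dvd_iff_pow_eq_one,
    ← QuotientGroup.mk_pow, QuotientGroup.eq_one_iff]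

/-- The powers of `a`, indexed by residues. -/
def MetacyclicFact.Gens.apow (s : f.Gens) (k : ZMod (Nat.card f.A)) : G := s.a ^ k.val

lemma MetacyclicFact.Gens.apow_intCast [Finite G] (s : f.Gens) (x : ℤ) :
    s.apow x = s.a ^ x := by
  have : NeZero (Nat.card f.A) := ⟨Nat.card_pos.ne'⟩
  rw [MetacyclicFact.Gens.apow, ← zpow_natCast, s.zpow_eq_iff, ← ZMod.intCast_zmod_eq_zero_iff_dvd]
  push_cast
  rw [ZMod.natCast_zmod_val, sub_self]

lemma MetacyclicFact.Gens.bijective_pow_mul_apow [Finite G] (s : f.Gens) :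
    Function.Bijective
      (fun q : Fin f.A.index × ZMod (Nat.card f.A) => s.b ^ (q.1 : ℕ) * s.apow q.2) := by
  have : NeZero (Nat.card f.A) := ⟨Nat.card_pos.ne'⟩
  rw [Nat.bijective_iff_surjective_and_card]
  constructor
  · intro g
    obtain ⟨i, j, rfl⟩ := s.exists_eq_pow g
    obtain ⟨σ, hσ, -⟩ := s.exists_pow_index
    have hlt : j % f.A.index < f.A.index :=
      Nat.mod_lt _ (Nat.pos_of_ne_zero Subgroup.index_ne_zero_of_finite)
    refine ⟨(⟨j % f.A.index, hlt⟩, ((σ * (j / f.A.index : ℕ) + i * s.u ^ j : ℤ) : ZMod _)), ?_⟩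
    change s.b ^ (j % f.A.index) * s.apow _ = _
    rw [s.apow_intCast, zpow_mul_pow_eq s.mul_eq, zpow_add, zpow_mul, ← hσ, zpow_natCast,
      ← pow_mul, ← mul_assoc, ← pow_add, Nat.mod_add_div]
  · rw [Nat.card_prod, Nat.card_zmod, Nat.card_fin, mul_comm, f.A.card_mul_index]

lemma MetacyclicFact.Gens.real_iff (s : f.Gens) (l j : ℕ) (k i : ℤ) :
    (s.b ^ l * s.a ^ k) * (s.b ^ j * s.a ^ i) * (s.b ^ l * s.a ^ k) = s.b ^ j * s.a ^ i ↔
      s.b ^ (2 * l) * s.a ^ (k * (s.u ^ (l + j) + 1) + i * (s.u ^ l - 1)) = 1 := by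
  have h : (s.b ^ l * s.a ^ k) * (s.b ^ j * s.a ^ i) * (s.b ^ l * s.a ^ k) =
      s.b ^ j * (s.b ^ (2 * l) * s.a ^ (k * (s.u ^ (l + j) + 1) + i * (s.u ^ l - 1))) * s.a ^ i := by
    calc _ = s.b ^ l * (s.a ^ k * s.b ^ j) * (s.a ^ i * s.b ^ l) * s.a ^ k := by group
      _ = s.b ^ l * s.b ^ j * (s.a ^ (k * s.u ^ j) * s.b ^ l) * s.a ^ (i * s.u ^ l) * s.a ^ k := by
          rw [zpow_mul_pow_eq s.mul_eq, zpow_mul_pow_eq s.mul_eq]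
          simp only [mul_assoc]
      _ = (s.b ^ l * s.b ^ j * s.b ^ l) * (s.a ^ (k * s.u ^ j * s.u ^ l) * s.a ^ (i * s.u ^ l) *
            s.a ^ k) := by
          rw [zpow_mul_pow_eq s.mul_eq]
          simp only [mul_assoc]
      _ = s.b ^ j * s.b ^ (2 * l) *
            (s.a ^ (k * (s.u ^ (l + j) + 1) + i * (s.u ^ l - 1)) * s.a ^ i) := by
          rw [← pow_add, ← pow_add, ← pow_add, ← zpow_add, ← zpow_add, ← zpow_add]
          congr 2 <;> ring
      _ = _ := by simp only [mul_assoc]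
  rw [h]
  constructor
  · intro h1
    have := mul_right_cancel h1
    exact mul_left_cancel (this.trans (mul_one _).symm)
  · intro h1
    rw [h1, mul_one]

/-- The contribution of the cosets of `b ^ l` and `b ^ j` to `realCount`. -/
def MetacyclicFact.Gens.realTerm (s : f.Gens) (l j : ℕ) : ℕ :=
  Nat.card {p : ZMod (Nat.card f.A) × ZMod (Nat.card f.A) //
    (s.b ^ l * s.apow p.1) * (s.b ^ j * s.apow p.2) * (s.b ^ l * s.apow p.1) =
      s.b ^ j * s.apow p.2}

lemma MetacyclicFact.Gens.realCount_eq [Finite G] (s : f.Gens) :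
    realCount G = ∑ l ∈ Finset.range f.A.index, ∑ j ∈ Finset.range f.A.index, s.realTerm l j := by
  have : NeZero (Nat.card f.A) := ⟨Nat.card_pos.ne'⟩
  let E := Equiv.ofBijective _ s.bijective_pow_mul_apow
  let F : (Fin f.A.index × Fin f.A.index) × (ZMod (Nat.card f.A) × ZMod (Nat.card f.A)) ≃ G × G :=
    (Equiv.prodProdProdComm _ _ _ _).trans (E.prodCongr E)
  have e1 := (F.symm.subtypeEquiv (p := fun q : G × G => q.1 * q.2 * q.1 = q.2)
    (q := fun r => (F r).1 * (F r).2 * (F r).1 = (F r).2) fun q => by simp)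
  have e2 := Equiv.subtypeProdEquivSigmaSubtype
    (fun (a : Fin f.A.index × Fin f.A.index) (b : ZMod (Nat.card f.A) × ZMod (Nat.card f.A)) =>
      (F (a, b)).1 * (F (a, b)).2 * (F (a, b)).1 = (F (a, b)).2)
  rw [realCount, Nat.card_congr (e1.trans e2), Nat.card_sigma, Fintype.sum_prod_type,
    Finset.sum_range]
  refine Finset.sum_congr rfl fun l _ => ?_
  rw [Finset.sum_range]
  rfl

lemma MetacyclicFact.Gens.realTerm_eq_zero [Finite G] (s : f.Gens) {l j : ℕ}
    (h : ¬ f.A.index ∣ 2 * l) : s.realTerm l j = 0 := by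
  rw [MetacyclicFact.Gens.realTerm, Nat.card_eq_zero]
  left
  refine ⟨fun ⟨⟨k, i⟩, hp⟩ => h ?_⟩
  obtain ⟨k, rfl⟩ := ZMod.intCast_surjective k
  obtain ⟨i, rfl⟩ := ZMod.intCast_surjective i
  simp only [s.apow_intCast] at hp
  rw [s.real_iff, mul_eq_one_iff_eq_inv] at hp
  rw [← s.pow_mem_iff, hp, ← s.zpowers_a]
  exact inv_mem ⟨_, rfl⟩

lemma MetacyclicFact.Gens.realTerm_eq_card [Finite G] (s : f.Gens) {l : ℕ} {τ : ℤ}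
    (h : s.b ^ (2 * l) = s.a ^ τ) (j : ℕ) :
    s.realTerm l j = Nat.card {p : ZMod (Nat.card f.A) × ZMod (Nat.card f.A) //
      (τ : ZMod (Nat.card f.A)) + p.1 * (s.u ^ (l + j) + 1 : ℤ) + p.2 * (s.u ^ l - 1 : ℤ) = 0} := by
  refine Nat.card_congr (Equiv.subtypeEquivRight fun p => ?_)
  obtain ⟨k, i⟩ := p
  obtain ⟨k, rfl⟩ := ZMod.intCast_surjective k
  obtain ⟨i, rfl⟩ := ZMod.intCast_surjective i
  simp only [s.apow_intCast]
  rw [s.real_iff, h, ← zpow_add, s.zpow_eq_one_iff, ← ZMod.intCast_zmod_eq_zero_iff_dvd]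
  push_cast
  rw [add_assoc]

end RealCount

section RealCountValue

lemma gcd_eq_two_of_emod {m : ℕ} (hm : IsSigma {2} m) (hm0 : m ≠ 0) (h2 : 2 ∣ m) {x : ℤ}
    (hx : x % 4 = 2) : Int.gcd x m = 2 := by
  have hgm : Int.gcd x m ∣ m := by exact_mod_cast Int.gcd_dvd_right x m
  have hgx : (Int.gcd x m : ℤ) ∣ x := Int.gcd_dvd_left x m
  obtain ⟨k, hk⟩ := (hm.of_dvd hgm).exists_eq_pow (ne_zero_of_dvd_ne_zero hm0 hgm)
  refine Nat.dvd_antisymm ?_ ?_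
  · rw [hk]
    refine pow_dvd_pow (n := 1) 2 ?_
    by_contra hlt
    have h4 : ((4 : ℕ) : ℤ) ∣ Int.gcd x m := by
      rw [hk]
      exact Int.natCast_dvd_natCast.2 (pow_dvd_pow 2 (show 2 ≤ k by omega))
    have := h4.trans hgx
    push_cast at this
    omega
  · rw [← Int.natCast_dvd_natCast, Int.dvd_coe_gcd_iff]
    exact ⟨by push_cast; omega, Int.natCast_dvd_natCast.2 h2⟩

lemma sum_range_two_mul_ite_even (h x y : ℕ) :
    ∑ j ∈ Finset.range (2 * h), (if Even j then x else y) = h * (x + y) := by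
  induction h with
  | zero => simp
  | succ h ih =>
    rw [mul_add_one, Finset.sum_range_succ, Finset.sum_range_succ, ih, if_pos (by simp),
      if_neg (by simp)]
    ring

lemma four_dvd_pow_sub_one {u : ℤ} (hu : (4 : ℤ) ∣ u + 1) {e : ℕ} (he : Even e) :
    (4 : ℤ) ∣ u ^ e - 1 := by
  have h2 : u + 1 ∣ u ^ e - (-1) ^ e := by simpa using sub_dvd_pow_sub_pow u (-1) e
  rw [he.neg_one_pow] at h2
  exact hu.trans h2

lemma gcd_pow_add_one_of_odd {m : ℕ} (hm : IsSigma {2} m) (hm0 : m ≠ 0) {u : ℤ}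
    (hu : (4 : ℤ) ∣ u + 1) {e : ℕ} (he : Odd e) : Int.gcd (u ^ e + 1) m = Int.gcd (u + 1) m := by
  have hS : u ^ e + 1 = (u + 1) * ∑ i ∈ Finset.range e, (-u) ^ i := by
    have := mul_geom_sum (-u) e
    rw [he.neg_pow] at this
    linear_combination this
  have hodd : Odd (∑ i ∈ Finset.range e, (-u) ^ i) := by
    have h1 : (-u) - 1 ∣ ∑ i ∈ Finset.range e, ((-u) ^ i - 1) :=
      Finset.dvd_sum fun i _ => by simpa using sub_dvd_pow_sub_pow (-u) 1 i
    rw [Finset.sum_sub_distrib, Finset.sum_const, Finset.card_range, nsmul_one] at h1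
    have h2 : (2 : ℤ) ∣ -u - 1 := by omega
    have h3 := h2.trans h1
    have h4 : (e : ℤ) % 2 = 1 := by exact_mod_cast Nat.odd_iff.1 he
    rw [Int.odd_iff]
    omega
  refine Nat.dvd_antisymm ?_ ?_
  · rw [← Int.natCast_dvd_natCast, Int.dvd_coe_gcd_iff]
    refine ⟨?_, Int.gcd_dvd_right _ _⟩
    have hgm : Int.gcd (u ^ e + 1) m ∣ m := by exact_mod_cast Int.gcd_dvd_right (u ^ e + 1) m
    obtain ⟨k, hk⟩ := (hm.of_dvd hgm).exists_eq_pow (ne_zero_of_dvd_ne_zero hm0 hgm)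
    have hg : (Int.gcd (u ^ e + 1) m : ℤ) ∣ u ^ e + 1 := Int.gcd_dvd_left _ _
    rw [hk] at hg ⊢
    rw [hS] at hg
    refine IsCoprime.dvd_of_dvd_mul_right ?_ hg
    push_cast
    exact IsCoprime.pow_left (Int.isCoprime_two_left.2 hodd)
  · rw [← Int.natCast_dvd_natCast, Int.dvd_coe_gcd_iff]
    refine ⟨?_, Int.gcd_dvd_right _ _⟩
    rw [hS]
    exact (Int.gcd_dvd_left _ _).mul_right _

variable {f : MetacyclicFact G} (s : f.Gens)

lemma MetacyclicFact.Gens.rNeg_dvd : s.rNeg ∣ Nat.card f.A := by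
  exact_mod_cast Int.gcd_dvd_right (s.u + 1) (Nat.card f.A)

lemma MetacyclicFact.Gens.four_dvd_rNeg (h4 : 4 ∣ Nat.card f.A) (hu : (4 : ℤ) ∣ s.u + 1) :
    4 ∣ s.rNeg := by
  rw [← Int.natCast_dvd_natCast, MetacyclicFact.Gens.rNeg, Int.dvd_coe_gcd_iff]
  exact ⟨hu, Int.natCast_dvd_natCast.2 h4⟩

variable [Finite G]

lemma MetacyclicFact.Gens.card_dvd_two_mul (hG : IsSigma {2} (Nat.card G))
    (hu : (4 : ℤ) ∣ s.u + 1) {σ : ℤ} (hσ : (Nat.card f.A : ℤ) ∣ σ * (s.u - 1)) :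
    (Nat.card f.A : ℤ) ∣ 2 * σ := by
  obtain ⟨μ, hμ⟩ := (hG.of_dvd f.A.card_subgroup_dvd_card).exists_eq_pow Nat.card_pos.ne'
  obtain ⟨d, hd⟩ := hu
  rw [hμ] at hσ ⊢
  have h1 : σ * (s.u - 1) = 2 * σ * (2 * d - 1) := by linear_combination σ * hd
  rw [h1] at hσ
  refine IsCoprime.dvd_of_dvd_mul_right ?_ hσ
  push_cast
  refine IsCoprime.pow_left (Int.isCoprime_two_left.2 ?_)
  rw [Int.odd_iff]
  omega

lemma MetacyclicFact.Gens.realTerm_zero (hG : IsSigma {2} (Nat.card G))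
    (h4 : 4 ∣ Nat.card f.A) (hu : (4 : ℤ) ∣ s.u + 1) (j : ℕ) :
    s.realTerm 0 j = if Even j then Nat.card f.A * 2 else Nat.card f.A * s.rNeg := by
  have : NeZero (Nat.card f.A) := ⟨Nat.card_pos.ne'⟩
  have hm := hG.of_dvd f.A.card_subgroup_dvd_card
  rw [s.realTerm_eq_card (τ := 0) (by simp), zero_add, pow_zero, sub_self]
  split_ifs with hj
  · rw [card_linear_eq_left 0 (gcd_eq_two_of_emod hm Nat.card_pos.ne' (dvd_trans (by norm_num) h4)
      ?_) (dvd_zero _), if_pos (dvd_zero _)]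
    have := four_dvd_pow_sub_one hu hj
    omega
  · rw [card_linear_eq_left 0 (gcd_pow_add_one_of_odd hm Nat.card_pos.ne' hu
      (Nat.not_even_iff_odd.1 hj)) (dvd_zero _), if_pos (dvd_zero _)]
    rfl

lemma MetacyclicFact.Gens.realTerm_one (hG : IsSigma {2} (Nat.card G))
    (h4 : 4 ∣ Nat.card f.A) (hu : (4 : ℤ) ∣ s.u + 1) (hn : f.A.index = 2) (j : ℕ) :
    s.realTerm 1 j = Nat.card f.A * 2 := by
  have : NeZero (Nat.card f.A) := ⟨Nat.card_pos.ne'⟩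
  have hm := hG.of_dvd f.A.card_subgroup_dvd_card
  obtain ⟨σ, hσ, hσ'⟩ := s.exists_pow_index
  have h2 := s.card_dvd_two_mul hG hu hσ'
  have hev : (2 : ℤ) ∣ σ := by
    have : ((4 : ℕ) : ℤ) ∣ 2 * σ := (Int.natCast_dvd_natCast.2 h4).trans h2
    push_cast at this
    omega
  rw [hn] at hσ
  rw [s.realTerm_eq_card (τ := σ) (by simpa using hσ), pow_one,
    card_linear_eq_right σ (gcd_eq_two_of_emod hm Nat.card_pos.ne' (dvd_trans (by norm_num) h4)
      (by omega)), if_pos (by exact_mod_cast hev)]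
  have hodd : Odd (s.u ^ (1 + j)) := Odd.pow (by rw [Int.odd_iff]; omega)
  exact_mod_cast even_iff_two_dvd.1 (hodd.add_odd odd_one)

lemma MetacyclicFact.Gens.realTerm_half (hG : IsSigma {2} (Nat.card G))
    (h4 : 4 ∣ Nat.card f.A) (hu : (4 : ℤ) ∣ s.u + 1) {h : ℕ} (hh : Even h)
    {σ : ℤ} (hσ : s.b ^ (2 * h) = s.a ^ σ) (h2 : (Nat.card f.A : ℤ) ∣ 2 * σ) (j : ℕ) :
    s.realTerm h j = if Even j then Nat.card f.A * 2 else
      if (s.rNeg : ℤ) ∣ σ then Nat.card f.A * s.rNeg else 0 := by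
  have : NeZero (Nat.card f.A) := ⟨Nat.card_pos.ne'⟩
  have hm := hG.of_dvd f.A.card_subgroup_dvd_card
  have hev : (2 : ℤ) ∣ σ := by
    have : ((4 : ℕ) : ℤ) ∣ 2 * σ := (Int.natCast_dvd_natCast.2 h4).trans h2
    push_cast at this
    omega
  rw [s.realTerm_eq_card hσ]
  have hγ := four_dvd_pow_sub_one hu hh
  split_ifs with hj hR
  · rw [card_linear_eq_left σ (gcd_eq_two_of_emod hm Nat.card_pos.ne' (dvd_trans (by norm_num) h4)
      ?_), if_pos (by exact_mod_cast hev)]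
    · push_cast
      omega
    · have := four_dvd_pow_sub_one hu (hh.add hj)
      omega
  all_goals
    have hγ' : (s.rNeg : ℤ) ∣ s.u ^ h - 1 := by
      have h2 : s.u + 1 ∣ s.u ^ h - (-1) ^ h := by simpa using sub_dvd_pow_sub_pow s.u (-1) h
      rw [hh.neg_one_pow] at h2
      exact (Int.gcd_dvd_left _ _).trans h2
    rw [card_linear_eq_left σ (g := s.rNeg) (gcd_pow_add_one_of_odd hm Nat.card_pos.ne' hu
      (hh.add_odd (Nat.not_even_iff_odd.1 hj))) hγ']
  · rw [if_pos hR]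
  · rw [if_neg hR]

lemma MetacyclicFact.Gens.realCount_eq_add {h : ℕ} (hh : 0 < h) (hn : f.A.index = 2 * h) :
    realCount G = ∑ j ∈ Finset.range (2 * h), s.realTerm 0 j +
      ∑ j ∈ Finset.range (2 * h), s.realTerm h j := by
  rw [s.realCount_eq, hn]
  refine Finset.sum_eq_add_of_mem 0 h (Finset.mem_range.2 (by omega))
    (Finset.mem_range.2 (by omega)) hh.ne fun l hl hne => ?_
  refine Finset.sum_eq_zero fun j _ => s.realTerm_eq_zero ?_
  rw [hn]
  rintro ⟨c, hc⟩
  have hl := Finset.mem_range.1 hl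
  have h1 : l = h * c := by linarith
  have hc2 : c < 2 := by
    by_contra hcon
    have := Nat.mul_le_mul_left h (not_lt.1 hcon)
    omega
  interval_cases c <;> omega

lemma MetacyclicFact.Gens.realCount_of_index_eq_two (hG : IsSigma {2} (Nat.card G))
    (h4 : 4 ∣ Nat.card f.A) (hu : (4 : ℤ) ∣ s.u + 1) (hn : f.A.index = 2) :
    realCount G = Nat.card f.A * (6 + s.rNeg) := by
  rw [s.realCount_eq_add one_pos hn]
  simp only [s.realTerm_zero hG h4 hu, s.realTerm_one hG h4 hu hn]
  rw [sum_range_two_mul_ite_even, Finset.sum_const, Finset.card_range]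
  simp only [smul_eq_mul]
  ring

lemma MetacyclicFact.Gens.realCount_of_dvd (hG : IsSigma {2} (Nat.card G))
    (h4 : 4 ∣ Nat.card f.A) (hu : (4 : ℤ) ∣ s.u + 1) {h : ℕ} (hh : Even h) (h0 : 0 < h)
    (hn : f.A.index = 2 * h) {σ : ℤ} (hσ : s.b ^ (2 * h) = s.a ^ σ)
    (h2 : (Nat.card f.A : ℤ) ∣ 2 * σ) (hR : (s.rNeg : ℤ) ∣ σ) :
    realCount G = h * (2 * (Nat.card f.A * (2 + s.rNeg))) := by
  rw [s.realCount_eq_add h0 hn]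
  simp only [s.realTerm_zero hG h4 hu, s.realTerm_half hG h4 hu hh hσ h2, if_pos hR]
  rw [sum_range_two_mul_ite_even]
  ring

lemma MetacyclicFact.Gens.card_eq_four_of_not_dvd (hG : IsSigma {2} (Nat.card G))
    (hf : IsMinimalFact f)
    (h4 : 4 ∣ Nat.card f.A) (hu : (4 : ℤ) ∣ s.u + 1) {h : ℕ} (hh : Even h)
    {σ : ℤ} (hσ : s.b ^ (2 * h) = s.a ^ σ)
    (h2 : (Nat.card f.A : ℤ) ∣ 2 * σ) (hR : ¬ (s.rNeg : ℤ) ∣ σ) : Nat.card f.A = 4 := by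
  have := f.normalA
  have := f.cyclicA
  have hm := hG.of_dvd f.A.card_subgroup_dvd_card
  obtain ⟨μ, hμ⟩ := hm.exists_eq_pow Nat.card_pos.ne'
  obtain ⟨k, hk⟩ := (hm.of_dvd s.rNeg_dvd).exists_eq_pow
    (ne_zero_of_dvd_ne_zero Nat.card_pos.ne' s.rNeg_dvd)
  have hkμ : μ ≤ k := by
    by_contra hlt
    refine hR ?_
    have h1 : ((2 ^ (k + 1) : ℕ) : ℤ) ∣ 2 * σ := by
      refine dvd_trans ?_ h2
      rw [hμ]
      exact Int.natCast_dvd_natCast.2 (pow_dvd_pow 2 (show k + 1 ≤ μ by omega))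
    rw [hk]
    rw [pow_succ', Nat.cast_mul] at h1
    exact (mul_dvd_mul_iff_left (by norm_num)).1 h1
  have hRm : s.rNeg = Nat.card f.A :=
    Nat.dvd_antisymm s.rNeg_dvd (by rw [hk, hμ]; exact pow_dvd_pow 2 hkμ)
  have hum : (Nat.card f.A : ℤ) ∣ s.u + 1 := hRm ▸ Int.gcd_dvd_left _ _
  rw [hRm] at hR
  by_contra hne
  have h8 : 8 ∣ Nat.card f.A := by
    rw [hμ] at h4 hne ⊢
    refine pow_dvd_pow 2 (show 3 ≤ μ from ?_)
    have : 2 ≤ μ := (Nat.pow_dvd_pow_iff_le_right (x := 2) (k := 2) (by norm_num)).1 h4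
    by_contra h3
    exact hne (by rw [show μ = 2 by omega]; norm_num)
  obtain ⟨q, hq⟩ := h8
  obtain ⟨c', hc'⟩ := h2
  have hodd : c' % 2 = 1 := by
    by_contra hev
    refine hR ⟨c' / 2, ?_⟩
    have h3 : c' = 2 * (c' / 2) := by omega
    rw [h3] at hc'
    linarith
  have hσq : s.a ^ σ = s.a ^ (4 * q : ℤ) := by
    rw [s.zpow_eq_iff]
    refine ⟨c' / 2, ?_⟩
    have h3 : c' = 2 * (c' / 2) + 1 := by omega
    rw [h3] at hc'
    rw [hq] at hc' ⊢
    push_cast at hc' ⊢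
    linarith
  have hcomm : Commute s.a (s.b ^ h) := by
    have h1 := zpow_mul_pow_eq s.mul_eq 1 h
    rw [zpow_one, one_mul] at h1
    change s.a * s.b ^ h = s.b ^ h * s.a
    rw [h1]
    congr 1
    conv_rhs => rw [← zpow_one s.a]
    rw [s.zpow_eq_iff]
    have h2 : s.u + 1 ∣ s.u ^ h - (-1) ^ h := by simpa using sub_dvd_pow_sub_pow s.u (-1) h
    rw [hh.neg_one_pow] at h2
    exact hum.trans h2
  have hc2 : (s.a * s.b ^ h) ^ 2 = s.a ^ (2 + 4 * q : ℤ) := by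
    rw [hcomm.mul_pow, ← pow_mul, mul_comm h, hσ, hσq, ← zpow_natCast, ← zpow_add]
    rfl
  have hcm : (s.a * s.b ^ h) ^ Nat.card f.A = 1 := by
    rw [hq, show 8 * q = 2 * (4 * q) by ring, pow_mul, hc2, ← zpow_natCast, ← zpow_mul,
      s.zpow_eq_one_iff, hq]
    push_cast
    exact ⟨1 + 2 * q, by ring⟩
  obtain ⟨f', hf'⟩ := exists_fact_of_generators (c := s.a * s.b ^ h) (d := s.b) (by
    rw [s.commutator_eq_zpowers_r, Subgroup.zpowers_le, s.r_eq_two hG h4 hu]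
    refine ⟨2 * (1 - 2 * q), ?_⟩
    change (s.a * s.b ^ h) ^ (2 * (1 - 2 * (q : ℤ))) = _
    rw [zpow_mul, zpow_ofNat, hc2, ← zpow_mul, ← zpow_natCast, s.zpow_eq_iff, hq]
    push_cast
    exact ⟨-q, by ring⟩) (by
    have hb : s.b ∈ Subgroup.closure {s.a * s.b ^ h, s.b} := Subgroup.subset_closure (by simp)
    have hc : s.a * s.b ^ h ∈ Subgroup.closure {s.a * s.b ^ h, s.b} :=
      Subgroup.subset_closure (by simp)
    exact s.eq_top ((Subgroup.mul_mem_cancel_right _ (pow_mem hb h)).1 hc) hb)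
  have := f'.normalA
  have := f'.cyclicA
  have hle : Nat.card f'.A ≤ Nat.card f.A := by
    rw [hf', Nat.card_zpowers]
    exact orderOf_le_of_pow_eq_one Nat.card_pos hcm
  have hmin := hf f'
  simp only [lex3, factTriple, s.rOfA_eq_of_four_dvd hG hu, hRm] at hmin
  have hcard : Nat.card f'.A = Nat.card f.A := by omega
  have hr := Nat.le_of_dvd Nat.card_pos (rOfA_dvd_card f'.A)
  have hr' : rOfA f'.A = 2 ^ μ := by omega
  have hpm := (prime_pow_dvd_rOfA_iff f'.A Nat.prime_two).1 hr'.symm.dvd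
  obtain ⟨t, ht⟩ := exists_conjActsAsPow f'.A s.b
  have hct := ht (s.a * s.b ^ h) (hf' ▸ Subgroup.mem_zpowers _)
  have hb : s.b⁻¹ * (s.a * s.b ^ h) * s.b = s.a⁻¹ * s.b ^ h := by
    calc _ = s.b⁻¹ * (s.a * s.b) * s.b ^ h := by group
      _ = s.a ^ s.u * s.b ^ h := by rw [s.mul_eq]; group
      _ = _ := by
        congr 1
        rw [← zpow_neg_one, s.zpow_eq_iff]
        simpa using hum
  rw [hb] at hct
  have hpow : ∀ y : ℤ, ((2 ^ μ : ℕ) : ℤ) ∣ t - y → s.a⁻¹ * s.b ^ h = (s.a * s.b ^ h) ^ y := by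
    intro y hy
    rw [hct, ← zpow_natCast, zpow_eq_zpow_iff_modEq, Int.modEq_comm, Int.modEq_iff_dvd]
    refine dvd_trans (Int.natCast_dvd_natCast.2 ?_) hy
    rw [← hμ]
    exact orderOf_dvd_of_pow_eq_one hcm
  rcases hpm.2 s.b t ht with h1 | ⟨-, h1⟩
  · rw [natCast_eq_one_iff_dvd] at h1
    have h3 := hpow 1 h1
    rw [zpow_one, mul_left_inj, ← zpow_neg_one, ← zpow_one s.a, ← zpow_mul, s.zpow_eq_iff, hq] at h3
    obtain ⟨d, hd⟩ := h3
    push_cast at hd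
    generalize (q : ℤ) * d = z at *
    have : (8 : ℤ) * (q * d) = -2 := by linarith
    omega
  · rw [natCast_eq_neg_one_iff_dvd] at h1
    have h3 := hpow (-1) (by simpa using h1)
    rw [zpow_neg_one, hcomm.eq, mul_inv_rev, mul_right_inj, eq_inv_iff_mul_eq_one, ← pow_add,
      ← two_mul, hσ, s.zpow_eq_one_iff] at h3
    exact hR h3

end RealCountValue

section RealCountInvariant

/-- Inversion of group elements, extended linearly to the group algebra. -/
def invMap (G : Type*) [Group G] : MonoidAlgebra ℚ G →ₗ[ℚ] MonoidAlgebra ℚ G where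
  toFun x := .ofCoeff (x.coeff.equivMapDomain (Equiv.inv G))
  map_add' x y := by ext g; simp
  map_smul' c x := by ext g; simp

lemma coeff_invMap (x : MonoidAlgebra ℚ G) (g : G) : (invMap G x).coeff g = x.coeff g⁻¹ := by
  simp [invMap]

lemma invMap_single (g : G) (c : ℚ) :
    invMap G (MonoidAlgebra.single g c) = MonoidAlgebra.single g⁻¹ c := by
  ext h
  rw [coeff_invMap, MonoidAlgebra.coeff_single, MonoidAlgebra.coeff_single, Finsupp.single_apply,
    Finsupp.single_apply]
  simp only [inv_eq_iff_eq_inv]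

lemma invMap_invMap (x : MonoidAlgebra ℚ G) : invMap G (invMap G x) = x := by
  ext h
  simp [coeff_invMap]

lemma conjSum_apply [Fintype G] (x : MonoidAlgebra ℚ G) :
    conjSum G x = ∑ g : G, MonoidAlgebra.single g⁻¹ 1 * (x * MonoidAlgebra.single g 1) := by
  rw [conjSum, LinearMap.sum_apply]
  convert Finset.sum_congr rfl fun g _ => ?_
  simp

lemma conjSum_conjSum [Finite G] (x : MonoidAlgebra ℚ G) :
    conjSum G (conjSum G x) = (Nat.card G : ℚ) • conjSum G x := by
  let := Fintype.ofFinite G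
  have h : ∀ g : G, MonoidAlgebra.single g⁻¹ (1 : ℚ) * (conjSum G x * MonoidAlgebra.single g 1) =
      conjSum G x := by
    intro g
    rw [conjSum_apply x, Finset.sum_mul, Finset.mul_sum]
    refine Fintype.sum_equiv (Equiv.mulRight g) _ _ fun k => ?_
    have h1 : MonoidAlgebra.single (k * g) (1 : ℚ) =
        MonoidAlgebra.single k 1 * MonoidAlgebra.single g 1 := by simp
    have h2 : MonoidAlgebra.single (k * g)⁻¹ (1 : ℚ) =
        MonoidAlgebra.single g⁻¹ 1 * MonoidAlgebra.single k⁻¹ 1 := by simp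
    rw [Equiv.coe_mulRight, h1, h2]
    simp only [mul_assoc]
  rw [conjSum_apply (conjSum G x), Finset.sum_congr rfl fun g _ => h g, Finset.sum_const,
    Finset.card_univ, Nat.card_eq_fintype_card, Nat.cast_smul_eq_nsmul]

lemma invMap_conjSum [Finite G] (x : MonoidAlgebra ℚ G) :
    invMap G (conjSum G x) = conjSum G (invMap G x) := by
  let := Fintype.ofFinite G
  induction x using MonoidAlgebra.induction_linear with
  | zero => simp
  | add f g hf hg => simp [hf, hg]
  | single g a =>
    rw [conjSum_apply, map_sum, invMap_single, conjSum_apply]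
    refine Finset.sum_congr rfl fun h _ => ?_
    simp [invMap_single, mul_assoc]

lemma tau_mul_invMap [Fintype G] (x : MonoidAlgebra ℚ G) :
    tau G (x * invMap G x) = ∑ g : G, x.coeff g ^ 2 := by
  have h : invMap G x = ∑ g : G, x.coeff g • MonoidAlgebra.single g⁻¹ (1 : ℚ) := by
    ext k
    rw [coeff_invMap]
    simp [MonoidAlgebra.coeff_sum, Finsupp.single_apply, inv_eq_iff_eq_inv]
  rw [h, Finset.mul_sum, map_sum]
  refine Finset.sum_congr rfl fun g _ => ?_
  rw [mul_smul_comm, map_smul, tau_mul_single, smul_eq_mul, sq]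

/-- The central elements on which inversion acts as the scalar `ε`. -/
def signedCenter (G : Type*) [Group G] [Finite G] (ε : ℚ) : Submodule ℚ (MonoidAlgebra ℚ G) :=
  LinearMap.ker (conjSum G - (Nat.card G : ℚ) • LinearMap.id) ⊓
    LinearMap.ker (invMap G - ε • LinearMap.id)

/-- The fixed points of the averaging map, that is, the centre of the group algebra. -/
def averagedCenter (G : Type*) [Group G] [Finite G] : Submodule ℚ (MonoidAlgebra ℚ G) :=
  LinearMap.ker (conjSum G - (Nat.card G : ℚ) • LinearMap.id)

lemma mem_averagedCenter [Finite G] {x : MonoidAlgebra ℚ G} :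
    x ∈ averagedCenter G ↔ conjSum G x = (Nat.card G : ℚ) • x := by
  rw [averagedCenter, LinearMap.mem_ker, LinearMap.sub_apply, sub_eq_zero, LinearMap.smul_apply,
    LinearMap.id_apply]

lemma mem_signedCenter [Finite G] {ε : ℚ} {x : MonoidAlgebra ℚ G} :
    x ∈ signedCenter G ε ↔ x ∈ averagedCenter G ∧ invMap G x = ε • x := by
  rw [signedCenter, Submodule.mem_inf]
  refine and_congr_right fun _ => ?_
  rw [LinearMap.mem_ker, LinearMap.sub_apply, sub_eq_zero, LinearMap.smul_apply,
    LinearMap.id_apply]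

lemma finrank_averagedCenter [Finite G] :
    (Module.finrank ℚ (averagedCenter G) : ℚ) * Nat.card G =
      LinearMap.trace ℚ _ (conjSum G) := by
  have hN : (Nat.card G : ℚ) ≠ 0 := Nat.cast_ne_zero.2 Nat.card_pos.ne'
  have hp : LinearMap.IsProj (averagedCenter G) ((Nat.card G : ℚ)⁻¹ • conjSum G) := by
    constructor
    · intro x
      rw [mem_averagedCenter, LinearMap.smul_apply, map_smul, conjSum_conjSum, smul_comm]
    · intro x hx
      rw [LinearMap.smul_apply, mem_averagedCenter.1 hx, inv_smul_smul₀ hN]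
  rw [← hp.trace, map_smul, smul_eq_mul, mul_comm, mul_inv_cancel_left₀ hN]

lemma finrank_signedCenter [Finite G] {ε : ℚ} (hε : ε * ε = 1) :
    (Module.finrank ℚ (signedCenter G ε) : ℚ) * (2 * Nat.card G) =
      LinearMap.trace ℚ _ (conjSum G) +
        ε * LinearMap.trace ℚ _ (invMap G ∘ₗ conjSum G) := by
  have hN : (2 * Nat.card G : ℚ) ≠ 0 :=
    mul_ne_zero two_ne_zero (Nat.cast_ne_zero.2 Nat.card_pos.ne')
  have hp : LinearMap.IsProj (signedCenter G ε)
      ((2 * Nat.card G : ℚ)⁻¹ • (conjSum G + ε • (invMap G ∘ₗ conjSum G))) := by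
    constructor
    · intro x
      rw [LinearMap.smul_apply]
      refine Submodule.smul_mem _ _ ?_
      rw [mem_signedCenter, mem_averagedCenter]
      simp only [LinearMap.add_apply, LinearMap.smul_apply, LinearMap.comp_apply, map_add, map_smul,
        ← invMap_conjSum, conjSum_conjSum, invMap_invMap, smul_add, smul_smul, hε, one_smul]
      refine ⟨by rw [mul_comm ε], add_comm _ _⟩
    · intro x hx
      rw [mem_signedCenter, mem_averagedCenter] at hx
      simp only [LinearMap.add_apply, LinearMap.smul_apply, LinearMap.comp_apply, hx.1, map_smul,
        hx.2, smul_smul, ← add_smul]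
      rw [show (2 * Nat.card G : ℚ)⁻¹ * (Nat.card G + ε * (Nat.card G * ε)) = 1 by
        rw [mul_left_comm ε, hε, mul_one, ← two_mul, inv_mul_cancel₀ hN], one_smul]
  rw [← hp.trace, map_smul, map_add, map_smul, smul_eq_mul, smul_eq_mul, mul_comm,
    mul_inv_cancel_left₀ hN]

lemma trace_invMap_conjSum [Finite G] :
    LinearMap.trace ℚ _ (invMap G ∘ₗ conjSum G) = realCount G := by
  let := Fintype.ofFinite G
  rw [trace_eq_sum, realCount, Nat.card_eq_fintype_card, Fintype.card_subtype,
    Finset.card_filter, Nat.cast_sum, Fintype.sum_prod_type]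
  refine Finset.sum_congr rfl fun g _ => ?_
  rw [LinearMap.comp_apply, conjSum_apply, coeff_invMap, MonoidAlgebra.coeff_sum,
    Finset.sum_apply']
  refine Finset.sum_congr rfl fun h _ => ?_
  rw [MonoidAlgebra.single_mul_single, MonoidAlgebra.single_mul_single]
  have : h⁻¹ * (g * h) = g⁻¹ ↔ g * h * g = h := by
    rw [inv_mul_eq_iff_eq_mul, eq_mul_inv_iff_mul_eq]
  simp [Finsupp.single_apply, this]

variable {H : Type*} [Group H]

lemma finrank_signedCenter_le [Finite G] [Finite H]
    (φ : MonoidAlgebra ℚ G ≃ₐ[ℚ] MonoidAlgebra ℚ H) :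
    Module.finrank ℚ (signedCenter G 1) + Module.finrank ℚ (signedCenter H (-1)) ≤
      Module.finrank ℚ (averagedCenter H) := by
  let := Fintype.ofFinite G
  let := Fintype.ofFinite H
  set V := (signedCenter G 1).map (φ.toLinearEquiv : MonoidAlgebra ℚ G →ₗ[ℚ] MonoidAlgebra ℚ H)
    with hV
  have h1 : Module.finrank ℚ V = Module.finrank ℚ (signedCenter G 1) :=
    LinearEquiv.finrank_map_eq φ.toLinearEquiv _
  have h2 : V ⊓ signedCenter H (-1) = ⊥ := by
    rw [eq_bot_iff]
    rintro x ⟨⟨y, hy, rfl⟩, hx⟩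
    have hy := (mem_signedCenter.1 hy).2
    have hx := (mem_signedCenter.1 hx).2
    change invMap H (φ y) = _ • φ y at hx
    have ey := tau_mul_invMap y
    have ex := tau_mul_invMap (φ y)
    rw [hy, one_smul] at ey
    rw [hx, mul_smul_comm, map_smul, ← map_mul, tau_algEquiv, ey] at ex
    have hp : 0 ≤ ∑ h : H, (φ y).coeff h ^ 2 := Finset.sum_nonneg fun _ _ => sq_nonneg _
    have hq : 0 ≤ ∑ g : G, y.coeff g ^ 2 := Finset.sum_nonneg fun _ _ => sq_nonneg _
    have h0 : ∑ g : G, y.coeff g ^ 2 = 0 := by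
      rw [smul_eq_mul] at ex
      linarith
    have hy0 : y = 0 := by
      ext g
      simpa using (Finset.sum_eq_zero_iff_of_nonneg fun _ _ => sq_nonneg _).1 h0 g
        (Finset.mem_univ g)
    rw [hy0, map_zero]
    exact zero_mem _
  have h3 : V ⊔ signedCenter H (-1) ≤ averagedCenter H := by
    refine sup_le ?_ fun x hx => (mem_signedCenter.1 hx).1
    rintro _ ⟨y, hy, rfl⟩
    have hy := mem_averagedCenter.1 (mem_signedCenter.1 hy).1
    rw [mem_averagedCenter]
    change conjSum H (φ y) = _ • φ y
    rw [conjSum_algEquiv, hy, map_smul, card_eq_of_algEquiv φ]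
  have h4 := Submodule.finrank_sup_add_finrank_inf_eq V (signedCenter H (-1))
  rw [h2, finrank_bot, add_zero, h1] at h4
  rw [← h4]
  exact Submodule.finrank_mono h3

lemma realCount_le_of_algEquiv [Finite G] [Finite H]
    (φ : MonoidAlgebra ℚ G ≃ₐ[ℚ] MonoidAlgebra ℚ H) : realCount G ≤ realCount H := by
  have hN : (0 : ℚ) < 2 * Nat.card H := mul_pos two_pos (Nat.cast_pos.2 Nat.card_pos)
  have h1 : ((Module.finrank ℚ (signedCenter G 1) + Module.finrank ℚ (signedCenter H (-1)) : ℕ) :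
      ℚ) ≤ Module.finrank ℚ (averagedCenter H) := Nat.cast_le.2 (finrank_signedCenter_le φ)
  have e1 := finrank_signedCenter (G := G) (ε := 1) (by norm_num)
  have e2 := finrank_signedCenter (G := H) (ε := -1) (by norm_num)
  have e3 := finrank_averagedCenter (G := H)
  have e4 : LinearMap.trace ℚ _ (conjSum H) = LinearMap.trace ℚ _ (conjSum G) :=
    trace_conj_algEquiv φ (conjSum_algEquiv φ)
  rw [trace_invMap_conjSum] at e1 e2
  rw [card_eq_of_algEquiv φ] at e1
  push_cast at h1
  have h2 := mul_le_mul_of_nonneg_right h1 hN.le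
  rw [← Nat.cast_le (α := ℚ)]
  linarith

lemma realCount_eq_of_algEquiv [Finite G] [Finite H]
    (φ : MonoidAlgebra ℚ G ≃ₐ[ℚ] MonoidAlgebra ℚ H) : realCount G = realCount H :=
  le_antisymm (realCount_le_of_algEquiv φ) (realCount_le_of_algEquiv φ.symm)

lemma realCount_congr (e : G ≃* H) : realCount G = realCount H :=
  Nat.card_congr ((Equiv.prodCongr e.toEquiv e.toEquiv).subtypeEquiv fun q => by
    simp [← map_mul])

lemma realCount_prod : realCount (G × H) = realCount G * realCount H := by
  rw [realCount, realCount, realCount, ← Nat.card_prod]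
  refine Nat.card_congr (Equiv.trans ?_ (Equiv.subtypeProdEquivProd))
  exact (Equiv.prodProdProdComm G H G H).subtypeEquiv fun q => by
    simp [Prod.ext_iff]

lemma realCount_of_odd [Finite G] (hG : ¬ 2 ∣ Nat.card G) : realCount G = Nat.card G := by
  have key : ∀ z w : G, z * w * z = w → z = 1 := by
    intro z w h
    have hodd : ∀ x : G, x ^ 2 = 1 → x = 1 := by
      intro x hx
      have h1 : orderOf x ∣ 2 := orderOf_dvd_of_pow_eq_one hx
      rcases (Nat.dvd_prime Nat.prime_two).1 h1 with h2 | h2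
      · exact orderOf_eq_one_iff.1 h2
      · exact absurd (h2 ▸ orderOf_dvd_natCard x) hG
    have hs : SemiconjBy w z z⁻¹ := by
      change w * z = z⁻¹ * w
      rw [eq_inv_mul_iff_mul_eq, ← mul_assoc, h]
    have hodd' : Odd (orderOf w) := by
      rw [← Nat.not_even_iff_odd, even_iff_two_dvd]
      exact fun h2 => hG (h2.trans (orderOf_dvd_natCard w))
    have hp : ∀ k : ℕ, SemiconjBy (w ^ (2 * k + 1)) z z⁻¹ := by
      intro k
      induction k with
      | zero => simpa using hs
      | succ k ih =>
        have h2 : SemiconjBy w z⁻¹ z := by simpa using hs.inv_right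
        rw [show 2 * (k + 1) + 1 = 1 + 1 + (2 * k + 1) by ring, pow_add, pow_add, pow_one]
        exact (hs.mul_left h2).mul_left ih
    obtain ⟨k, hk⟩ := hodd'
    have h1 := hp k
    rw [← hk, pow_orderOf_eq_one] at h1
    have h3 : z = z⁻¹ := by simpa [SemiconjBy] using h1
    refine hodd z ?_
    rw [sq]
    nth_rewrite 1 [h3]
    exact inv_mul_cancel z
  refine Nat.card_congr ⟨fun q => q.1.2, fun w => ⟨(1, w), by simp⟩, ?_, fun w => rfl⟩
  rintro ⟨⟨z, w⟩, h⟩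
  obtain rfl := key z w h
  rfl

end RealCountInvariant

section Comparison

variable {P Q : Type*} [Group P] [Group Q] [Finite P] [Finite Q]

lemma not_regular_of_four_dvd {f : MetacyclicFact P} {g : MetacyclicFact Q}
    (cP : IsSigma {2} (Nat.card P)) (h4 : 4 ∣ Nat.card f.A)
    (hm : Nat.card f.A = Nat.card g.A)
    (hc : Nat.card (commutator P) = Nat.card (commutator Q))
    (s : f.Gens) (t : g.Gens) (hs : (4 : ℤ) ∣ s.u + 1) : ¬ t.Regular 2 := by
  intro ht
  have h1 := s.card_commutator
  have h2 := t.card_commutator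
  rw [s.r_eq_two cP h4 hs, hc, hm, ← h2] at h1
  have h3 : 2 = t.r := Nat.eq_of_mul_eq_mul_right Nat.card_pos h1
  have h5 : 4 ∣ t.r := by
    rw [← Int.natCast_dvd_natCast, MetacyclicFact.Gens.r, Int.dvd_coe_gcd_iff]
    exact ⟨ht.2 rfl, Int.natCast_dvd_natCast.2 (hm ▸ h4)⟩
  rw [← h3] at h5
  omega

lemma even_of_two_mul_dvd {n h : ℕ} (hn : IsSigma {2} n) (hn0 : n ≠ 0) (hnh : n = 2 * h)
    (hh : h ≠ 1) : Even h := by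
  have h0 : h ≠ 0 := by rintro rfl; exact hn0 (by simpa using hnh)
  obtain ⟨k, rfl⟩ := (hn.of_dvd ⟨2, by rw [hnh, mul_comm]⟩ : IsSigma {2} h).exists_eq_pow h0
  have hk : k ≠ 0 := by rintro rfl; exact hh (pow_zero 2)
  exact (even_two).pow_of_ne_zero hk

lemma rOfA_eq_of_four_dvd_of_four_dvd {f : MetacyclicFact P} {g : MetacyclicFact Q}
    (hf : IsMinimalFact f) (hg : IsMinimalFact g)
    (cP : IsSigma {2} (Nat.card P)) (cQ : IsSigma {2} (Nat.card Q)) (h4 : 4 ∣ Nat.card f.A)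
    (hm : Nat.card f.A = Nat.card g.A) (hn : f.A.index = g.A.index)
    (hreal : realCount P = realCount Q)
    (s : f.Gens) (t : g.Gens) (hs : (4 : ℤ) ∣ s.u + 1) (ht : (4 : ℤ) ∣ t.u + 1) :
    rOfA f.A = rOfA g.A := by
  have h4' : 4 ∣ Nat.card g.A := hm ▸ h4
  have hm0 : 0 < Nat.card g.A := Nat.card_pos
  rw [s.rOfA_eq_of_four_dvd cP hs, t.rOfA_eq_of_four_dvd cQ ht]
  obtain ⟨h, hh⟩ := s.two_dvd_index cP h4 hs
  have hh' : g.A.index = 2 * h := hn ▸ hh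
  have hn0 : f.A.index ≠ 0 := Subgroup.index_ne_zero_of_finite
  by_cases h1 : h = 1
  · rw [s.realCount_of_index_eq_two cP h4 hs (by rw [hh, h1]),
      t.realCount_of_index_eq_two cQ h4' ht (by rw [hh', h1]), hm] at hreal
    have := Nat.eq_of_mul_eq_mul_left hm0 hreal
    omega
  have he : Even h := even_of_two_mul_dvd (cP.of_dvd f.A.index_dvd_card) hn0 hh h1
  have h0 : 0 < h := by omega
  by_cases hm4 : Nat.card f.A = 4
  · have e1 := Nat.dvd_antisymm (hm4 ▸ s.rNeg_dvd) (s.four_dvd_rNeg h4 hs)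
    have e2 := Nat.dvd_antisymm ((hm ▸ hm4) ▸ t.rNeg_dvd) (t.four_dvd_rNeg h4' ht)
    rw [e1, e2]
  obtain ⟨σ, hσ, hσ'⟩ := s.exists_pow_index
  obtain ⟨τ, hτ, hτ'⟩ := t.exists_pow_index
  rw [hh] at hσ
  rw [hh'] at hτ
  have k1 := s.card_dvd_two_mul cP hs hσ'
  have k2 := t.card_dvd_two_mul cQ ht hτ'
  have l1 : (s.rNeg : ℤ) ∣ σ := by
    by_contra hR
    exact hm4 (s.card_eq_four_of_not_dvd cP hf h4 hs he hσ k1 hR)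
  have l2 : (t.rNeg : ℤ) ∣ τ := by
    by_contra hR
    exact hm4 (hm ▸ t.card_eq_four_of_not_dvd cQ hg h4' ht he hτ k2 hR)
  rw [s.realCount_of_dvd cP h4 hs he h0 hh hσ k1 l1,
    t.realCount_of_dvd cQ h4' ht he h0 hh' hτ k2 l2, hm] at hreal
  have := Nat.eq_of_mul_eq_mul_left hm0
    (Nat.eq_of_mul_eq_mul_left two_pos (Nat.eq_of_mul_eq_mul_left h0 hreal))
  omega

lemma IsMinimalFact.rOfA_eq {f : MetacyclicFact P} {g : MetacyclicFact Q}
    (hf : IsMinimalFact f) (hg : IsMinimalFact g) {p : ℕ} (hp : p.Prime)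
    (cP : IsSigma {p} (Nat.card P)) (cQ : IsSigma {p} (Nat.card Q))
    (hPQ : Nat.card P = Nat.card Q) (hm : Nat.card f.A = Nat.card g.A)
    (hc : Nat.card (commutator P) = Nat.card (commutator Q))
    (hreal : p = 2 → realCount P = realCount Q) : rOfA f.A = rOfA g.A := by
  have hn : f.A.index = g.A.index := by
    have h1 := f.A.card_mul_index
    rw [hPQ, ← g.A.card_mul_index, hm] at h1
    exact Nat.eq_of_mul_eq_mul_left Nat.card_pos h1
  obtain ⟨s, hs | ⟨rfl, h4, hs⟩⟩ := f.exists_gens_regular_or hp cP <;>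
    obtain ⟨t, ht | ⟨h2, h4', ht⟩⟩ := g.exists_gens_regular_or hp cQ
  · rw [s.rOfA_eq_of_regular cP hs, t.rOfA_eq_of_regular cQ ht]
    have h1 := s.card_commutator
    rw [hc, hm, ← t.card_commutator] at h1
    exact Nat.eq_of_mul_eq_mul_right Nat.card_pos h1
  · subst h2
    exact absurd hs (not_regular_of_four_dvd cQ h4' hm.symm hc.symm t s ht)
  · exact absurd ht (not_regular_of_four_dvd cP h4 hm hc s t hs)
  · exact rOfA_eq_of_four_dvd_of_four_dvd hf hg cP cQ h4 hm hn (hreal rfl) s t hs ht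

end Comparison

lemma IsSigma.isPGroup {p : ℕ} [Finite G] (h : IsSigma {p} (Nat.card G)) : IsPGroup p G := by
  obtain ⟨k, hk⟩ := h.exists_eq_pow Nat.card_pos.ne'
  exact IsPGroup.of_card hk

lemma prime_dvd_expAb [Finite G] {p : ℕ} (hp : p.Prime) (h : IsSigma {p} (Nat.card G))
    (h1 : Nat.card G ≠ 1) : p ∣ expAb G := by
  have : Fact p.Prime := ⟨hp⟩
  have hne : expAb G ≠ 1 := by
    intro he
    have htop : commutator G = ⊤ := by
      rw [eq_top_iff]
      intro g _
      simpa using expAb_dvd_iff.1 he.dvd g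
    have : Nontrivial G := by
      rw [← Finite.one_lt_card_iff_nontrivial]
      have := Nat.card_pos (α := G)
      omega
    have : Group.IsNilpotent G := h.isPGroup.isNilpotent
    exact (Group.IsSolvable.commutator_lt_top_of_nontrivial G).ne htop
  have hd : expAb G ∣ Nat.card G := expAb_dvd_iff.2 fun g => by
    rw [pow_card_eq_one']; exact one_mem _
  obtain ⟨k, hk⟩ := (h.of_dvd hd).exists_eq_pow expAb_ne_zero
  rw [hk] at hne ⊢
  exact dvd_pow_self p (by rintro rfl; exact hne (pow_zero p))

lemma ordProj_card_of_prod {p : ℕ} (hp : p.Prime) {K L : Type*} [Group K] [Group L] [Finite K]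
    (cK : IsSigma {p} (Nat.card K)) (cL : ¬ p ∣ Nat.card L) (e : K × L ≃* G) :
    ordProj[p] (Nat.card G) = Nat.card K := by
  rw [← Nat.card_congr e.toEquiv, Nat.card_prod]
  exact ordProj_mul_of_isSigma hp Nat.card_pos.ne' cK dvd_rfl cL

section Transfer

variable {H : Type*} [Group H] [Finite G] [Finite H]

lemma expAb_dvd_of_prod {p : ℕ} (hp : p.Prime) {K L Q M : Type*} [Group K] [Group L] [Group Q]
    [Group M] [Finite K] [Finite L] [Finite Q] [Finite M]
    (φ : MonoidAlgebra ℚ G ≃ₐ[ℚ] MonoidAlgebra ℚ H)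
    (cK : IsSigma {p} (Nat.card K)) (cL : ¬ p ∣ Nat.card L) (e : K × L ≃* G)
    (cQ : IsSigma {p} (Nat.card Q)) (cM : ¬ p ∣ Nat.card M) (e' : Q × M ≃* H)
    (hK : Nat.card K ≠ 1) : expAb Q ∣ expAb K := by
  have h1 := expAb_dvd_of_algEquiv φ
  rw [← expAb_prod hp cK cL e, ← expAb_prod hp cQ cM e']
  refine pow_dvd_pow p ?_
  refine ((Nat.factorization_le_iff_dvd expAb_ne_zero
    (Nat.lcm_ne_zero two_ne_zero expAb_ne_zero)).2 h1 p).trans ?_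
  rw [Nat.factorization_lcm two_ne_zero expAb_ne_zero]
  refine sup_le ?_ le_rfl
  by_cases h2 : p = 2
  · subst h2
    rw [hp.factorization_self]
    have h3 := prime_dvd_expAb hp cK hK
    rw [← expAb_prod hp cK cL e] at h3
    exact (hp.dvd_iff_one_le_factorization expAb_ne_zero).1
      (h3.trans (Nat.ordProj_dvd _ _))
  · rw [Nat.factorization_eq_zero_of_not_dvd]
    · exact Nat.zero_le _
    · exact fun h => h2 ((Nat.prime_dvd_prime_iff_eq hp Nat.prime_two).1 h)

lemma realCount_eq_of_prod {K L Q M : Type*} [Group K] [Group L] [Group Q]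
    [Group M] [Finite K] [Finite L] [Finite Q] [Finite M]
    (φ : MonoidAlgebra ℚ G ≃ₐ[ℚ] MonoidAlgebra ℚ H)
    (cL : ¬ 2 ∣ Nat.card L) (e : K × L ≃* G) (cM : ¬ 2 ∣ Nat.card M) (e' : Q × M ≃* H)
    (hLM : Nat.card L = Nat.card M) : realCount K = realCount Q := by
  have h := realCount_eq_of_algEquiv φ
  rw [← realCount_congr e, ← realCount_congr e', realCount_prod, realCount_prod,
    realCount_of_odd cL, realCount_of_odd cM, hLM] at h
  exact Nat.eq_of_mul_eq_mul_right Nat.card_pos h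

end Transfer

lemma nonempty_sylow_mulEquiv_of_prod [Finite G] {p : ℕ} (hp : p.Prime) (P : Sylow p G)
    {K L : Subgroup G} (cK : IsSigma {p} (Nat.card K)) (cL : ¬ p ∣ Nat.card L)
    (e : K × L ≃* G) : Nonempty (P ≃* K) := by
  have : Fact p.Prime := ⟨hp⟩
  have hi : ¬ p ∣ K.index := by
    have h := K.card_mul_index
    rw [← Nat.card_congr e.toEquiv, Nat.card_prod] at h
    rwa [Nat.eq_of_mul_eq_mul_left Nat.card_pos h]
  exact ⟨P.equiv (cK.isPGroup.toSylow hi)⟩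

/-- If `ℚG ≅ ℚH`, `p ∈ π_G` and `(k^G)_p = 1`, then
`(m^G)_p = (m^H)_p = m^{G_p}` and `(r^G)_p = (r^H)_p = r^{G_p}`. -/
theorem p_parts_eq_of_kp_eq_one {G H : Type*} [Group G] [Group H] [Finite G] [Finite H]
    (fG : MetacyclicFact G) (hfG : IsMinimalFact fG)
    (fH : MetacyclicFact H) (hfH : IsMinimalFact fH)
    (h : Nonempty (MonoidAlgebra ℚ G ≃ₐ[ℚ] MonoidAlgebra ℚ H))
    (p : ℕ) (hp : p.Prime) (hppi : p ∈ piSet G) (hkp : ordProj[p] (kOf fG) = 1)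
    (P : Sylow p G) (fP : MetacyclicFact ↥(P : Subgroup G)) (hfP : IsMinimalFact fP) :
    ordProj[p] (mOf fG) = ordProj[p] (mOf fH) ∧ ordProj[p] (mOf fG) = mOf fP ∧
    ordProj[p] (rOf fG) = ordProj[p] (rOf fH) ∧ ordProj[p] (rOf fG) = rOf fP := by
  obtain ⟨φ⟩ := h
  have s1 := fG.splits_singleton hp hkp
  have s2 := fG.splits_compl hppi
  obtain ⟨K, L, cK, cL, ⟨e⟩⟩ := fG.exists_prod_equiv hp s1 s2
  obtain ⟨Q, M, cQ, cM, ⟨e'⟩⟩ := fH.exists_prod_equiv hp (MetacyclicFact.Splits.transfer φ fG fH s1)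
    (MetacyclicFact.Splits.transfer φ fG fH s2)
  obtain ⟨eP⟩ := nonempty_sylow_mulEquiv_of_prod hp P cK cL e
  have hGH := card_eq_of_algEquiv φ
  have hKQ : Nat.card K = Nat.card Q := by
    rw [← ordProj_card_of_prod hp cK cL e, ← ordProj_card_of_prod hp cQ cM e', hGH]
  have hLM : Nat.card L = Nat.card M := by
    rw [← Nat.card_congr e.toEquiv, ← Nat.card_congr e'.toEquiv, Nat.card_prod, Nat.card_prod,
      hKQ] at hGH
    exact Nat.eq_of_mul_eq_mul_left Nat.card_pos hGH
  have hK : Nat.card K ≠ 1 := by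
    intro h1
    have h2 := hppi.2.1
    rw [← Nat.card_congr e.toEquiv, Nat.card_prod, h1, one_mul] at h2
    exact cL h2
  obtain ⟨fQ, hfQ⟩ := exists_isMinimalFact (fH.map ((MonoidHom.fst Q M).comp e'.symm.toMonoidHom)
    (Prod.fst_surjective.comp e'.symm.surjective))
  have iA := fP.normalA
  have iC := fP.cyclicA
  have hfK := hfP.map_equiv eP
  obtain ⟨mG, rG⟩ := hfG.p_parts_eq hp cK cL e hfK
  obtain ⟨mH, rH⟩ := hfH.p_parts_eq hp cQ cM e' hfQ
  have mK : mOf (fP.map eP.toMonoidHom eP.surjective) = mOf fP := card_map_equiv eP fP.A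
  have rK : rOf (fP.map eP.toMonoidHom eP.surjective) = rOf fP := rOfA_map_equiv eP fP.A
  have hexp : expAb K = expAb Q := Nat.dvd_antisymm
    (expAb_dvd_of_prod hp φ.symm cQ cM e' cK cL e (hKQ ▸ hK))
    (expAb_dvd_of_prod hp φ cK cL e cQ cM e' hK)
  have hm : mOf (fP.map eP.toMonoidHom eP.surjective) = mOf fQ := by
    have h1 := hfK.card_mul_expAb hp cK
    rw [hKQ, ← hfQ.card_mul_expAb hp cQ, hexp] at h1
    exact Nat.eq_of_mul_eq_mul_right (Nat.pos_of_ne_zero expAb_ne_zero) h1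
  have hc : Nat.card (commutator K) = Nat.card (commutator Q) := by
    rw [← card_commutator_prod hp cK cL e, ← card_commutator_prod hp cQ cM e',
      card_commutator_eq_of_algEquiv φ]
  have hr : rOf (fP.map eP.toMonoidHom eP.surjective) = rOf fQ :=
    hfK.rOfA_eq hfQ hp cK cQ hKQ hm hc fun h2 => by
      subst h2
      exact realCount_eq_of_prod φ cL e cM e' hLM
  exact ⟨by rw [mG, mH, hm], by rw [mG, mK], by rw [rG, rH, hr], by rw [rG, rK]⟩

end ArXiv230800432
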